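/- Let Δ be a pure simplicial complex on [n] with dim Δ ≥ 2. The following conditions are equivalent: (i) I_Δ^{(m)} is Cohen–Macaulay for every m ≥ 1; (ii) I_Δ^{(m)} is Buchsbaum for some m ≥ 3; (iii) I_Δ^{(m)} is quasi-Buchsbaum for some m ≥ 3; (iv) Δ is a matroid. -/

import Mathlib

open CategoryTheory Opposite

/-! ### Abstract simplicial complexes -/

/-- An abstract simplicial complex on the vertex set `Fin n`: a collection of finite
subsets (faces) closed under taking subsets. -/
structure SimComplex (n : ℕ) where
  faces : Set (Finset (Fin n))
  down_closed : ∀ ⦃F G : Finset (Fin n)⦄, F ∈ faces → G ⊆ F → G ∈ faces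

namespace SimComplex

variable {n : ℕ}

/-- The vertex set of a simplicial complex. -/
def vertexSet (Δ : SimComplex n) : Set (Fin n) := {v | ({v} : Finset (Fin n)) ∈ Δ.faces}

/-- The dimension of a simplicial complex: the maximal cardinality of a face, minus one. -/
noncomputable def dim (Δ : SimComplex n) : ℤ :=
  (Int.ofNat (sSup (Finset.card '' Δ.faces))) - 1

/-- A facet is a maximal face. -/
def IsFacet (Δ : SimComplex n) (F : Finset (Fin n)) : Prop :=
  F ∈ Δ.faces ∧ ∀ G ∈ Δ.faces, F ⊆ G → F = G

/-- A complex is pure if all facets have the same cardinality. -/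
def Pure (Δ : SimComplex n) : Prop :=
  ∀ F G, Δ.IsFacet F → Δ.IsFacet G → F.card = G.card

/-- A matroid: for any two faces `F`, `G` with `|F| > |G|` there is `i ∈ F ∖ G`
with `G ∪ {i}` a face. -/
def IsMatroid (Δ : SimComplex n) : Prop :=
  ∀ F G, F ∈ Δ.faces → G ∈ Δ.faces → G.card < F.card →
    ∃ i ∈ F, i ∉ G ∧ insert i G ∈ Δ.faces

/-- The link of a face `G`: `{F ∖ G : G ⊆ F ∈ Δ}`. -/
def link (Δ : SimComplex n) (G : Finset (Fin n)) : SimComplex n where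
  faces := {F | Disjoint F G ∧ F ∪ G ∈ Δ.faces}
  down_closed := by
    intro F F' hF hsub
    exact ⟨hF.1.mono_left hsub, Δ.down_closed hF.2 (Finset.union_subset_union hsub subset_rfl)⟩

/-- The star of a face `G`: `{F ∈ Δ : F ∪ G ∈ Δ}`. -/
def star (Δ : SimComplex n) (G : Finset (Fin n)) : SimComplex n where
  faces := {F | F ∈ Δ.faces ∧ F ∪ G ∈ Δ.faces}
  down_closed := by
    intro F F' hF hsub
    exact ⟨Δ.down_closed hF.1 hsub, Δ.down_closed hF.2 (Finset.union_subset_union hsub subset_rfl)⟩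

/-- `Δ` is locally a matroid if the link of every vertex is a matroid. -/
def LocallyMatroid (Δ : SimComplex n) : Prop :=
  ∀ v ∈ Δ.vertexSet, (Δ.link {v}).IsMatroid

/-- Two vertices are adjacent if they span a 1-dimensional face (an edge). -/
def Adj (Δ : SimComplex n) (u v : Fin n) : Prop :=
  u ≠ v ∧ ({u, v} : Finset (Fin n)) ∈ Δ.faces

/-- Two vertices are joined by a path of edges. -/
def Reach (Δ : SimComplex n) : Fin n → Fin n → Prop := Relation.ReflTransGen Δ.Adj

/-- A complex is connected if any two vertices are joined by a path of edges. -/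
def Connected (Δ : SimComplex n) : Prop :=
  ∀ u ∈ Δ.vertexSet, ∀ v ∈ Δ.vertexSet, Δ.Reach u v

/-- The induced subcomplex on a set `W` of vertices. -/
def induced (Δ : SimComplex n) (W : Set (Fin n)) : SimComplex n where
  faces := {F | F ∈ Δ.faces ∧ ↑F ⊆ W}
  down_closed := by
    intro F F' hF hsub
    exact ⟨Δ.down_closed hF.1 hsub, subset_trans (Finset.coe_subset.2 hsub) hF.2⟩

/-- The connected component of a vertex `v`, as an induced subcomplex. -/
def component (Δ : SimComplex n) (v : Fin n) : SimComplex n :=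
  Δ.induced {u | Δ.Reach v u}

/-- A minimal nonface: a subset of the vertex set which is not a face, all of whose
proper subsets are faces. -/
def IsMinNonface (Δ : SimComplex n) (F : Finset (Fin n)) : Prop :=
  ↑F ⊆ Δ.vertexSet ∧ F ∉ Δ.faces ∧ ∀ G ⊂ F, G ∈ Δ.faces

/-- A complete intersection complex: the minimal nonfaces are pairwise disjoint. -/
def IsCompleteIntersection (Δ : SimComplex n) : Prop :=
  ∀ F G, Δ.IsMinNonface F → Δ.IsMinNonface G → F ≠ G → Disjoint F G

/-- `Δ` is locally a complete intersection if the link of every vertex is one. -/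
def LocallyCompleteIntersection (Δ : SimComplex n) : Prop :=
  ∀ v ∈ Δ.vertexSet, (Δ.link {v}).IsCompleteIntersection

/-- A path graph: vertices `f 0, …, f (k+1)` and edges exactly the consecutive pairs. -/
def IsPathGraph (Δ : SimComplex n) : Prop :=
  ∃ (k : ℕ) (f : Fin (k + 2) → Fin n), Function.Injective f ∧
    Δ.vertexSet = Set.range f ∧
    ∀ e : Finset (Fin n), (e ∈ Δ.faces ∧ e.card = 2) ↔
      ∃ i : Fin (k + 1), e = {f i.castSucc, f i.succ}

/-- A cycle graph: vertices `f 0, …, f (k+2)` and edges exactly the cyclically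
consecutive pairs. -/
def IsCycleGraph (Δ : SimComplex n) : Prop :=
  ∃ (k : ℕ) (f : Fin (k + 3) → Fin n), Function.Injective f ∧
    Δ.vertexSet = Set.range f ∧
    ∀ e : Finset (Fin n), (e ∈ Δ.faces ∧ e.card = 2) ↔
      ∃ i : Fin (k + 3), e = {f i, f (i + 1)}

end SimComplex

/-! ### Commutative-algebra notions -/

noncomputable section

/-- The `i`-th Ext group of two modules over a commutative ring. -/
def ExtGroup (A : Type) [CommRing A] (i : ℕ) (M N : Type) [AddCommGroup M] [Module A M]
    [AddCommGroup N] [Module A N] : Type :=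
  ((Ext A (ModuleCat A) i).obj (op (ModuleCat.of A M))).obj (ModuleCat.of A N)

/-- A local ring is Cohen–Macaulay if its depth equals its Krull dimension, i.e. if
`Ext^i(residue field, B)` vanishes for all `i < dim B`. -/
def IsCohenMacaulayLocalRing (B : Type) [CommRing B] [IsLocalRing B] : Prop :=
  ∀ i : ℕ, (i : WithBot ℕ∞) < ringKrullDim B →
    Subsingleton (ExtGroup B i (B ⧸ IsLocalRing.maximalIdeal B) B)

/-- A commutative ring is Cohen–Macaulay if all its localizations at primes are
Cohen–Macaulay local rings. -/
def IsCohenMacaulayRing (A : Type) [CommRing A] : Prop :=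
  ∀ (P : Ideal A) (hP : P.IsPrime),
    letI : P.IsPrime := hP
    IsCohenMacaulayLocalRing (Localization.AtPrime P)

/-- An ideal `I` of `A` is Cohen–Macaulay if `A ⧸ I` is a Cohen–Macaulay ring. -/
def IsCohenMacaulayIdeal {A : Type} [CommRing A] (I : Ideal A) : Prop :=
  IsCohenMacaulayRing (A ⧸ I)

/-- The ideal `I` satisfies Serre's condition `(S₂)`: for every prime `P` of `A`, the
depth of the localized module `(A⧸I)_P` over `A_P` is at least `min {2, height P}`,
where the height of `P` is the Krull dimension of `A_P` and depth is detected by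
vanishing of `Ext^i` from the residue field. -/
def SatisfiesS2 {A : Type} [CommRing A] (I : Ideal A) : Prop :=
  ∀ (P : Ideal A) (hP : P.IsPrime),
    letI : P.IsPrime := hP
    ∀ i : ℕ, (i : WithBot ℕ∞) < min 2 (ringKrullDim (Localization.AtPrime P)) →
      Subsingleton (ExtGroup (Localization.AtPrime P) i
        (Localization.AtPrime P ⧸ IsLocalRing.maximalIdeal (Localization.AtPrime P))
        (LocalizedModule P.primeCompl (A ⧸ I)))

/-- The `m`-th symbolic power of an ideal: the intersection of the `m`-th powers of
its minimal primes. -/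
def symbPowIdeal {A : Type} [CommRing A] (I : Ideal A) (m : ℕ) : Ideal A :=
  ⨅ P ∈ I.minimalPrimes, P ^ m

end

/-! ### Stanley–Reisner theory -/

noncomputable section

open MvPolynomial

/-- The squarefree monomial attached to a finite set of variables. -/
def faceMonomial (K : Type) [Field K] {n : ℕ} (F : Finset (Fin n)) : MvPolynomial (Fin n) K :=
  ∏ i ∈ F, X i

/-- The Stanley–Reisner ideal of a complex on `[n]`: generated by the squarefree
monomials corresponding to nonfaces. -/
def SRIdeal (K : Type) [Field K] {n : ℕ} (Δ : SimComplex n) : Ideal (MvPolynomial (Fin n) K) :=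
  Ideal.span {p | ∃ F : Finset (Fin n), F ∉ Δ.faces ∧ p = faceMonomial K F}

/-- The Stanley–Reisner ideal of a complex whose vertex set may be a proper subset of
`[n]`: generated by the squarefree monomials of nonfaces contained in the vertex set. -/
def SRIdealOn (K : Type) [Field K] {n : ℕ} (Δ : SimComplex n) : Ideal (MvPolynomial (Fin n) K) :=
  Ideal.span {p | ∃ F : Finset (Fin n), ↑F ⊆ Δ.vertexSet ∧ F ∉ Δ.faces ∧ p = faceMonomial K F}

/-- The prime ideal generated by the variables indexed by `F`. -/
def PF (K : Type) [Field K] {n : ℕ} (F : Finset (Fin n)) : Ideal (MvPolynomial (Fin n) K) :=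
  Ideal.span ((fun i => (X i : MvPolynomial (Fin n) K)) '' ↑F)

/-- The `m`-th symbolic power of the Stanley–Reisner ideal:
`I_Δ^{(m)} = ⋂_{F facet} P_{complement of F}^m`. -/
def SRSymbPow (K : Type) [Field K] {n : ℕ} (Δ : SimComplex n) (m : ℕ) :
    Ideal (MvPolynomial (Fin n) K) :=
  ⨅ (F : Finset (Fin n)) (_ : Δ.IsFacet F), (PF K Fᶜ) ^ m

/-- The cover ideal `J(Δ) = ⋂_{F facet} P_F` and its symbolic powers. -/
def coverSymbPow (K : Type) [Field K] {n : ℕ} (Δ : SimComplex n) (m : ℕ) :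
    Ideal (MvPolynomial (Fin n) K) :=
  ⨅ (F : Finset (Fin n)) (_ : Δ.IsFacet F), (PF K F) ^ m

/-- The graded maximal ideal `(x_1, …, x_n)`. -/
def maxIdeal (K : Type) [Field K] (n : ℕ) : Ideal (MvPolynomial (Fin n) K) :=
  Ideal.span (Set.range X)

/-- The `i`-th local cohomology module of `S ⧸ I` with support in the maximal
graded ideal. -/
def locCoh (K : Type) [Field K] {n : ℕ} (i : ℕ) (I : Ideal (MvPolynomial (Fin n) K)) :
    ModuleCat (MvPolynomial (Fin n) K) :=
  (localCohomology (maxIdeal K n) i).obj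
    (ModuleCat.of (MvPolynomial (Fin n) K) (MvPolynomial (Fin n) K ⧸ I))

/-- `I` is quasi-Buchsbaum: the maximal ideal annihilates all local cohomology modules
`H^i_m(S⧸I)` for `i < dim S⧸I`. -/
def IsQuasiBuchsbaum (K : Type) [Field K] {n : ℕ} (I : Ideal (MvPolynomial (Fin n) K)) : Prop :=
  ∀ i : ℕ, (i : WithBot ℕ∞) < ringKrullDim (MvPolynomial (Fin n) K ⧸ I) →
    ∀ x ∈ maxIdeal K n, ∀ y : (locCoh K i I), x • y = 0

/-- `I` is Buchsbaum: for `i < dim S⧸I` the natural map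
`Ext^i_S(S⧸m, S⧸I) → H^i_m(S⧸I)` (the structure map into the direct limit defining local
cohomology) is surjective. -/
def IsBuchsbaum (K : Type) [Field K] {n : ℕ} (I : Ideal (MvPolynomial (Fin n) K)) : Prop :=
  ∀ i : ℕ, (i : WithBot ℕ∞) < ringKrullDim (MvPolynomial (Fin n) K ⧸ I) →
    letI := localCohomology.hasColimitDiagram
      (localCohomology.idealPowersDiagram (maxIdeal K n)) i
    Function.Surjective
      ((CategoryTheory.Limits.colimit.ι
          (localCohomology.diagram (localCohomology.idealPowersDiagram (maxIdeal K n)) i)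
          (Opposite.op (Opposite.op (1 : ℕ)))).app
        (ModuleCat.of (MvPolynomial (Fin n) K) (MvPolynomial (Fin n) K ⧸ I)))

/-- `I` is generalized Cohen–Macaulay: the local cohomology modules `H^i_m(S⧸I)` are
finite-dimensional over `K` for `i < dim S⧸I`. -/
def IsGeneralizedCM (K : Type) [Field K] {n : ℕ} (I : Ideal (MvPolynomial (Fin n) K)) : Prop :=
  ∀ i : ℕ, (i : WithBot ℕ∞) < ringKrullDim (MvPolynomial (Fin n) K ⧸ I) →
    Module.Finite K (RestrictScalars K (MvPolynomial (Fin n) K) (locCoh K i I))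

end

/-! ### Monomial ideals -/

/-- A monomial ideal of `K[x_1,…,x_n]`. -/
def IsMonomialIdeal {K : Type} [Field K] {n : ℕ} (I : Ideal (MvPolynomial (Fin n) K)) : Prop :=
  ∃ S : Set (Fin n →₀ ℕ),
    I = Ideal.span {p | ∃ d ∈ S, p = MvPolynomial.monomial d (1 : K)}

/-- A squarefree monomial ideal of `K[x_1,…,x_n]`. -/
def IsSquarefreeMonomialIdeal {K : Type} [Field K] {n : ℕ}
    (I : Ideal (MvPolynomial (Fin n) K)) : Prop :=
  ∃ S : Set (Finset (Fin n)),
    I = Ideal.span {p | ∃ F ∈ S, p = ∏ i ∈ F, (MvPolynomial.X i : MvPolynomial (Fin n) K)}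

namespace EX
noncomputable section
variable {A : Type} [CommRing A]

/-- the cochain map induced by a chain map -/
def yonMap {X X' : ModuleCat.{0} A} (P : ProjectiveResolution X) (Q : ProjectiveResolution X')
    (φ : P.complex ⟶ Q.complex) (Y : ModuleCat.{0} A) :
    Q.complex.linearYonedaObj A Y ⟶ P.complex.linearYonedaObj A Y :=
  (HomologicalComplex.unopFunctor _ _).map
    ((((linearYoneda A (ModuleCat.{0} A)).obj Y).rightOp.mapHomologicalComplex _).map φ).op

theorem cat_aux {D : Type*} [Category D] {a b : Dᵒᵖ} {x y : D} (α : a ≅ op x) (β : b ≅ op y)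
    (g : a ⟶ b) (k : y ⟶ x) (h : g ≫ β.hom = α.hom ≫ k.op) {s t : Dᵒᵖ} (p : s ≅ a) (q : t ≅ b)
    (m : s ⟶ t) (h1 : p.inv ≫ m = g ≫ q.inv) :
    m.unop ≫ p.inv.unop ≫ α.inv.unop = (q.inv.unop ≫ β.inv.unop) ≫ k := by
  have h2 : α.inv ≫ g = k.op ≫ β.inv := by
    rw [Iso.inv_comp_eq, ← Category.assoc, ← h, Category.assoc, Iso.hom_inv_id, Category.comp_id]
  have : (α.inv ≫ p.inv ≫ m).unop = (k.op ≫ β.inv ≫ q.inv).unop := by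
    rw [h1, ← Category.assoc, h2, Category.assoc]
  simpa using this

theorem isoExt_nat {X X' : ModuleCat.{0} A} (f : X ⟶ X') (P : ProjectiveResolution X)
    (Q : ProjectiveResolution X')
    (φ : P.complex ⟶ Q.complex) (comm : φ.f 0 ≫ Q.π.f 0 = P.π.f 0 ≫ f) (Y : ModuleCat.{0} A)
    (i : ℕ) :
    ((Ext A (ModuleCat.{0} A) i).map f.op).app Y ≫ (P.isoExt i Y).hom =
      (Q.isoExt i Y).hom ≫ HomologicalComplex.homologyMap (yonMap P Q φ Y) i :=
  cat_aux ((P.complex.linearYonedaObj A Y).homologyOp i) ((Q.complex.linearYonedaObj A Y).homologyOp i)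
    _ _ (HomologicalComplex.homologyOp_hom_naturality (yonMap P Q φ Y) i)
    (P.isoLeftDerivedObj ((linearYoneda A (ModuleCat A)).obj Y).rightOp i)
    (Q.isoLeftDerivedObj ((linearYoneda A (ModuleCat A)).obj Y).rightOp i) _
    (ProjectiveResolution.isoLeftDerivedObj_inv_naturality f P Q φ comm
    ((linearYoneda A (ModuleCat.{0} A)).obj Y).rightOp i)

/-- `e` is the class of the cocycle `f` -/
def IsCls {X : ModuleCat.{0} A} (P : ProjectiveResolution X) {Y : ModuleCat.{0} A} {i : ℕ}
    (e : ((Ext A (ModuleCat.{0} A) i).obj (op X)).obj Y) (f : P.complex.X i ⟶ Y) : Prop :=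
  ∃ z : (P.complex.linearYonedaObj A Y).cycles i,
    ((P.complex.linearYonedaObj A Y).iCycles i) z = f ∧
    (P.isoExt i Y).hom e = (P.complex.linearYonedaObj A Y).homologyπ i z

variable {X : ModuleCat.{0} A} (P : ProjectiveResolution X) {Y : ModuleCat.{0} A} {i : ℕ}

theorem IsCls.cocycle {e : ((Ext A (ModuleCat.{0} A) i).obj (op X)).obj Y}
    {f : P.complex.X i ⟶ Y} (h : IsCls P e f) : P.complex.d (i+1) i ≫ f = 0 := by
  obtain ⟨z, hz, -⟩ := h
  have := congrArg (fun q => q.hom z) ((P.complex.linearYonedaObj A Y).iCycles_d i (i+1))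
  change ((P.complex.linearYonedaObj A Y).d i (i+1)) (((P.complex.linearYonedaObj A Y).iCycles i) z) = 0 at this
  rw [hz] at this
  exact this

theorem exists_cocycle (e : ((Ext A (ModuleCat.{0} A) i).obj (op X)).obj Y) :
    ∃ f, IsCls P e f := by
  obtain ⟨z, hz⟩ := (ModuleCat.epi_iff_surjective ((P.complex.linearYonedaObj A Y).homologyπ i)).1 inferInstance
    ((P.isoExt i Y).hom e)
  exact ⟨_, z, rfl, hz.symm⟩

theorem exists_cls (f : P.complex.X i ⟶ Y) (hf : P.complex.d (i+1) i ≫ f = 0) :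
    ∃ e : ((Ext A (ModuleCat.{0} A) i).obj (op X)).obj Y, IsCls P e f := by
  let z := (P.complex.linearYonedaObj A Y).cyclesMk (i := i) f (i+1) (by simp) hf
  refine ⟨(P.isoExt i Y).inv ((P.complex.linearYonedaObj A Y).homologyπ i z), z, ?_, ?_⟩
  · exact (P.complex.linearYonedaObj A Y).i_cyclesMk (i := i) f (i+1) (by simp) hf
  · simp

theorem IsCls.smul {e : ((Ext A (ModuleCat.{0} A) i).obj (op X)).obj Y}
    {f : P.complex.X i ⟶ Y} (h : IsCls P e f) (x : A) : IsCls P (x • e) (x • f) := by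
  obtain ⟨z, hz, h⟩ := h
  refine ⟨x • z, ?_, ?_⟩
  · rw [map_smul, hz]; rfl
  · rw [map_smul, map_smul, h]

theorem IsCls.sub {e e' : ((Ext A (ModuleCat.{0} A) i).obj (op X)).obj Y}
    {f f' : P.complex.X i ⟶ Y} (h : IsCls P e f) (h' : IsCls P e' f') : IsCls P (e - e') (f - f') := by
  obtain ⟨z, hz, h⟩ := h
  obtain ⟨z', hz', h'⟩ := h'
  refine ⟨z - z', ?_, ?_⟩
  · rw [map_sub, hz, hz']; rfl
  · rw [map_sub, map_sub, h, h']

/-- coboundaries -/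
def IsBd (f : P.complex.X i ⟶ Y) : Prop := ∃ g : P.complex.X (i-1) ⟶ Y, f = P.complex.d i (i-1) ≫ g

theorem IsCls.eq_zero_iff {e : ((Ext A (ModuleCat.{0} A) i).obj (op X)).obj Y}
    {f : P.complex.X i ⟶ Y} (h : IsCls P e f) : e = 0 ↔ IsBd P f := by
  obtain ⟨z, hz, h⟩ := h
  have h1 : e = 0 ↔ (P.complex.linearYonedaObj A Y).homologyπ i z = 0 := by
    rw [← h]
    constructor
    · rintro rfl; simp
    · intro h
      have := congrArg (P.isoExt i Y).inv h
      simpa using this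
  rw [h1]
  set C := (P.complex.linearYonedaObj A Y) with hC
  have hp : (ComplexShape.up ℕ).prev i = i - 1 := by
    rcases i with _ | i
    · simp
    · simp
  have hex : (ShortComplex.mk (C.toCycles (i-1) i) (C.homologyπ i) (by simp)).Exact :=
    ShortComplex.exact_of_g_is_cokernel _ (C.homologyIsCokernel (i-1) i hp)
  constructor
  · intro h0
    obtain ⟨g, hg⟩ := (ShortComplex.moduleCat_exact_iff _).1 hex z h0
    refine ⟨g, ?_⟩
    rw [← hz, ← hg]
    have := congrArg (fun q => q.hom g) (C.toCycles_i (i-1) i)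
    exact this
  · rintro ⟨g, hg⟩
    have : z = C.toCycles (i-1) i g := by
      apply (ModuleCat.mono_iff_injective (C.iCycles i)).1 inferInstance
      rw [hz, hg]
      have := congrArg (fun q => q.hom g) (C.toCycles_i (i-1) i)
      exact this.symm
    rw [this]
    have := congrArg (fun q => q.hom g) (C.toCycles_comp_homologyπ (i-1) i)
    exact this

theorem IsCls.map {X' : ModuleCat.{0} A} (f : X ⟶ X')
    (Q : ProjectiveResolution X')
    (φ : P.complex ⟶ Q.complex) (comm : φ.f 0 ≫ Q.π.f 0 = P.π.f 0 ≫ f)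
    {e : ((Ext A (ModuleCat.{0} A) i).obj (op X')).obj Y}
    {c : Q.complex.X i ⟶ Y} (h : IsCls Q e c) :
    IsCls P ((((Ext A (ModuleCat.{0} A) i).map f.op).app Y) e) (φ.f i ≫ c) := by
  obtain ⟨z, hz, h⟩ := h
  refine ⟨HomologicalComplex.cyclesMap (yonMap P Q φ Y) i z, ?_, ?_⟩
  · have := congrArg (fun q => q.hom z) (HomologicalComplex.cyclesMap_i (yonMap P Q φ Y) i)
    refine Eq.trans this ?_
    subst hz
    rfl
  · have h1 := congrArg (fun q => q.hom e) (isoExt_nat f P Q φ comm Y i)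
    have h2 := congrArg (fun q => q.hom z) (HomologicalComplex.homologyπ_naturality (yonMap P Q φ Y) i)
    simp only [ModuleCat.hom_comp, LinearMap.comp_apply] at h1 h2
    refine h1.trans ?_
    rw [h, h2]

theorem subsingleton_iff : Subsingleton (((Ext A (ModuleCat.{0} A) i).obj (op X)).obj Y) ↔
    ∀ f : P.complex.X i ⟶ Y, P.complex.d (i+1) i ≫ f = 0 → IsBd P f := by
  constructor
  · intro h f hf
    obtain ⟨e, he⟩ := exists_cls P f hf
    exact (he.eq_zero_iff).1 (Subsingleton.elim _ _)
  · intro h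
    refine subsingleton_of_forall_eq 0 fun e => ?_
    obtain ⟨f, hf⟩ := exists_cocycle P e
    exact hf.eq_zero_iff.2 (h f hf.cocycle)

/-- An element killing `X` kills cocycles modulo coboundaries -/
theorem smul_isBd (x : A) (hx : ∀ y : X, x • y = 0) (f : P.complex.X i ⟶ Y)
    (hf : P.complex.d (i+1) i ≫ f = 0) : IsBd P (x • f) := by
  obtain ⟨e, he⟩ := exists_cls P f hf
  have h1 := IsCls.map P (0 : X ⟶ X) P (x • 𝟙 P.complex) (by
    refine Eq.trans ?_ (Limits.comp_zero).symm
    ext y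
    change (P.π.f 0).hom (x • y) = 0
    rw [map_smul]
    exact hx _) he
  have h2 := IsCls.map P (0 : X ⟶ X) P (0 : P.complex ⟶ P.complex) 
    ((Limits.zero_comp).trans (Limits.comp_zero).symm) he
  have h3 := (h1.sub _ h2).eq_zero_iff.1 (sub_self _)
  simpa using h3

end
end EX

namespace EX
noncomputable section
variable {A : Type} [CommRing A]

/-- vanishing of Ext -/
def EV (A : Type) [CommRing A] (i : ℕ) (L M : Type) [AddCommGroup L] [Module A L]
    [AddCommGroup M] [Module A M] : Prop := Subsingleton (ExtGroup A i L M)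

theorem lift_epi {M M'' N : ModuleCat.{0} A} [Projective N] (g : M ⟶ M'')
    (hg : Function.Surjective g) (h : N ⟶ M'') : ∃ h1 : N ⟶ M, h1 ≫ g = h := by
  have : Epi g := (ModuleCat.epi_iff_surjective g).2 hg
  exact ⟨Projective.factorThru h g, Projective.factorThru_comp _ _⟩

theorem lift_ker {M M' M'' N : ModuleCat.{0} A} (f : M' ⟶ M) (g : M ⟶ M'')
    (hf : Function.Injective f) (hfg : ∀ m, g m = 0 → ∃ m', f m' = m) (h : N ⟶ M)
    (hh : h ≫ g = 0) : ∃ h1 : N ⟶ M', h1 ≫ f = h := by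
  have h0 : ∀ y, g (h y) = 0 := fun y => by
    have := congrArg (fun q => q.hom y) hh
    exact this
  choose s hs using fun y => hfg _ (h0 y)
  refine ⟨ModuleCat.ofHom { toFun := s, map_add' := ?_, map_smul' := ?_ }, ?_⟩
  · intro y z; apply hf; rw [hs, map_add, map_add, hs, hs]
  · intro r y; apply hf; rw [hs, map_smul, RingHom.id_apply, map_smul, hs]
  · ext y; exact hs y

variable {L M M' M'' : Type} [AddCommGroup L] [Module A L] [AddCommGroup M] [Module A M]
  [AddCommGroup M'] [Module A M'] [AddCommGroup M''] [Module A M'']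

theorem EV_iff {i : ℕ} : EV A i L M ↔ ∀ f : (projectiveResolution (ModuleCat.of A L)).complex.X i ⟶ ModuleCat.of A M,
    (projectiveResolution (ModuleCat.of A L)).complex.d (i+1) i ≫ f = 0 → IsBd (projectiveResolution (ModuleCat.of A L)) f :=
  subsingleton_iff _

theorem mono_cancel {N M M' : ModuleCat.{0} A} (f : M' ⟶ M) (hf : Function.Injective f)
    (a b : N ⟶ M') (h : a ≫ f = b ≫ f) : a = b := by
  have := (ModuleCat.mono_iff_injective f).2 hf
  exact (cancel_mono f).1 h

theorem V1 {i : ℕ} (f : M' →ₗ[A] M) (g : M →ₗ[A] M'') (hf : Function.Injective f)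
    (hfg : ∀ m, g m = 0 ↔ ∃ m', f m' = m) (hg : Function.Surjective g)
    (h' : EV A i L M') (h'' : EV A i L M'') : EV A i L M := by
  rw [EV_iff] at *
  set P := projectiveResolution (ModuleCat.of A L)
  intro c hc
  have hfg0 : ModuleCat.ofHom f ≫ ModuleCat.ofHom g = 0 := by
    ext m; exact (hfg _).2 ⟨m, rfl⟩
  obtain ⟨g0, hg0⟩ := h'' (c ≫ ModuleCat.ofHom g) (by rw [← Category.assoc, hc, Limits.zero_comp])
  have := P.projective (i-1)
  obtain ⟨g1, hg1⟩ := lift_epi (ModuleCat.ofHom g) hg g0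
  obtain ⟨c', hc'⟩ := lift_ker (ModuleCat.ofHom f) (ModuleCat.ofHom g) hf (fun m => (hfg m).1)
    (c - P.complex.d i (i-1) ≫ g1) (by
      rw [Preadditive.sub_comp, hg0, Category.assoc, hg1, sub_self])
  obtain ⟨g', hg'⟩ := h' c' (by
    apply mono_cancel (ModuleCat.ofHom f) hf
    rw [Category.assoc, hc', Preadditive.comp_sub, hc, ← Category.assoc, P.complex.d_comp_d, Limits.zero_comp, sub_self, Limits.zero_comp])
  refine ⟨g1 + g' ≫ ModuleCat.ofHom f, ?_⟩
  rw [Preadditive.comp_add, ← Category.assoc, ← hg', hc']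
  abel

theorem V3 {i : ℕ} (f : M' →ₗ[A] M) (g : M →ₗ[A] M'') (hf : Function.Injective f)
    (hfg : ∀ m, g m = 0 ↔ ∃ m', f m' = m) (hg : Function.Surjective g)
    (h' : EV A (i+1) L M') (h : EV A i L M) : EV A i L M'' := by
  rw [EV_iff] at *
  set P := projectiveResolution (ModuleCat.of A L)
  intro c hc
  have hfg0 : ModuleCat.ofHom f ≫ ModuleCat.ofHom g = 0 := by
    ext m; exact (hfg _).2 ⟨m, rfl⟩
  have := P.projective i
  obtain ⟨c1, hc1⟩ := lift_epi (ModuleCat.ofHom g) hg c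
  obtain ⟨c', hc'⟩ := lift_ker (ModuleCat.ofHom f) (ModuleCat.ofHom g) hf (fun m => (hfg m).1)
    (P.complex.d (i+1) i ≫ c1) (by rw [Category.assoc, hc1, hc])
  obtain ⟨g', hg'⟩ := h' c' (by
    apply mono_cancel (ModuleCat.ofHom f) hf
    rw [Category.assoc, hc', ← Category.assoc, P.complex.d_comp_d, Limits.zero_comp, Limits.zero_comp])
  change P.complex.X i ⟶ _ at g'
  change _ = P.complex.d (i+1) i ≫ g' at hg'
  obtain ⟨k, hk⟩ := h (c1 - g' ≫ ModuleCat.ofHom f) (by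
    rw [Preadditive.comp_sub, ← Category.assoc, ← hc', hg', sub_self])
  refine ⟨k ≫ ModuleCat.ofHom g, ?_⟩
  rw [← Category.assoc, ← hk, Preadditive.sub_comp, hc1, Category.assoc, hfg0, Limits.comp_zero, sub_zero]

theorem V2 {i : ℕ} (x : A) (g : M →ₗ[A] M'') (hx : ∀ m : M, x • m = 0 → m = 0)
    (hfg : ∀ m, g m = 0 ↔ ∃ m', x • m' = m) (hg : Function.Surjective g)
    (k : ℕ) (hk : ∀ l : L, x ^ k • l = 0)
    (h'' : ∀ j, j + 1 = i → EV A j L M'') : EV A i L M := by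
  have hinj : Function.Injective (ModuleCat.ofHom (x • (LinearMap.id : M →ₗ[A] M))) := by
    intro a b hab
    have : x • (a - b) = 0 := by
      rw [smul_sub, sub_eq_zero]; exact hab
    exact sub_eq_zero.1 (hx _ this)
  simp only [EV_iff] at *
  set P := projectiveResolution (ModuleCat.of A L)
  have key : ∀ c : P.complex.X i ⟶ ModuleCat.of A M, P.complex.d (i+1) i ≫ c = 0 → IsBd P (x • c) → IsBd P c := by
    intro c hc hb
    have hxc : ∀ (N : ModuleCat.{0} A) (u : N ⟶ ModuleCat.of A M), u ≫ (ModuleCat.ofHom (x • (LinearMap.id : M →ₗ[A] M))) = x • u := by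
      intro N u; ext y; rfl
    obtain ⟨b, hb⟩ := hb
    rcases i with _ | j
    · refine ⟨0, ?_⟩
      apply mono_cancel _ hinj
      rw [hxc, hb, P.complex.shape]
      · simp
      · simp
    · change P.complex.X j ⟶ _ at b
      change _ = P.complex.d (j+1) j ≫ b at hb
      obtain ⟨h, hh⟩ := h'' j rfl (b ≫ ModuleCat.ofHom g) (by
        have : P.complex.d (j+1) j ≫ b = x • c := hb.symm
        rw [← Category.assoc, this]
        ext y
        exact (hfg _).2 ⟨_, rfl⟩)
      have := P.projective (j-1)
      obtain ⟨h1, hh1⟩ := lift_epi (ModuleCat.ofHom g) hg h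
      obtain ⟨g', hg'⟩ := lift_ker (ModuleCat.ofHom (x • (LinearMap.id : M →ₗ[A] M))) (ModuleCat.ofHom g) hinj (fun m => (hfg m).1)
        (b - P.complex.d j (j-1) ≫ h1) (by
          rw [Preadditive.sub_comp, Category.assoc, hh1, hh, sub_self])
      refine ⟨g', ?_⟩
      apply mono_cancel _ hinj
      rw [hxc, hb]
      change _ = (P.complex.d (j+1) j ≫ g') ≫ _
      rw [Category.assoc, hg', Preadditive.comp_sub, ← Category.assoc, P.complex.d_comp_d, Limits.zero_comp, sub_zero]
  intro c hc
  have : ∀ k, IsBd P (x ^ k • c) → IsBd P c := by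
    intro k
    induction k with
    | zero => intro h; simpa using h
    | succ k ih =>
      intro h
      apply ih
      apply key
      · rw [Linear.comp_smul, hc, smul_zero]
      · rwa [smul_smul, ← pow_succ']
  exact this k (smul_isBd P _ hk c hc)

theorem EV_of_subsingleton {i : ℕ} [Subsingleton M] : EV A i L M := by
  rw [EV_iff]
  intro f _
  refine ⟨0, ?_⟩
  ext y
  exact Subsingleton.elim (α := M) _ _

theorem EV_congr {i : ℕ} (e : M ≃ₗ[A] M') (h : EV A i L M) : EV A i L M' := by
  refine V1 (M'' := PUnit.{1}) (e : M →ₗ[A] M') 0 e.injective ?_ ?_ h EV_of_subsingleton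
  · intro m; simp; exact ⟨e.symm m, by simp⟩
  · intro u; exact ⟨0, rfl⟩
end
end EX

namespace EX
noncomputable section
variable {R : Type} [CommRing R] (J : Ideal R) (i : ℕ) (M : ModuleCat.{0} R)

/-- the structure map into local cohomology -/
def lcι (t : ℕ) : ((Ext R (ModuleCat.{0} R) i).obj (op (ModuleCat.of R (R ⧸ J ^ t)))).obj M ⟶
    (localCohomology J i).obj M :=
  letI := localCohomology.hasColimitDiagram (localCohomology.idealPowersDiagram J) i
  (CategoryTheory.Limits.colimit.ι
          (localCohomology.diagram (localCohomology.idealPowersDiagram J) i)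
          (Opposite.op (Opposite.op t))).app M

/-- the colimit -/
def lcIsColimit :
  letI := localCohomology.hasColimitDiagram (localCohomology.idealPowersDiagram J) i
  Limits.IsColimit (((evaluation (ModuleCat.{0} R) (ModuleCat.{0} R)).obj M).mapCocone
    (Limits.colimit.cocone (localCohomology.diagram (localCohomology.idealPowersDiagram J) i))) :=
  letI := localCohomology.hasColimitDiagram (localCohomology.idealPowersDiagram J) i
  Limits.isColimitOfPreserves ((evaluation (ModuleCat.{0} R) (ModuleCat.{0} R)).obj M)
    (Limits.colimit.isColimit (localCohomology.diagram (localCohomology.idealPowersDiagram J) i))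

theorem lc_rep (y : (localCohomology J i).obj M) : ∃ t e, lcι J i M t e = y := by
  obtain ⟨t, e, h⟩ := Limits.Concrete.isColimit_exists_rep _ (lcIsColimit J i M) y
  exact ⟨t.unop.unop, e, h⟩

/-- transition map -/
def qtr {I I' : Ideal R} (h : I ≤ I') : ModuleCat.of R (R ⧸ I) ⟶ ModuleCat.of R (R ⧸ I') :=
  ModuleCat.ofHom <| Submodule.mapQ _ _ LinearMap.id h

theorem lc_zero (t : ℕ) (e) (h : lcι J i M t e = 0) : ∃ (T : ℕ) (hT : t ≤ T),
    (((Ext R (ModuleCat.{0} R) i).map (qtr (Ideal.pow_le_pow_right (I := J) hT)).op).app M) e = 0 := by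
  let D := localCohomology.diagram (localCohomology.idealPowersDiagram J) i ⋙ (evaluation (ModuleCat.{0} R) (ModuleCat.{0} R)).obj M
  let e' : (D.obj (op (op t)) : ModuleCat.{0} R) := e
  have h1 := Limits.Concrete.isColimit_exists_of_rep_eq D (lcIsColimit J i M) e' (0 : (D.obj (op (op t)) : ModuleCat.{0} R)) (by
    refine Eq.trans ?_ (map_zero _).symm
    exact h)
  obtain ⟨k, f, g, h1⟩ := h1
  have h2 : D.map f e' = 0 := h1.trans (map_zero _)
  exact ⟨k.unop.unop, f.unop.unop.down.down, h2⟩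
end
end EX

namespace EX
noncomputable section
variable {K : Type} [Field K] {n : ℕ} {I : Ideal (MvPolynomial (Fin n) K)}

theorem buch_quasi (h : IsBuchsbaum K I) : IsQuasiBuchsbaum K I := by
  intro i hi x hx y
  have hs : Function.Surjective (lcι (maxIdeal K n) i (ModuleCat.of (MvPolynomial (Fin n) K) (MvPolynomial (Fin n) K ⧸ I)) 1) := h i hi
  obtain ⟨e, he⟩ := hs y
  have : x • e = 0 := by
    obtain ⟨f, hf⟩ := exists_cocycle (projectiveResolution _) e
    refine (hf.smul _ x).eq_zero_iff.2 (smul_isBd _ x ?_ f hf.cocycle)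
    intro z
    change MvPolynomial (Fin n) K ⧸ (maxIdeal K n)^1 at z
    obtain ⟨z, rfl⟩ := Ideal.Quotient.mk_surjective z
    change Ideal.Quotient.mk _ (x * z) = 0
    rw [Ideal.Quotient.eq_zero_iff_mem, pow_one]
    exact Ideal.mul_mem_right _ _ hx
  rw [← he]
  refine (map_smul (lcι (maxIdeal K n) i _ 1).hom x e).symm.trans ?_
  rw [this, map_zero]
  rfl

theorem buch_of_EV (h : ∀ i : ℕ, (i : WithBot ℕ∞) < ringKrullDim (MvPolynomial (Fin n) K ⧸ I) →
    ∀ t : ℕ, EV (MvPolynomial (Fin n) K) i (MvPolynomial (Fin n) K ⧸ (maxIdeal K n)^t)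
      (MvPolynomial (Fin n) K ⧸ I)) : IsBuchsbaum K I := by
  intro i hi y
  change ((localCohomology (maxIdeal K n) i).obj
    (ModuleCat.of (MvPolynomial (Fin n) K) (MvPolynomial (Fin n) K ⧸ I)) : ModuleCat _) at y
  obtain ⟨t, e, he⟩ := lc_rep _ _ _ y
  have : Subsingleton (ExtGroup (MvPolynomial (Fin n) K) i (MvPolynomial (Fin n) K ⧸ (maxIdeal K n)^t) (MvPolynomial (Fin n) K ⧸ I)) := h i hi t
  have e0 : e = 0 := Subsingleton.elim (α := ExtGroup _ i _ _) _ _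
  refine ⟨0, ?_⟩
  have h0 : y = 0 := by rw [← he, e0, map_zero]
  rw [h0]
  exact map_zero _
end
end EX

namespace EX
noncomputable section
open MvPolynomial
variable {K : Type} [Field K] {n : ℕ}

/-- monomial ideal of an upper set -/
def MI (K : Type) [Field K] {n : ℕ} (U : UpperSet (Fin n →₀ ℕ)) : Ideal (MvPolynomial (Fin n) K) where
  carrier := {p | ∀ a, coeff a p ≠ 0 → a ∈ U}
  add_mem' := by
    intro p q hp hq a ha
    rw [coeff_add] at ha
    by_cases h : coeff a p = 0
    · exact hq a (by rw [h, zero_add] at ha; exact ha)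
    · exact hp a h
  zero_mem' := by intro a ha; simp at ha
  smul_mem' := by
    classical
    intro c p hp a ha
    rw [smul_eq_mul, coeff_mul] at ha
    obtain ⟨⟨b, d⟩, h1, h2⟩ := Finset.exists_ne_zero_of_sum_ne_zero ha
    rw [Finset.HasAntidiagonal.mem_antidiagonal] at h1
    have := hp d (right_ne_zero_of_mul h2)
    exact U.upper (by rw [← h1]; exact le_add_self) this

theorem mem_MI {U : UpperSet (Fin n →₀ ℕ)} {p : MvPolynomial (Fin n) K} :
    p ∈ MI K U ↔ ∀ a, coeff a p ≠ 0 → a ∈ U := Iff.rfl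

theorem monomial_mem_MI {U : UpperSet (Fin n →₀ ℕ)} {a} {c : K} (hc : c ≠ 0) :
    monomial a c ∈ MI K U ↔ a ∈ U := by
  classical
  rw [mem_MI]
  simp only [coeff_monomial]
  constructor
  · intro h; exact h a (by simpa using hc)
  · intro h b hb
    have : a = b := by by_contra h'; simp [h'] at hb
    exact this ▸ h

theorem mem_of_monomials {J : Ideal (MvPolynomial (Fin n) K)} {p : MvPolynomial (Fin n) K}
    (h : ∀ a, coeff a p ≠ 0 → monomial a (1:K) ∈ J) : p ∈ J := by
  rw [p.as_sum]
  refine Ideal.sum_mem _ fun a ha => ?_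
  have : monomial a (coeff a p) = C (coeff a p) * monomial a (1:K) := by
    rw [C_mul_monomial, mul_one]
  rw [this]
  exact Ideal.mul_mem_left _ _ (h a (mem_support_iff.1 ha))

/-- weight of `a` on `F` -/
def wt (F : Finset (Fin n)) (a : Fin n →₀ ℕ) : ℕ := ∑ i ∈ F, a i

theorem wt_mono (F : Finset (Fin n)) {a b : Fin n →₀ ℕ} (h : a ≤ b) : wt F a ≤ wt F b :=
  Finset.sum_le_sum fun i _ => h i

theorem wt_add (F : Finset (Fin n)) (a b : Fin n →₀ ℕ) : wt F (a + b) = wt F a + wt F b := by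
  simp [wt, Finset.sum_add_distrib]

theorem wt_single (F : Finset (Fin n)) (i : Fin n) (k : ℕ) :
    wt F (Finsupp.single i k) = if i ∈ F then k else 0 := by
  classical
  simp [wt, Finsupp.single_apply]

/-- upper set -/
def UF (F : Finset (Fin n)) (m : ℕ) : UpperSet (Fin n →₀ ℕ) :=
  ⟨{a | m ≤ wt F a}, fun _ _ h h' => le_trans h' (wt_mono F h)⟩

theorem mem_UF {F : Finset (Fin n)} {m : ℕ} {a : Fin n →₀ ℕ} : a ∈ UF F m ↔ m ≤ wt F a := Iff.rfl

theorem PF_pow (F : Finset (Fin n)) (m : ℕ) : PF K F ^ m = MI K (UF F m) := by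
  classical
  apply le_antisymm
  · induction m with
    | zero => intro p _ a _; exact Nat.zero_le _
    | succ m ih =>
      rw [pow_succ']
      have h1 : PF K F ≤ MI K (UF F 1) := by
        rw [PF, Ideal.span_le]
        rintro _ ⟨i, hi, rfl⟩
        refine (monomial_mem_MI one_ne_zero).2 ?_
        rw [mem_UF, wt_single, if_pos (by exact_mod_cast hi)]
      refine (Ideal.mul_mono h1 ih).trans ?_
      rw [Ideal.mul_le]
      intro p hp q hq a ha
      rw [coeff_mul] at ha
      obtain ⟨⟨b, d⟩, h1, h2⟩ := Finset.exists_ne_zero_of_sum_ne_zero ha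
      rw [Finset.HasAntidiagonal.mem_antidiagonal] at h1
      have e1 := hp b (left_ne_zero_of_mul h2)
      have e2 := hq d (right_ne_zero_of_mul h2)
      rw [mem_UF] at *
      simp only at h1
      rw [← h1, wt_add]; omega
  · intro p hp
    refine mem_of_monomials fun a ha => ?_
    have h := hp a ha
    clear hp ha
    rw [mem_UF] at h
    induction m generalizing a with
    | zero => simp
    | succ m ih =>
      obtain ⟨i, hi, hi'⟩ : ∃ i ∈ F, a i ≠ 0 := by
        by_contra hc
        push Not at hc
        have : wt F a = 0 := Finset.sum_eq_zero hc
        omega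
      have hle : Finsupp.single i 1 ≤ a := by
        rw [Finsupp.single_le_iff]; omega
      have e : a = Finsupp.single i 1 + (a - Finsupp.single i 1) := (add_tsub_cancel_of_le hle).symm
      have hw : wt F a = 1 + wt F (a - Finsupp.single i 1) := by
        conv_lhs => rw [e, wt_add, wt_single, if_pos hi]
      have : (monomial a (1:K)) = X i * monomial (a - Finsupp.single i 1) 1 := by
        conv_lhs => rw [e]
        rw [X, monomial_mul, one_mul]
      rw [this, pow_succ']
      exact Ideal.mul_mem_mul (Ideal.subset_span ⟨i, by exact_mod_cast hi, rfl⟩) (ih _ (by omega))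

theorem PF_eq (F : Finset (Fin n)) : PF K F = MI K (UF F 1) := by
  rw [← PF_pow, pow_one]

theorem maxIdeal_eq : maxIdeal K n = PF K Finset.univ := by
  simp [maxIdeal, PF]

/-- upper set of symbolic power -/
def US (Δ : SimComplex n) (m : ℕ) : UpperSet (Fin n →₀ ℕ) :=
  ⟨{a | ∀ F, Δ.IsFacet F → m ≤ wt Fᶜ a}, fun _ _ h h' F hF => le_trans (h' F hF) (wt_mono _ h)⟩

theorem mem_US {Δ : SimComplex n} {m : ℕ} {a : Fin n →₀ ℕ} :
    a ∈ US Δ m ↔ ∀ F, Δ.IsFacet F → m ≤ wt Fᶜ a := Iff.rfl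

theorem SRSymbPow_eq (Δ : SimComplex n) (m : ℕ) : SRSymbPow K Δ m = MI K (US Δ m) := by
  ext p
  simp only [SRSymbPow, PF_pow, Ideal.mem_iInf, mem_MI, mem_UF, mem_US]
  exact ⟨fun h a ha F hF => h F hF a ha, fun h F hF a ha => h a ha F hF⟩

theorem mem_PF {F : Finset (Fin n)} {p : MvPolynomial (Fin n) K} :
    p ∈ PF K F ↔ ∀ a, coeff a p ≠ 0 → ∃ i ∈ F, a i ≠ 0 := by
  rw [PF_eq, mem_MI]
  refine forall_congr' fun a => forall_congr' fun _ => ?_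
  rw [mem_UF, wt, Nat.one_le_iff_ne_zero, ne_eq, Finset.sum_eq_zero_iff]
  push Not
  rfl

theorem X_mem_PF {F : Finset (Fin n)} {i : Fin n} : (X i : MvPolynomial (Fin n) K) ∈ PF K F ↔ i ∈ F := by
  classical
  rw [PF_eq, X, monomial_mem_MI one_ne_zero, mem_UF, wt_single]
  split_ifs <;> simp_all

theorem monomial_mem_PF {F : Finset (Fin n)} {a : Fin n →₀ ℕ} {c : K} (hc : c ≠ 0) :
    monomial a c ∈ PF K F ↔ ∃ i ∈ F, a i ≠ 0 := by
  rw [PF_eq, monomial_mem_MI hc, mem_UF, wt, Nat.one_le_iff_ne_zero, ne_eq, Finset.sum_eq_zero_iff]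
  push Not
  rfl

theorem PF_mono {F G : Finset (Fin n)} (h : F ⊆ G) : PF K F ≤ PF K G :=
  Ideal.span_mono (Set.image_mono (by exact_mod_cast h))

theorem PF_le_iff {F G : Finset (Fin n)} : PF K F ≤ PF K G ↔ F ⊆ G :=
  ⟨fun h _ hi => X_mem_PF.1 (h (X_mem_PF.2 hi)), PF_mono⟩

/-- restriction to the variables of `F` -/
def res (K : Type) [Field K] {n : ℕ} (F : Finset (Fin n)) : MvPolynomial (Fin n) K →ₐ[K] MvPolynomial {i // i ∈ F} K :=
  aeval (fun i => if h : i ∈ F then X ⟨i, h⟩ else 0)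

theorem res_surj (F : Finset (Fin n)) : Function.Surjective (res K F) := by
  intro q
  refine ⟨rename Subtype.val q, ?_⟩
  have : (res K F).comp (rename Subtype.val) = AlgHom.id K _ := by
    ext i
    simp [res]
  exact DFunLike.congr_fun this q

theorem ker_res (F : Finset (Fin n)) : RingHom.ker (res K F) = PF K Fᶜ := by
  apply le_antisymm
  · intro p hp
    have h : (Ideal.Quotient.mkₐ K (PF K Fᶜ)).comp ((rename Subtype.val).comp (res K F))
        = Ideal.Quotient.mkₐ K (PF K Fᶜ) := by
      ext i
      by_cases hi : i ∈ F
      · simp [res, hi]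
      · simp only [res, AlgHom.comp_apply, aeval_X, hi, dif_neg, not_false_eq_true, map_zero]
        symm
        exact Ideal.Quotient.eq_zero_iff_mem.2 (X_mem_PF.2 (by simpa using hi))
    have h2 := DFunLike.congr_fun h p
    simp only [AlgHom.comp_apply] at h2
    rw [RingHom.mem_ker] at hp
    rw [show (res K F) p = 0 from hp, map_zero, map_zero] at h2
    exact Ideal.Quotient.eq_zero_iff_mem.1 h2.symm
  · rw [PF, Ideal.span_le]
    rintro _ ⟨i, hi, rfl⟩
    have : i ∉ F := by simpa using hi
    change (res K F) (X i) = 0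
    simp [res, this]

theorem PF_prime (F : Finset (Fin n)) : (PF K F).IsPrime := by
  have h := ker_res (K := K) Fᶜ
  rw [compl_compl] at h
  rw [← h]
  exact RingHom.ker_isPrime _

/-- quotient by `PF` -/
def quotEquiv (K : Type) [Field K] {n : ℕ} (F : Finset (Fin n)) : (MvPolynomial (Fin n) K ⧸ PF K Fᶜ) ≃+* MvPolynomial {i // i ∈ F} K :=
  (Ideal.quotEquivOfEq (ker_res F).symm).trans (RingHom.quotientKerEquivOfSurjective (f := (res K F).toRingHom) (res_surj F))

theorem dim_quot (F : Finset (Fin n)) : ringKrullDim (MvPolynomial (Fin n) K ⧸ PF K Fᶜ) = F.card := by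
  rw [ringKrullDim_eq_of_ringEquiv (quotEquiv K F), MvPolynomial.ringKrullDim_of_isNoetherianRing]
  simp
end
end EX

namespace EX
noncomputable section
open MvPolynomial
variable {K : Type} [Field K] {n : ℕ}

theorem exch {Δ : SimComplex n} {d : ℕ} (hM : Δ.IsMatroid)
    (hmax : ∀ Y ∈ Δ.faces, Y.card ≤ d)
    {F H : Finset (Fin n)} (hF : F ∈ Δ.faces) (hFc : F.card = d) (hH : H ∈ Δ.faces)
    (hHc : H.card = d) {e : Fin n} (he : e ∈ H) (heF : e ∉ F) :
    ∃ j ∈ F, j ∉ H ∧ insert e (F.erase j) ∈ Δ.faces := by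
  classical
  have key : ∀ k, ∀ Z : Finset (Fin n), Z ∈ Δ.faces → insert e (F ∩ H) ⊆ Z → Z ⊆ insert e F →
      d ≤ Z.card + k → ∃ Z : Finset (Fin n), Z ∈ Δ.faces ∧ insert e (F ∩ H) ⊆ Z ∧ Z ⊆ insert e F ∧ d ≤ Z.card := by
    intro k
    induction k with
    | zero => intro Z h1 h2 h3 h4; exact ⟨Z, h1, h2, h3, h4⟩
    | succ k ih =>
      intro Z h1 h2 h3 h4
      by_cases hc : d ≤ Z.card
      · exact ⟨Z, h1, h2, h3, hc⟩
      · obtain ⟨i, hi, hiZ, hZ⟩ := hM F Z hF h1 (by omega)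
        refine ih _ hZ (h2.trans (Finset.subset_insert _ _)) ?_ ?_
        · exact Finset.insert_subset (Finset.mem_insert_of_mem hi) h3
        · rw [Finset.card_insert_of_notMem hiZ]; omega
  obtain ⟨Z, h1, h2, h3, h4⟩ := key d (insert e (F ∩ H))
    (Δ.down_closed hH (Finset.insert_subset he Finset.inter_subset_right)) subset_rfl
    (Finset.insert_subset_insert _ Finset.inter_subset_left) (by omega)
  have heZ : e ∈ Z := h2 (Finset.mem_insert_self _ _)
  have hZne : ∃ j ∈ F, j ∉ Z := by
    by_contra hc
    push Not at hc
    have : insert e F ⊆ Z := Finset.insert_subset heZ hc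
    have h5 := Finset.card_le_card this
    rw [Finset.card_insert_of_notMem heF] at h5
    have := hmax Z h1
    omega
  obtain ⟨j, hj, hjZ⟩ := hZne
  refine ⟨j, hj, fun hjH => hjZ (h2 (Finset.mem_insert_of_mem (Finset.mem_inter.2 ⟨hj, hjH⟩))), ?_⟩
  have hsub : Z ⊆ insert e (F.erase j) := by
    intro z hz
    rcases Finset.mem_insert.1 (h3 hz) with h | h
    · exact Finset.mem_insert.2 (Or.inl h)
    · refine Finset.mem_insert.2 (Or.inr (Finset.mem_erase.2 ⟨?_, h⟩))
      rintro rfl; exact hjZ hz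
  have hcard : (insert e (F.erase j)).card ≤ Z.card := by
    refine (Finset.card_insert_le _ _).trans ?_
    rw [Finset.card_erase_of_mem hj]
    have := Finset.card_pos.2 ⟨j, hj⟩
    omega
  rw [← Finset.eq_of_subset_of_card_le hsub hcard]
  exact h1

/-- weights -/
def ww (a : Fin n →₀ ℕ) (f : Fin n) : ℤ := ((n * n + 1 : ℕ) : ℤ) * a f - (f : ℕ)

theorem ww_inj (a : Fin n →₀ ℕ) : Function.Injective (ww a) := by
  intro f g h
  have hf := f.2
  have hg := g.2
  have hn : n ≤ n * n := Nat.le_mul_self n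
  unfold ww at h
  push_cast at h
  have h1 : ((n:ℤ) * n + 1) * ((a f : ℤ) - a g) = (f : ℕ) - (g : ℕ) := by linarith
  have h2 : ((a f : ℤ) - a g) = 0 := by
    by_contra hc
    have : 1 ≤ |(a f : ℤ) - a g| := Int.one_le_abs hc
    have h3 : |((f : ℕ) : ℤ) - (g : ℕ)| < n := by rw [abs_lt]; constructor <;> omega
    rw [← h1, abs_mul, abs_of_nonneg (by positivity)] at h3
    have hn' : (n : ℤ) ≤ n * n := by exact_mod_cast hn
    nlinarith
  rw [h2, mul_zero] at h1
  exact Fin.ext (by omega)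

theorem ww_mono {a b : Fin n →₀ ℕ} {f : Fin n} (h : a f ≤ b f) : ww a f ≤ ww b f := by
  unfold ww
  have : (a f : ℤ) ≤ b f := by exact_mod_cast h
  have h2 : (0:ℤ) ≤ ((n * n + 1 : ℕ) : ℤ) := by positivity
  nlinarith

/-- local optimality -/
def LO (Δ : SimComplex n) (d : ℕ) (a : Fin n →₀ ℕ) (F : Finset (Fin n)) : Prop :=
  (F ∈ Δ.faces ∧ F.card = d) ∧
    ∀ j ∈ F, ∀ i, i ∉ F → insert i (F.erase j) ∈ Δ.faces → ww a i < ww a j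

theorem sum_swap (w : Fin n → ℤ) {F : Finset (Fin n)} {i j : Fin n} (hj : j ∈ F) (hi : i ∉ F) :
    ∑ f ∈ insert i (F.erase j), w f = ∑ f ∈ F, w f + w i - w j := by
  classical
  rw [Finset.sum_insert (fun h => hi (Finset.mem_of_mem_erase h)),
    ← Finset.add_sum_erase F w hj]
  ring

theorem card_swap {F : Finset (Fin n)} {i j : Fin n} (hj : j ∈ F) (hi : i ∉ F) :
    (insert i (F.erase j)).card = F.card := by
  classical
  rw [Finset.card_insert_of_notMem (fun h => hi (Finset.mem_of_mem_erase h)),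
    Finset.card_erase_of_mem hj]
  have := Finset.card_pos.2 ⟨j, hj⟩
  omega

theorem LO.opt {Δ : SimComplex n} {d : ℕ} (hM : Δ.IsMatroid)
    (hmax : ∀ Y ∈ Δ.faces, Y.card ≤ d) {a : Fin n →₀ ℕ} {F : Finset (Fin n)} (h : LO Δ d a F)
    {H : Finset (Fin n)} (hH : H ∈ Δ.faces) (hHc : H.card = d) (hne : H ≠ F) :
    ∑ f ∈ H, ww a f < ∑ f ∈ F, ww a f := by
  classical
  have main : ∀ k, ∀ H : Finset (Fin n), H ∈ Δ.faces → H.card = d → (H \ F).card ≤ k → H ≠ F →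
      ∑ f ∈ H, ww a f < ∑ f ∈ F, ww a f := by
    intro k
    induction k with
    | zero =>
      intro H h1 h2 h3 h4
      exfalso
      have : H \ F = ∅ := Finset.card_eq_zero.1 (by omega)
      exact h4 (Finset.eq_of_subset_of_card_le (Finset.sdiff_eq_empty_iff_subset.1 this)
        (by rw [h2, h.1.2]))
    | succ k ih =>
      intro H h1 h2 h3 h4
      have hne : (symmDiff F H).Nonempty := by
        rw [Finset.nonempty_iff_ne_empty]
        intro h5
        exact h4 (symmDiff_eq_bot.1 h5).symm
      obtain ⟨e, he, hemax⟩ := Finset.exists_max_image _ (ww a) hne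
      rcases Finset.mem_symmDiff.1 he with ⟨heF, heH⟩ | ⟨heH, heF⟩
      · obtain ⟨j, hj, hjF, hjf⟩ := exch hM hmax h1 h2 h.1.1 h.1.2 heF heH
        have hlt : ww a j < ww a e := by
          refine lt_of_le_of_ne (hemax j (Finset.mem_symmDiff.2 (Or.inr ⟨hj, hjF⟩))) ?_
          intro h6
          exact heH (ww_inj a h6 ▸ hj)
        have hs := sum_swap (ww a) hj heH
        by_cases h7 : insert e (H.erase j) = F
        · rw [h7] at hs; linarith
        · have := ih _ hjf ((card_swap hj heH).trans h2) ?_ h7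
          · linarith
          · have h8 : insert e (H.erase j) \ F = (H \ F).erase j := by
              ext z; simp only [Finset.mem_sdiff, Finset.mem_insert, Finset.mem_erase]
              constructor
              · rintro ⟨rfl | h9, h10⟩
                · exact absurd heF h10
                · exact ⟨h9.1, h9.2, h10⟩
              · rintro ⟨h9, h10, h11⟩; exact ⟨Or.inr ⟨h9, h10⟩, h11⟩
            rw [h8, Finset.card_erase_of_mem (Finset.mem_sdiff.2 ⟨hj, hjF⟩)]
            omega
      · exfalso
        obtain ⟨j, hj, hjH, hjf⟩ := exch hM hmax h.1.1 h.1.2 h1 h2 heH heF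
        have h5 := h.2 j hj e heF hjf
        have h6 := hemax j (Finset.mem_symmDiff.2 (Or.inl ⟨hj, hjH⟩))
        exact absurd h5 (not_lt.2 h6)
  exact main _ H hH hHc le_rfl hne

theorem exists_LO {Δ : SimComplex n} {d : ℕ} (hne : ∃ F ∈ Δ.faces, F.card = d) (a : Fin n →₀ ℕ) :
    ∃ F, LO Δ d a F := by
  classical
  let s : Finset (Finset (Fin n)) := Finset.univ.filter fun F => F ∈ Δ.faces ∧ F.card = d
  obtain ⟨F0, h1, h2⟩ := hne
  obtain ⟨F, hF, hm⟩ := Finset.exists_max_image s (fun F => ∑ f ∈ F, ww a f)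
    ⟨F0, Finset.mem_filter.2 ⟨Finset.mem_univ _, h1, h2⟩⟩
  have hF' := (Finset.mem_filter.1 hF).2
  refine ⟨F, hF', ?_⟩
  intro j hj i hi hij
  have h3 := hm _ (Finset.mem_filter.2 ⟨Finset.mem_univ _, hij, (card_swap hj hi).trans hF'.2⟩)
  simp only [sum_swap (ww a) hj hi] at h3
  refine lt_of_le_of_ne (by linarith) ?_
  intro h; exact hi (ww_inj a h ▸ hj)

/-- the value of a facet -/
def vv (a : Fin n →₀ ℕ) (F : Finset (Fin n)) : ℕ := (n * n + 1) * wt Fᶜ a + ∑ f ∈ F, (f : ℕ)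

theorem vv_eq (a : Fin n →₀ ℕ) (F : Finset (Fin n)) :
    (vv a F : ℤ) = ((n * n + 1 : ℕ) : ℤ) * wt Finset.univ a - ∑ f ∈ F, ww a f := by
  classical
  have : wt Finset.univ a = wt F a + wt Fᶜ a := (Finset.sum_add_sum_compl F _).symm
  rw [this]
  unfold vv ww
  rw [Finset.sum_sub_distrib, ← Finset.mul_sum]
  have h : ((wt F a : ℕ) : ℤ) = ∑ i ∈ F, (a i : ℤ) := by simp [wt]
  push_cast
  rw [← h]; ring

theorem sum_lt (F : Finset (Fin n)) : ∑ f ∈ F, (f : ℕ) < n * n + 1 := by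
  have : ∑ f ∈ F, (f : ℕ) ≤ ∑ f ∈ F, n := Finset.sum_le_sum fun f _ => f.2.le
  rw [Finset.sum_const, smul_eq_mul] at this
  have h2 : F.card ≤ n := by simpa using Finset.card_le_univ F
  have := Nat.mul_le_mul_right n h2
  omega

theorem LO.vv_lt {Δ : SimComplex n} {d : ℕ} (hM : Δ.IsMatroid)
    (hmax : ∀ Y ∈ Δ.faces, Y.card ≤ d) {a : Fin n →₀ ℕ} {F : Finset (Fin n)} (h : LO Δ d a F)
    {H : Finset (Fin n)} (hH : H ∈ Δ.faces) (hHc : H.card = d) (hne : H ≠ F) :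
    vv a F < vv a H := by
  have := h.opt hM hmax hH hHc hne
  have e1 := vv_eq a F
  have e2 := vv_eq a H
  omega

theorem LO.unique {Δ : SimComplex n} {d : ℕ} (hM : Δ.IsMatroid)
    (hmax : ∀ Y ∈ Δ.faces, Y.card ≤ d) {a : Fin n →₀ ℕ} {F F' : Finset (Fin n)} (h : LO Δ d a F)
    (h' : LO Δ d a F') : F = F' := by
  by_contra hc
  have h1 := h.vv_lt hM hmax h'.1.1 h'.1.2 (Ne.symm hc)
  have h2 := h'.vv_lt hM hmax h.1.1 h.1.2 hc
  omega

/-- enlarging on F -/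
theorem LO.mono {Δ : SimComplex n} {d : ℕ} {a b : Fin n →₀ ℕ} {F : Finset (Fin n)}
    (h : LO Δ d a F) (h1 : ∀ i ∈ F, a i ≤ b i) (h2 : ∀ i, i ∉ F → b i = a i) : LO Δ d b F := by
  refine ⟨h.1, fun j hj i hi hij => ?_⟩
  have e : ww b i = ww a i := by unfold ww; rw [h2 i hi]
  rw [e]
  exact (h.2 j hj i hi hij).trans_le (ww_mono (h1 j hj))

theorem LO.inf {Δ : SimComplex n} {d : ℕ} {a b : Fin n →₀ ℕ} {F : Finset (Fin n)}
    (h : LO Δ d a F) (h' : LO Δ d b F) (h2 : ∀ i, i ∉ F → b i = a i) : LO Δ d (a ⊓ b) F := by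
  refine ⟨h.1, fun j hj i hi hij => ?_⟩
  have e : (a ⊓ b) i = a i := by simp [h2 i hi]
  have e1 : ww (a ⊓ b) i = ww a i := by unfold ww; rw [e]
  have e2 : ww b i = ww a i := by unfold ww; rw [h2 i hi]
  rw [e1]
  rcases le_total (a j) (b j) with h3 | h3
  · have : (a ⊓ b) j = a j := by simp [h3]
    have : ww (a ⊓ b) j = ww a j := by unfold ww; rw [this]
    rw [this]; exact h.2 j hj i hi hij
  · have : (a ⊓ b) j = b j := by simp [h3]
    have : ww (a ⊓ b) j = ww b j := by unfold ww; rw [this]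
    rw [this, ← e2]; exact h'.2 j hj i hi hij

/-- minimal element of a cell -/
theorem exists_min {Δ : SimComplex n} {d : ℕ} {a : Fin n →₀ ℕ} {F : Finset (Fin n)}
    (h : LO Δ d a F) : ∃ g, LO Δ d g F ∧ (∀ i, i ∉ F → g i = a i) ∧
      ∀ b, LO Δ d b F → (∀ i, i ∉ F → b i = a i) → g ≤ b := by
  classical
  let T : Set (Fin n →₀ ℕ) := {g | LO Δ d g F ∧ (∀ i, i ∉ F → g i = a i)}
  have hT : T.Nonempty := ⟨a, h, fun _ _ => rfl⟩
  have wf : WellFounded (fun x y : Fin n →₀ ℕ => wt Finset.univ x < wt Finset.univ y) :=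
    (measure (wt Finset.univ)).wf
  obtain ⟨g, hg, hmin⟩ := wf.has_min T hT
  refine ⟨g, hg.1, hg.2, fun b hb hba => ?_⟩
  have h1 : g ⊓ b ∈ T := by
    refine ⟨hg.1.inf hb fun i hi => (hba i hi).trans (hg.2 i hi).symm, fun i hi => ?_⟩
    simp [hba i hi, hg.2 i hi]
  have h2 := hmin _ h1
  intro i
  by_contra hc
  apply h2
  refine Finset.sum_lt_sum (fun i _ => ?_) ⟨i, Finset.mem_univ _, ?_⟩
  · simp
  · simp; omega
end
end EX

namespace EX
noncomputable section
open MvPolynomial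
variable {K : Type} [Field K] {n : ℕ}

theorem MI_top : MI K (⊥ : UpperSet (Fin n →₀ ℕ)) = ⊤ := by
  rw [Ideal.eq_top_iff_one, mem_MI]
  intro a _
  exact UpperSet.mem_bot

theorem MI_sup (U : UpperSet (Fin n →₀ ℕ)) (g : Fin n →₀ ℕ) :
    MI K U ⊔ Ideal.span {monomial g (1:K)} = MI K (U ⊓ UpperSet.Ici g) := by
  apply le_antisymm
  · refine sup_le (fun p hp a ha => ?_) ?_
    · exact UpperSet.mem_inf_iff.2 (Or.inl (hp a ha))
    · rw [Ideal.span_le, Set.singleton_subset_iff]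
      refine (monomial_mem_MI one_ne_zero).2 (UpperSet.mem_inf_iff.2 (Or.inr ?_))
      exact UpperSet.mem_Ici_iff.2 le_rfl
  · intro p hp
    refine mem_of_monomials fun a ha => ?_
    rcases UpperSet.mem_inf_iff.1 (hp a ha) with h | h
    · exact Ideal.mem_sup_left ((monomial_mem_MI one_ne_zero).2 h)
    · refine Ideal.mem_sup_right ?_
      rw [UpperSet.mem_Ici_iff] at h
      have e : monomial a (1:K) = monomial (a - g) 1 * monomial g 1 := by
        rw [monomial_mul, one_mul, tsub_add_cancel_of_le h]
      rw [e]
      exact Ideal.mul_mem_left _ _ (Ideal.subset_span rfl)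

theorem mono_mul_mem (U : UpperSet (Fin n →₀ ℕ)) (g : Fin n →₀ ℕ) (p : MvPolynomial (Fin n) K) :
    monomial g 1 * p ∈ MI K U ↔ ∀ a, coeff a p ≠ 0 → g + a ∈ U := by
  classical
  rw [mem_MI]
  constructor
  · intro h a ha
    apply h
    rw [coeff_monomial_mul, one_mul]
    exact ha
  · intro h a ha
    rw [coeff_monomial_mul'] at ha
    split_ifs at ha with hle
    · rw [one_mul] at ha
      have := h _ ha
      rwa [add_tsub_cancel_of_le hle] at this
    · exact absurd rfl ha

theorem filt {Δ : SimComplex n} {d : ℕ} (hM : Δ.IsMatroid)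
    (hfac : ∀ F, Δ.IsFacet F ↔ F ∈ Δ.faces ∧ F.card = d)
    (hmax : ∀ Y ∈ Δ.faces, Y.card ≤ d) (hne : ∃ F ∈ Δ.faces, F.card = d) (m : ℕ)
    (Q : Ideal (MvPolynomial (Fin n) K) → Prop) (h0 : Q ⊤)
    (hstep : ∀ J f F, Δ.IsFacet F → (∀ p, f * p ∈ J ↔ p ∈ PF K Fᶜ) →
      Q (J ⊔ Ideal.span {f}) → Q J) : Q (SRSymbPow K Δ m) := by
  classical
  rw [SRSymbPow_eq]
  have hsat0 : ∀ a F, LO Δ d a F → (a ∈ US Δ m ↔ m ≤ wt Fᶜ a) := by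
    intro a F h
    rw [mem_US]
    refine ⟨fun h1 => h1 F ((hfac F).2 h.1), fun h1 H hH => ?_⟩
    rw [hfac] at hH
    by_cases he : H = F
    · rw [he]; exact h1
    · have h2 := h.vv_lt hM hmax hH.1 hH.2 he
      unfold vv at h2
      have h3 := sum_lt H
      by_contra hc
      have h4 : wt Hᶜ a + 1 ≤ wt Fᶜ a := by omega
      have := Nat.mul_le_mul_left (n*n+1) h4
      rw [mul_add] at this
      omega
  have main : ∀ J : Ideal (MvPolynomial (Fin n) K), ∀ U : UpperSet (Fin n →₀ ℕ), MI K U = J →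
      (∀ a, a ∈ US Δ m → a ∈ U) →
      (∀ a b F, LO Δ d a F → LO Δ d b F → (∀ i, i ∉ F → a i = b i) → a ∈ U → b ∈ U) →
      Q J := by
    intro J
    induction J using (wellFounded_gt (α := Ideal (MvPolynomial (Fin n) K))).induction with
    | _ J ih =>
    intro U hUJ hU hsat
    by_cases htop : ∀ a, a ∈ U
    · have : U = ⊥ := by ext a; simp [htop a]
      rw [← hUJ, this, MI_top]; exact h0
    push Not at htop
    -- choose maximal rho
    let V : Set ℕ := {r | ∃ a F, a ∉ U ∧ LO Δ d a F ∧ vv a F = r}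
    have hVne : V.Nonempty := by
      obtain ⟨a, ha⟩ := htop
      obtain ⟨F, hF⟩ := exists_LO hne a
      exact ⟨_, a, F, ha, hF, rfl⟩
    have hVb : BddAbove V := by
      refine ⟨(n*n+1) * m + (n*n+1), ?_⟩
      rintro r ⟨a, F, ha, hF, rfl⟩
      have h1 : ¬ m ≤ wt Fᶜ a := fun h => ha (hU a ((hsat0 a F hF).2 h))
      have := Nat.mul_le_mul_left (n*n+1) (by omega : wt Fᶜ a ≤ m)
      have := sum_lt F
      unfold vv; omega
    obtain ⟨a, F, ha, hF, hr⟩ := Nat.sSup_mem hVne hVb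
    have hrmax : ∀ b H, b ∉ U → LO Δ d b H → vv b H ≤ vv a F := by
      intro b H hb hH
      rw [hr]
      exact le_csSup hVb ⟨b, H, hb, hH, rfl⟩
    obtain ⟨g, hg, hga, hgmin⟩ := exists_min hF
    have hgU : g ∉ U := fun h => ha (hsat g a F hg hF hga h)
    have hvg : vv g F = vv a F := by
      unfold vv wt
      rw [Finset.sum_congr rfl fun i hi => hga i (Finset.mem_compl.1 hi)]
    have hstay : ∀ b : Fin n →₀ ℕ, (∀ i, i ∉ F → b i = 0) → LO Δ d (g + b) F := by
      intro b hb
      exact hg.mono (fun i _ => by simp) (fun i hi => by simp [hb i hi])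
    have hcol : ∀ b : Fin n →₀ ℕ, g + b ∈ U ↔ ∃ i ∈ Fᶜ, b i ≠ 0 := by
      intro b
      constructor
      · intro h
        by_contra hc
        push Not at hc
        exact hgU (hsat (g + b) g F (hstay b fun i hi => hc i (Finset.mem_compl.2 hi)) hg
          (fun i hi => by simp [hc i (Finset.mem_compl.2 hi)]) h)
      · rintro ⟨i, hi, hbi⟩
        have hle : g + Finsupp.single i 1 ≤ g + b := by
          gcongr
          rw [Finsupp.single_le_iff]; omega
        refine U.upper hle ?_
        by_contra hc
        obtain ⟨H, hH⟩ := exists_LO hne (g + Finsupp.single i 1)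
        have h1 := hrmax _ H hc hH
        have h2 : vv g F < vv (g + Finsupp.single i 1) H := by
          by_cases he : H = F
          · rw [he]; unfold vv
            rw [wt_add, wt_single, if_pos hi, mul_add]; omega
          · refine (hg.vv_lt hM hmax hH.1.1 hH.1.2 he).trans_le ?_
            unfold vv
            rw [wt_add, mul_add]; omega
        omega
    have hf : MI K U ⊔ Ideal.span {monomial g (1:K)} = MI K (U ⊓ UpperSet.Ici g) := MI_sup U g
    rw [← hUJ]
    refine hstep (MI K U) (monomial g 1) F ((hfac F).2 hg.1) ?_ ?_
    · intro p
      rw [mono_mul_mem, mem_PF]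
      exact forall_congr' fun a => forall_congr' fun _ => hcol a
    · rw [hf]
      refine ih _ ?_ (U ⊓ UpperSet.Ici g) rfl ?_ ?_
      · rw [← hf, ← hUJ]
        refine lt_of_le_of_ne le_sup_left ?_
        intro h
        apply hgU
        rw [← monomial_mem_MI (K := K) one_ne_zero, h]
        exact Ideal.mem_sup_right (Ideal.subset_span rfl)
      · intro b hb; exact UpperSet.mem_inf_iff.2 (Or.inl (hU b hb))
      · intro b c H hb hc hbc hbU
        rw [UpperSet.mem_inf_iff] at hbU ⊢
        by_cases hb1 : b ∈ U
        · exact Or.inl (hsat b c H hb hc hbc hb1)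
        · right
          have h1 : g ≤ b := UpperSet.mem_Ici_iff.1 (hbU.resolve_left hb1)
          rw [UpperSet.mem_Ici_iff]
          have h2 : g + (b - g) = b := add_tsub_cancel_of_le h1
          have h3 : ∀ i, i ∉ F → (b - g) i = 0 := by
            by_contra hcc
            push Not at hcc
            obtain ⟨i, hi, hi'⟩ := hcc
            apply hb1
            rw [← h2, hcol]
            exact ⟨i, Finset.mem_compl.2 hi, hi'⟩
          have h4 := hstay _ h3
          rw [h2] at h4
          have h5 : H = F := hb.unique hM hmax h4
          subst h5
          refine hgmin c hc fun i hi => ?_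
          rw [← hbc i hi, ← hga i hi, ← h2]
          have h6 := h3 i hi
          rw [Finsupp.add_apply, h6, add_zero]
  refine main _ (US Δ m) rfl (fun _ h => h) ?_
  intro a b F ha hb hab h
  rw [hsat0 a F ha] at h
  rw [hsat0 b F hb]
  have : wt Fᶜ b = wt Fᶜ a :=
    Finset.sum_congr rfl fun i hi => (hab i (Finset.mem_compl.1 hi)).symm
  omega
end
end EX

namespace EX
noncomputable section
section gen
variable {B : Type} [CommRing B] {L : Type} [AddCommGroup L] [Module B L]

theorem EV_colon {i : ℕ} {J J' : Ideal B} {f : B} (hJ : ∀ p, f * p ∈ J ↔ p ∈ J')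
    (h' : EV B i L (B ⧸ J')) (h'' : EV B i L (B ⧸ (J ⊔ Ideal.span {f}))) : EV B i L (B ⧸ J) := by
  let φ : B →ₗ[B] B := LinearMap.mulLeft B f
  have hle : J' ≤ Submodule.comap φ J := fun p hp => (hJ p).2 hp
  refine V1 (Submodule.mapQ J' J φ hle) (Submodule.mapQ J (J ⊔ Ideal.span {f}) LinearMap.id
    (fun x hx => Ideal.mem_sup_left hx)) ?_ ?_ ?_ h' h''
  · rw [← LinearMap.ker_eq_bot, LinearMap.ker_eq_bot']
    intro m
    obtain ⟨p, rfl⟩ := Submodule.Quotient.mk_surjective _ m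
    intro hm
    rw [Submodule.mapQ_apply, Submodule.Quotient.mk_eq_zero] at hm
    exact (Submodule.Quotient.mk_eq_zero _).2 ((hJ p).1 hm)
  · intro m
    obtain ⟨p, rfl⟩ := Submodule.Quotient.mk_surjective _ m
    rw [Submodule.mapQ_apply, Submodule.Quotient.mk_eq_zero]
    constructor
    · intro h
      obtain ⟨y, hy, z, hz, hyz⟩ := Submodule.mem_sup.1 h
      obtain ⟨q, rfl⟩ := Ideal.mem_span_singleton'.1 hz
      refine ⟨Submodule.Quotient.mk q, ?_⟩
      rw [Submodule.mapQ_apply]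
      refine (Submodule.Quotient.eq J).2 ?_
      have : f * q - p = - y := by
        have : p = y + q * f := hyz.symm
        rw [this]; ring
      change f * q - p ∈ J
      rw [this]; exact J.neg_mem hy
    · rintro ⟨m', hm'⟩
      obtain ⟨q, rfl⟩ := Submodule.Quotient.mk_surjective _ m'
      rw [Submodule.mapQ_apply] at hm'
      have h1 : f * q - p ∈ J := (Submodule.Quotient.eq J).1 hm'
      have : p = q * f - (f * q - p) := by ring
      change p ∈ _
      rw [this]
      exact Ideal.sub_mem _ (Ideal.mem_sup_right (Ideal.mem_span_singleton'.2 ⟨q, rfl⟩))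
        (Ideal.mem_sup_left h1)
  · intro m
    obtain ⟨p, rfl⟩ := Submodule.Quotient.mk_surjective _ m
    exact ⟨Submodule.Quotient.mk p, rfl⟩

theorem EV_reg {i : ℕ} {J : Ideal B} {x : B} (hJ : ∀ p, x * p ∈ J → p ∈ J) (k : ℕ)
    (hk : ∀ l : L, x ^ k • l = 0)
    (h'' : ∀ j, j + 1 = i → EV B j L (B ⧸ (J ⊔ Ideal.span {x}))) : EV B i L (B ⧸ J) := by
  refine V2 x (Submodule.mapQ J (J ⊔ Ideal.span {x}) LinearMap.id
    (fun x hx => Ideal.mem_sup_left hx)) ?_ ?_ ?_ k hk h''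
  · intro m
    obtain ⟨p, rfl⟩ := Submodule.Quotient.mk_surjective _ m
    intro hm
    exact (Submodule.Quotient.mk_eq_zero _).2 (hJ p ((Submodule.Quotient.mk_eq_zero J).1 hm))
  · intro m
    obtain ⟨p, rfl⟩ := Submodule.Quotient.mk_surjective _ m
    rw [Submodule.mapQ_apply, Submodule.Quotient.mk_eq_zero]
    constructor
    · intro h
      obtain ⟨y, hy, z, hz, hyz⟩ := Submodule.mem_sup.1 h
      obtain ⟨q, rfl⟩ := Ideal.mem_span_singleton'.1 hz
      refine ⟨Submodule.Quotient.mk q, ?_⟩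
      refine (Submodule.Quotient.eq J).2 ?_
      have : x * q - p = - y := by
        have : p = y + q * x := hyz.symm
        rw [this]; ring
      change x * q - p ∈ J
      rw [this]; exact J.neg_mem hy
    · rintro ⟨m', hm'⟩
      obtain ⟨q, rfl⟩ := Submodule.Quotient.mk_surjective _ m'
      have h1 : x * q - p ∈ J := (Submodule.Quotient.eq J).1 hm'
      have : p = q * x - (x * q - p) := by ring
      change p ∈ _
      rw [this]
      exact Ideal.sub_mem _ (Ideal.mem_sup_right (Ideal.mem_span_singleton'.2 ⟨q, rfl⟩))
        (Ideal.mem_sup_left h1)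
  · intro m
    obtain ⟨p, rfl⟩ := Submodule.Quotient.mk_surjective _ m
    exact ⟨Submodule.Quotient.mk p, rfl⟩
end gen

open MvPolynomial
variable {K : Type} [Field K] {n : ℕ}

theorem PF_insert (F : Finset (Fin n)) (f : Fin n) :
    PF K F ⊔ Ideal.span {(X f : MvPolynomial (Fin n) K)} = PF K (insert f F) := by
  rw [PF, PF, Finset.coe_insert, Set.image_insert_eq, Ideal.span_insert, sup_comm]

theorem EV_PF (t i : ℕ) (F : Finset (Fin n)) (h : i < F.card) :
    EV (MvPolynomial (Fin n) K) i (MvPolynomial (Fin n) K ⧸ maxIdeal K n ^ t)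
      (MvPolynomial (Fin n) K ⧸ PF K Fᶜ) := by
  induction i generalizing F with
  | zero =>
    obtain ⟨f, hf⟩ := Finset.card_pos.1 h
    refine EV_reg (x := X f) ?_ t ?_ (fun j hj => by omega)
    · intro p hp
      have := (PF_prime (K := K) Fᶜ)
      exact (this.mem_or_mem hp).resolve_left (by simp [X_mem_PF, hf])
    · intro l
      obtain ⟨q, rfl⟩ := Ideal.Quotient.mk_surjective l
      refine (Submodule.Quotient.mk_eq_zero _).2 ?_
      exact Ideal.mul_mem_right _ _ (Ideal.pow_mem_pow (show (X f : MvPolynomial (Fin n) K) ∈ maxIdeal K n from Ideal.subset_span ⟨f, rfl⟩) t)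
  | succ i ih =>
    obtain ⟨f, hf⟩ := Finset.card_pos.1 (by omega : 0 < F.card)
    refine EV_reg (x := X f) ?_ t ?_ (fun j hj => ?_)
    · intro p hp
      have := (PF_prime (K := K) Fᶜ)
      exact (this.mem_or_mem hp).resolve_left (by simp [X_mem_PF, hf])
    · intro l
      obtain ⟨q, rfl⟩ := Ideal.Quotient.mk_surjective l
      refine (Submodule.Quotient.mk_eq_zero _).2 ?_
      exact Ideal.mul_mem_right _ _ (Ideal.pow_mem_pow (show (X f : MvPolynomial (Fin n) K) ∈ maxIdeal K n from Ideal.subset_span ⟨f, rfl⟩) t)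
    · obtain rfl : j = i := by omega
      rw [PF_insert, ← Finset.compl_erase]
      exact ih _ (by rw [Finset.card_erase_of_mem hf]; omega)

theorem prime_ge (Δ : SimComplex n) (m : ℕ) {q : Ideal (MvPolynomial (Fin n) K)} (hq : q.IsPrime)
    (h : SRSymbPow K Δ m ≤ q) : ∃ F, Δ.IsFacet F ∧ PF K Fᶜ ≤ q := by
  classical
  by_contra hc
  push Not at hc
  have h1 : ∀ F : Finset (Fin n), Δ.IsFacet F → ∃ p ∈ PF K Fᶜ, p ∉ q := fun F hF =>
    Set.not_subset.1 (hc F hF)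
  choose! p hp hpq using h1
  let s : Finset (Finset (Fin n)) := Finset.univ.filter fun F => Δ.IsFacet F
  have h2 : ∏ F ∈ s, p F ^ m ∈ SRSymbPow K Δ m := by
    simp only [SRSymbPow, Ideal.mem_iInf]
    intro F hF
    have hFs : F ∈ s := Finset.mem_filter.2 ⟨Finset.mem_univ _, hF⟩
    rw [← Finset.mul_prod_erase s _ hFs]
    exact Ideal.mul_mem_right _ _ (Ideal.pow_mem_pow (hp F hF) m)
  have h3 := h h2
  rw [hq.prod_mem_iff] at h3
  obtain ⟨F, hF, h4⟩ := h3
  exact hpq F (Finset.mem_filter.1 hF).2 (hq.mem_of_pow_mem _ h4)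

theorem dim_le {Δ : SimComplex n} {d : ℕ}
    (hfac : ∀ F, Δ.IsFacet F ↔ F ∈ Δ.faces ∧ F.card = d) (m : ℕ) :
    ringKrullDim (MvPolynomial (Fin n) K ⧸ SRSymbPow K Δ m) ≤ d := by
  rw [ringKrullDim_quotient]
  refine iSup_le fun p => ?_
  obtain ⟨F, hF, hFq⟩ := prime_ge Δ m p.head.1.2 p.head.2
  let p' : LTSeries (PrimeSpectrum.zeroLocus (R := MvPolynomial (Fin n) K) (PF K Fᶜ)) :=
    { length := p.length
      toFun := fun i => ⟨(p i).1, hFq.trans (show p.head.1 ≤ (p i).1 from p.monotone (Fin.zero_le i))⟩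
      step := fun i => p.step i }
  have h1 := Order.LTSeries.length_le_krullDim p'
  rw [← ringKrullDim_quotient, dim_quot, ((hfac F).1 hF).2] at h1
  exact h1

theorem mat_buch {Δ : SimComplex n} {d : ℕ} (hM : Δ.IsMatroid)
    (hfac : ∀ F, Δ.IsFacet F ↔ F ∈ Δ.faces ∧ F.card = d)
    (hmax : ∀ Y ∈ Δ.faces, Y.card ≤ d) (hne : ∃ F ∈ Δ.faces, F.card = d) (m : ℕ) :
    IsBuchsbaum K (SRSymbPow K Δ m) := by
  refine buch_of_EV fun i hi t => ?_
  have hid : i < d := by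
    have := hi.trans_le (dim_le hfac m)
    exact_mod_cast this
  refine filt hM hfac hmax hne m (fun J => EV (MvPolynomial (Fin n) K) i
    (MvPolynomial (Fin n) K ⧸ maxIdeal K n ^ t) (MvPolynomial (Fin n) K ⧸ J)) ?_ ?_
  · have : Subsingleton (MvPolynomial (Fin n) K ⧸ (⊤ : Ideal (MvPolynomial (Fin n) K))) :=
      Ideal.Quotient.subsingleton_iff.2 rfl
    exact EV_of_subsingleton
  · intro J f F hF hJ h
    exact EV_colon hJ (EV_PF t i F (by rw [((hfac F).1 hF).2]; exact hid)) h
end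
end EX

namespace EX
noncomputable section
section reg
open IsLocalRing
variable {B : Type} [CommRing B] [IsLocalRing B] [IsNoetherianRing B]

/-- `B/J` is regular of dimension `h` -/
def RGI (J : Ideal B) (h : ℕ) : Prop :=
  ringKrullDim (B ⧸ J) = h ∧ ∃ s : Finset B, s.card ≤ h ∧ J ⊔ Ideal.span (s : Set B) = maximalIdeal B

theorem dim_le_card {J : Ideal B} {s : Finset B} (hs : J ⊔ Ideal.span (s : Set B) = maximalIdeal B) :
    ringKrullDim (B ⧸ J) ≤ s.card := by
  classical
  have hJ : J ≤ maximalIdeal B := hs ▸ le_sup_left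
  have hJt : J ≠ ⊤ := fun h => (maximalIdeal.isMaximal B).ne_top (top_le_iff.1 (h ▸ hJ))
  have : Nontrivial (B ⧸ J) := Ideal.Quotient.nontrivial_iff.2 hJt
  have : IsLocalRing (B ⧸ J) := .of_surjective' (Ideal.Quotient.mk J) Ideal.Quotient.mk_surjective
  refine (ringKrullDim_le_spanFinrank_maximalIdeal _).trans ?_
  have e : maximalIdeal (B ⧸ J) = Ideal.span ((s.image (Ideal.Quotient.mk J) : Finset (B ⧸ J)) : Set (B ⧸ J)) := by
    rw [Finset.coe_image, ← Ideal.map_span]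
    have h1 : maximalIdeal (B ⧸ J) = (maximalIdeal B).map (Ideal.Quotient.mk J) := by
      refine le_antisymm ?_ ?_
      · intro y hy
        obtain ⟨x, rfl⟩ := Ideal.Quotient.mk_surjective y
        refine Ideal.mem_map_of_mem _ ?_
        rw [mem_maximalIdeal, mem_nonunits_iff] at hy ⊢
        exact fun h => hy (h.map _)
      · exact le_maximalIdeal (by
          intro h
          have := Ideal.comap_map_of_surjective' (Ideal.Quotient.mk J) Ideal.Quotient.mk_surjective (maximalIdeal B)
          rw [h, Ideal.comap_top, Ideal.mk_ker, sup_eq_left.2 hJ] at this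
          exact (maximalIdeal.isMaximal B).ne_top this.symm)
    rw [h1, ← hs, Ideal.map_sup, Ideal.map_quotient_self, bot_sup_eq]
  rw [e]
  have := Submodule.spanFinrank_span_le_ncard_of_finite (R := B ⧸ J) (M := B ⧸ J) (Finset.finite_toSet (s.image (Ideal.Quotient.mk J)))
  rw [Set.ncard_coe_finset] at this
  exact_mod_cast this.trans Finset.card_image_le

theorem dim_le_succ {J : Ideal B} (x : B) (hx : x ∈ maximalIdeal B) (hJ : J ≤ maximalIdeal B) :
    ringKrullDim (B ⧸ J) ≤ ringKrullDim (B ⧸ (J ⊔ Ideal.span {x})) + 1 := by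
  have hJt : J ≠ ⊤ := fun h => (maximalIdeal.isMaximal B).ne_top (top_le_iff.1 (h ▸ hJ))
  have : Nontrivial (B ⧸ J) := Ideal.Quotient.nontrivial_iff.2 hJt
  have : IsLocalRing (B ⧸ J) := .of_surjective' (Ideal.Quotient.mk J) Ideal.Quotient.mk_surjective
  have h := ringKrullDim_le_ringKrullDim_quotient_add_encard (R := B ⧸ J) {Ideal.Quotient.mk J x} (by
    rw [IsLocalRing.ringJacobson_eq_maximalIdeal]
    rw [Set.singleton_subset_iff, SetLike.mem_coe, mem_maximalIdeal, mem_nonunits_iff]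
    intro hu
    obtain ⟨y, hy⟩ := hu.exists_right_inv
    obtain ⟨z, rfl⟩ := Ideal.Quotient.mk_surjective y
    rw [← map_mul, ← map_one (Ideal.Quotient.mk J), Ideal.Quotient.eq] at hy
    have h1 : (1:B) ∈ maximalIdeal B := by
      have := (maximalIdeal B).sub_mem ((maximalIdeal B).mul_mem_right z hx) (hJ hy)
      simpa using this
    exact (maximalIdeal.isMaximal B).ne_top ((Ideal.eq_top_iff_one _).2 h1))
  have e : ((B ⧸ J) ⧸ Ideal.span {Ideal.Quotient.mk J x}) ≃+* (B ⧸ (J ⊔ Ideal.span {x})) :=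
    (Ideal.quotEquivOfEq (by rw [Ideal.map_span, Set.image_singleton])).trans
      (DoubleQuot.quotQuotEquivQuotSup J (Ideal.span {x}))
  rw [ringKrullDim_eq_of_ringEquiv e] at h
  simpa using h

theorem RGI.le {J : Ideal B} {h : ℕ} (H : RGI J h) : J ≤ maximalIdeal B := by
  obtain ⟨s, _, hs⟩ := H.2
  exact hs ▸ le_sup_left

theorem RGI.step {J : Ideal B} {h : ℕ} (H : RGI J (h+1)) {x : B} (hx : x ∈ maximalIdeal B)
    (hx2 : x ∉ J ⊔ maximalIdeal B • maximalIdeal B) : RGI (J ⊔ Ideal.span {x}) h := by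
  classical
  obtain ⟨hd, s, hsc, hs⟩ := H
  have hJ : J ≤ maximalIdeal B := hs ▸ le_sup_left
  have hxs : x ∈ J ⊔ Ideal.span (s : Set B) := hs ▸ hx
  obtain ⟨j, hj, z, hz, hxz⟩ := Submodule.mem_sup.1 hxs
  obtain ⟨c, -, hc⟩ := Submodule.mem_span_finset.1 hz
  have hsm : ∀ a ∈ s, a ∈ maximalIdeal B := fun a ha =>
    hs ▸ Ideal.mem_sup_right (Ideal.subset_span ha)
  obtain ⟨a, has, hau⟩ : ∃ a ∈ s, IsUnit (c a) := by
    by_contra hcon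
    push Not at hcon
    apply hx2
    rw [← hxz, ← hc]
    refine Ideal.add_mem _ (Ideal.mem_sup_left hj) (Ideal.mem_sup_right ?_)
    exact Submodule.sum_mem _ fun a ha => Submodule.smul_mem_smul
      ((mem_maximalIdeal _).2 (hcon a ha)) (hsm a ha)
  have hs' : (J ⊔ Ideal.span {x}) ⊔ Ideal.span ((s.erase a : Finset B) : Set B) = maximalIdeal B := by
    refine le_antisymm (sup_le (sup_le hJ ?_) ?_) ?_
    · rw [Ideal.span_le]; simpa using hx
    · rw [Ideal.span_le]; intro b hb
      exact hsm b (Finset.mem_of_mem_erase hb)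
    · rw [← hs]
      refine sup_le (le_sup_left.trans le_sup_left) ?_
      rw [Ideal.span_le]
      intro b hb
      by_cases hba : b = a
      · subst hba
        rw [SetLike.mem_coe, ← Ideal.unit_mul_mem_iff_mem _ hau]
        have : c b * b = x - j - ∑ y ∈ s.erase b, c y * y := by
          rw [← Finset.add_sum_erase s _ has] at hc
          rw [← hxz, ← hc]; simp only [smul_eq_mul]; ring
        rw [this]
        refine Ideal.sub_mem _ (Ideal.sub_mem _ ?_ ?_) ?_
        · exact Ideal.mem_sup_left (Ideal.mem_sup_right (Ideal.subset_span rfl))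
        · exact Ideal.mem_sup_left (Ideal.mem_sup_left hj)
        · exact Ideal.mem_sup_right (Ideal.sum_mem _ fun y hy =>
            Ideal.mul_mem_left _ _ (Ideal.subset_span hy))
      · exact Ideal.mem_sup_right (Ideal.subset_span (Finset.mem_erase.2 ⟨hba, hb⟩))
  have hcard : (s.erase a).card ≤ h := by
    rw [Finset.card_erase_of_mem has]; omega
  refine ⟨le_antisymm ?_ ?_, s.erase a, hcard, hs'⟩
  · exact (dim_le_card hs').trans (by exact_mod_cast hcard)
  · have h1 := dim_le_succ x hx hJ
    rw [hd] at h1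
    push_cast at h1
    by_contra hcon
    have h3 := h1.trans (ENat.WithBot.add_one_le_natCast_iff.2 (not_le.1 hcon))
    norm_cast at h3
    omega

theorem RGI.not_le {J : Ideal B} {h : ℕ} (H : RGI J (h+1)) :
    ¬ maximalIdeal B ≤ J ⊔ maximalIdeal B • maximalIdeal B := by
  intro hle
  have h1 := Submodule.le_of_le_smul_of_le_jacobson_bot
    (IsNoetherian.noetherian (maximalIdeal B)) (by rw [IsLocalRing.jacobson_eq_maximalIdeal ⊥ bot_ne_top]) hle
  have h2 : J = maximalIdeal B := le_antisymm H.le h1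
  have h3 := dim_le_card (J := J) (s := ∅) (by simpa using h2)
  rw [H.1] at h3
  norm_cast at h3

theorem RGI.prime {J : Ideal B} {h : ℕ} (H : RGI J h) : J.IsPrime := by
  classical
  induction h generalizing J with
  | zero =>
    obtain ⟨_, s, hs0, hs⟩ := H
    have : s = ∅ := Finset.card_eq_zero.1 (by omega)
    rw [this] at hs
    simp only [Finset.coe_empty, Ideal.span_empty, bot_le, sup_of_le_left] at hs
    rw [hs]; exact (maximalIdeal.isMaximal B).isPrime
  | succ h ih =>
    have hfin : J.minimalPrimes.Finite := Ideal.finite_minimalPrimes_of_isNoetherianRing B J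
    obtain ⟨x, hx, hx2, hxp⟩ : ∃ x ∈ maximalIdeal B, x ∉ J ⊔ maximalIdeal B • maximalIdeal B ∧
        ∀ p ∈ J.minimalPrimes, x ∉ p := by
      by_contra hcon
      push Not at hcon
      set N := J ⊔ maximalIdeal B • maximalIdeal B with hN
      have hsub : (maximalIdeal B : Set B) ⊆ ⋃ i ∈ ((insert N hfin.toFinset : Finset (Ideal B)) : Set (Ideal B)), (id i : Ideal B) := by
        intro x hx
        rw [Set.mem_iUnion₂]
        by_cases hx2 : x ∈ N
        · exact ⟨N, by simp, hx2⟩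
        · obtain ⟨p, hp, hxp⟩ := hcon x hx hx2
          exact ⟨p, by simp [hp], hxp⟩
      rw [Ideal.subset_union_prime N N (by
        intro i hi h1 _
        rcases Finset.mem_insert.1 hi with h2 | h2
        · exact absurd h2 h1
        · exact ((hfin.mem_toFinset.1 h2)).1.1)] at hsub
      obtain ⟨i, hi, hle⟩ := hsub
      rcases Finset.mem_insert.1 hi with h2 | h2
      · rw [h2] at hle; exact H.not_le hle
      · have hmin := hfin.mem_toFinset.1 h2
        have hpr : i.IsPrime := hmin.1.1
        have him : i = maximalIdeal B := le_antisymm (le_maximalIdeal hpr.ne_top) hle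
        have h3 : ringKrullDim (B ⧸ J) ≤ 0 := by
          rw [ringKrullDim_quotient]
          have : Subsingleton (PrimeSpectrum.zeroLocus (J : Set B)) := by
            refine ⟨fun p q => ?_⟩
            have key : ∀ p : PrimeSpectrum.zeroLocus (J : Set B), p.1.asIdeal = i := by
              intro p
              refine le_antisymm (him ▸ le_maximalIdeal p.1.2.ne_top) ?_
              exact hmin.2 ⟨p.1.2, p.2⟩ (him ▸ le_maximalIdeal p.1.2.ne_top)
            exact Subtype.ext (PrimeSpectrum.ext ((key p).trans (key q).symm))
          exact Order.krullDim_nonpos_of_subsingleton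
        rw [H.1] at h3
        norm_cast at h3
    have hpr := ih (H.step hx hx2)
    obtain ⟨p, hp, hpl⟩ := Ideal.exists_minimalPrimes_le (I := J) (J := J ⊔ Ideal.span {x}) le_sup_left
    have hpp : p.IsPrime := hp.1.1
    have : p ≤ J := by
      refine Submodule.le_of_le_smul_of_le_jacobson_bot (I := maximalIdeal B)
        (IsNoetherian.noetherian p) (by rw [IsLocalRing.jacobson_eq_maximalIdeal ⊥ bot_ne_top]) ?_
      intro y hy
      obtain ⟨j, hj, z, hz, hyz⟩ := Submodule.mem_sup.1 (hpl hy)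
      obtain ⟨r, rfl⟩ := Ideal.mem_span_singleton'.1 hz
      have hrx : r * x ∈ p := by
        have : r * x = y - j := by rw [← hyz]; ring
        rw [this]; exact p.sub_mem hy (hp.1.2 hj)
      have hr : r ∈ p := (hpp.mem_or_mem hrx).resolve_right (hxp p hp)
      rw [← hyz]
      refine Submodule.add_mem _ (Submodule.mem_sup_left hj) (Submodule.mem_sup_right ?_)
      rw [mul_comm]
      exact Submodule.smul_mem_smul hx hr
    have e : J = p := le_antisymm hp.1.2 this
    rw [e]; exact hpp

theorem RGI.EV {J : Ideal B} {h : ℕ} (H : RGI J h) {i : ℕ} (hi : i < h) :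
    EV B i (B ⧸ maximalIdeal B) (B ⧸ J) := by
  induction h generalizing J i with
  | zero => omega
  | succ h ih =>
    obtain ⟨x, hx, hx2⟩ := Set.not_subset.1 H.not_le
    have hp := H.prime
    refine EV_reg (x := x) ?_ 1 ?_ ?_
    · intro p hxp
      exact (hp.mem_or_mem hxp).resolve_left fun h => hx2 (Ideal.mem_sup_left h)
    · intro l
      obtain ⟨q, rfl⟩ := Ideal.Quotient.mk_surjective l
      refine (Submodule.Quotient.mk_eq_zero _).2 ?_
      rw [pow_one]
      exact Ideal.mul_mem_right _ _ hx
    · intro j hj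
      exact ih (H.step hx hx2) (by omega)

theorem RGI.of_reg {J : Ideal B} [hr : IsRegularLocalRing (B ⧸ J)] : ∃ h : ℕ, ringKrullDim (B ⧸ J) = h ∧ RGI J h := by
  classical
  refine ⟨_, hr.spanFinrank_maximalIdeal.symm, hr.spanFinrank_maximalIdeal.symm, ?_⟩
  obtain ⟨t, ht, hts⟩ := Submodule.FG.exists_span_set_encard_eq_spanFinrank
    (IsNoetherian.noetherian (maximalIdeal (B ⧸ J)))
  have htf : t.Finite := Set.finite_of_encard_eq_coe ht
  have hsur := Ideal.Quotient.mk_surjective (I := J)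
  let σ := Function.surjInv hsur
  have hσ : ∀ y, Ideal.Quotient.mk J (σ y) = y := Function.surjInv_eq hsur
  refine ⟨htf.toFinset.image σ, ?_, ?_⟩
  · refine Finset.card_image_le.trans ?_
    rw [htf.encard_eq_coe_toFinset_card] at ht
    exact_mod_cast ht.le
  · have hJt : J ≠ ⊤ := Ideal.Quotient.nontrivial_iff.1 inferInstance
    have hJ : J ≤ maximalIdeal B := le_maximalIdeal hJt
    have h1 : (maximalIdeal (B ⧸ J)).comap (Ideal.Quotient.mk J) = maximalIdeal B := by
      have : IsLocalHom (Ideal.Quotient.mk J) := IsLocalHom.of_surjective _ hsur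
      exact IsLocalRing.maximalIdeal_comap _
    have h2 : Ideal.map (Ideal.Quotient.mk J) (Ideal.span ((htf.toFinset.image σ : Finset B) : Set B)) = maximalIdeal (B ⧸ J) := by
      rw [Ideal.map_span, Finset.coe_image, htf.coe_toFinset, Set.image_image]
      simp only [hσ, Set.image_id']
      exact hts
    rw [← h1, ← h2, Ideal.comap_map_of_surjective' _ hsur, Ideal.mk_ker, sup_comm]
end reg
end
end EX

namespace EX
noncomputable section
section gen
variable {A : Type} [CommRing A] (P : Ideal A) [P.IsPrime]

theorem loc_colon {J J' : Ideal A} {f : A} (h : ∀ a, f * a ∈ J ↔ a ∈ J')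
    (b : Localization.AtPrime P) :
    algebraMap A (Localization.AtPrime P) f * b ∈ J.map (algebraMap A (Localization.AtPrime P)) ↔
      b ∈ J'.map (algebraMap A (Localization.AtPrime P)) := by
  obtain ⟨x, s, rfl⟩ := IsLocalization.exists_mk'_eq P.primeCompl b
  rw [← IsLocalization.mk'_one (M := P.primeCompl) (Localization.AtPrime P) f, ← IsLocalization.mk'_mul,
    IsLocalization.mk'_mem_map_algebraMap_iff, IsLocalization.mk'_mem_map_algebraMap_iff]
  refine exists_congr fun m => and_congr_right fun _ => ?_
  rw [← h, mul_left_comm]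

theorem quot_colon {I J J' : Ideal A} (hIJ : I ≤ J) {f : A} (h : ∀ a, f * a ∈ J ↔ a ∈ J')
    (b : A ⧸ I) :
    Ideal.Quotient.mk I f * b ∈ J.map (Ideal.Quotient.mk I) ↔
      b ∈ J'.map (Ideal.Quotient.mk I) := by
  obtain ⟨b, rfl⟩ := Ideal.Quotient.mk_surjective b
  have hIJ' : I ≤ J' := fun x hx => (h x).1 (J.mul_mem_left _ (hIJ hx))
  rw [← map_mul, Ideal.mem_map_iff_of_surjective _ Ideal.Quotient.mk_surjective,
    Ideal.mem_map_iff_of_surjective _ Ideal.Quotient.mk_surjective]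
  constructor
  · rintro ⟨y, hy, hyb⟩
    rw [Ideal.Quotient.eq] at hyb
    refine ⟨b, (h b).1 ?_, rfl⟩
    have := J.sub_mem hy (hIJ hyb)
    simpa using this
  · rintro ⟨y, hy, hyb⟩
    rw [Ideal.Quotient.eq] at hyb
    refine ⟨f * b, (h b).2 ?_, rfl⟩
    have := J'.sub_mem hy (hIJ' hyb)
    simpa using this

theorem loc_top {J : Ideal A} (h : ¬ J ≤ P) : J.map (algebraMap A (Localization.AtPrime P)) = ⊤ := by
  obtain ⟨x, hx, hxP⟩ := Set.not_subset.1 h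
  refine Ideal.eq_top_of_isUnit_mem _ (Ideal.mem_map_of_mem _ hx) ?_
  exact IsLocalization.map_units (Localization.AtPrime P) (⟨x, hxP⟩ : P.primeCompl)

theorem loc_quot {J : Ideal A} (hJ : J ≤ P) (hpr : (P.map (Ideal.Quotient.mk J)).IsPrime) :
    IsLocalization.AtPrime (Localization.AtPrime P ⧸ J.map (algebraMap A (Localization.AtPrime P)))
      (P.map (Ideal.Quotient.mk J)) := by
  have h : Algebra.algebraMapSubmonoid (A ⧸ J) P.primeCompl = (P.map (Ideal.Quotient.mk J)).primeCompl := by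
    ext y
    obtain ⟨x, rfl⟩ := Ideal.Quotient.mk_surjective y
    have hmem : ∀ x, Ideal.Quotient.mk J x ∈ P.map (Ideal.Quotient.mk J) ↔ x ∈ P := by
      intro x
      rw [Ideal.mem_quotient_iff_mem hJ]
    constructor
    · rintro ⟨z, hz, hzx⟩
      rw [← hzx]
      exact fun h => hz ((hmem z).1 h)
    · intro hx
      exact ⟨x, fun h => hx ((hmem x).2 h), rfl⟩
  have := (inferInstance : IsLocalization (Algebra.algebraMapSubmonoid (A ⧸ J) P.primeCompl)
    (Localization.AtPrime P ⧸ J.map (algebraMap A (Localization.AtPrime P))))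
  rw [h] at this
  exact this
end gen

open MvPolynomial
variable {K : Type} [Field K] {n : ℕ}

theorem PF_lt {F : Finset (Fin n)} {f : Fin n} (hf : f ∉ F) : PF K F < PF K (insert f F) := by
  refine lt_of_le_of_ne (by rw [← PF_insert]; exact le_sup_left) fun h => hf ?_
  rw [← X_mem_PF (K := K), h, X_mem_PF]
  exact Finset.mem_insert_self _ _

theorem height_PF (F : Finset (Fin n)) : (F.card : ℕ∞) ≤ (PF K F).height := by
  classical
  induction F using Finset.induction_on with
  | empty => simp
  | insert f F hf ih =>
    have := PF_prime (K := K) F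
    have := PF_prime (K := K) (insert f F)
    rw [Finset.card_insert_of_notMem hf]
    push_cast
    exact (add_le_add_left ih 1).trans (Ideal.height_add_one_le_of_lt_of_isPrime (PF_lt hf))

theorem spanFinrank_PF (F : Finset (Fin n)) : (PF K F).spanFinrank ≤ F.card := by
  classical
  have := Submodule.spanFinrank_span_le_ncard_of_finite (R := MvPolynomial (Fin n) K)
    (M := MvPolynomial (Fin n) K)
    (Finset.finite_toSet (F.image (fun i => (X i : MvPolynomial (Fin n) K))))
  rw [Set.ncard_coe_finset, Finset.coe_image] at this
  exact this.trans Finset.card_image_le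

theorem height_bound {Δ : SimComplex n} {d : ℕ}
    (hfac : ∀ F, Δ.IsFacet F ↔ F ∈ Δ.faces ∧ F.card = d) (m : ℕ)
    (P : Ideal (MvPolynomial (Fin n) K ⧸ SRSymbPow K Δ m)) [hP : P.IsPrime] :
    P.height + (n - d : ℕ) ≤ (P.comap (Ideal.Quotient.mk (SRSymbPow K Δ m))).height := by
  have hPc : (P.comap (Ideal.Quotient.mk (SRSymbPow K Δ m))).IsPrime := Ideal.comap_isPrime _ _
  obtain ⟨H, hH⟩ : ∃ H : ℕ, (P.comap (Ideal.Quotient.mk (SRSymbPow K Δ m))).height = H :=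
    ENat.ne_top_iff_exists.1 (Ideal.height_ne_top hPc.ne_top) |>.imp fun _ h => h.symm
  rw [hH]
  have key : ∀ p : LTSeries (PrimeSpectrum (MvPolynomial (Fin n) K ⧸ SRSymbPow K Δ m)),
      p.last = ⟨P, hP⟩ → p.length + (n - d) ≤ H := by
    intro p hp
    have hstep : ∀ i : ℕ, ∀ hi : i < p.length + 1, ((i + (n - d) : ℕ) : ℕ∞) ≤
        ((p ⟨i, hi⟩).asIdeal.comap (Ideal.Quotient.mk (SRSymbPow K Δ m))).height := by
      intro i
      induction i with
      | zero =>
        intro hi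
        have hpr : ((p ⟨0, hi⟩).asIdeal.comap (Ideal.Quotient.mk (SRSymbPow K Δ m))).IsPrime :=
          Ideal.comap_isPrime _ _
        obtain ⟨F, hF, hFq⟩ := prime_ge Δ m hpr (by
          conv_lhs => rw [← Ideal.mk_ker (I := SRSymbPow K Δ m)]
          exact Ideal.comap_mono bot_le)
        refine le_trans ?_ (Ideal.height_mono hFq)
        refine le_trans ?_ (height_PF Fᶜ)
        rw [Finset.card_compl, ((hfac F).1 hF).2, Fintype.card_fin, zero_add]
      | succ i ih =>
        intro hi
        have h1 := ih (by omega)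
        have hpr : ((p ⟨i, by omega⟩).asIdeal.comap (Ideal.Quotient.mk (SRSymbPow K Δ m))).IsPrime :=
          Ideal.comap_isPrime _ _
        have hpr' : ((p ⟨i+1, hi⟩).asIdeal.comap (Ideal.Quotient.mk (SRSymbPow K Δ m))).IsPrime :=
          Ideal.comap_isPrime _ _
        have hlt : (p ⟨i, by omega⟩).asIdeal.comap (Ideal.Quotient.mk (SRSymbPow K Δ m)) <
            (p ⟨i+1, hi⟩).asIdeal.comap (Ideal.Quotient.mk (SRSymbPow K Δ m)) := by
          have h2 : p ⟨i, by omega⟩ < p ⟨i+1, hi⟩ := p.strictMono (by simp)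
          refine lt_of_le_of_ne (Ideal.comap_mono h2.le) fun h => h2.ne ?_
          exact PrimeSpectrum.ext (Ideal.comap_injective_of_surjective _ Ideal.Quotient.mk_surjective h)
        have h3 := Ideal.height_add_one_le_of_lt_of_isPrime hlt
        refine le_trans ?_ h3
        refine le_trans ?_ (add_le_add_left h1 1)
        push_cast
        rw [add_right_comm]
    have h1 := hstep p.length (by omega)
    have e : p ⟨p.length, by omega⟩ = ⟨P, hP⟩ := hp
    rw [e] at h1
    change _ ≤ (P.comap (Ideal.Quotient.mk (SRSymbPow K Δ m))).height at h1
    rw [hH] at h1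
    exact_mod_cast h1
  have h0 : n - d ≤ H := by
    have := key (RelSeries.singleton _ ⟨P, hP⟩) rfl
    simp at this
    omega
  have h2 : P.height ≤ ((H - (n - d) : ℕ) : ℕ∞) := by
    refine (PrimeSpectrum.height_eq_orderHeight (⟨P, hP⟩ : PrimeSpectrum _)).le.trans ?_
    refine Order.height_le fun p hp => ?_
    have := key p hp
    exact_mod_cast (by omega : p.length ≤ H - (n-d))
  refine (add_le_add_left h2 _).trans ?_
  norm_cast
  omega
end
end EX

namespace EX
noncomputable section
open MvPolynomial IsLocalRing
section gen
variable {A : Type} [CommRing A] (P : Ideal A) [P.IsPrime]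
def EVL (i : ℕ) (J : Ideal A) : Prop :=
  EV (Localization.AtPrime P) i (Localization.AtPrime P ⧸ maximalIdeal (Localization.AtPrime P))
      (Localization.AtPrime P ⧸ J.map (algebraMap _ (Localization.AtPrime P)))

theorem EVL_top (i : ℕ) : EVL P i ⊤ := by
  unfold EVL
  rw [Ideal.map_top]
  have := Ideal.Quotient.subsingleton_iff.2 (rfl : (⊤ : Ideal (Localization.AtPrime P)) = ⊤)
  exact EV_of_subsingleton

theorem EVL_bot {i : ℕ} (h : EVL P i ⊥) : EV (Localization.AtPrime P) i
    (Localization.AtPrime P ⧸ maximalIdeal (Localization.AtPrime P)) (Localization.AtPrime P) := by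
  unfold EVL at h
  rw [Ideal.map_bot] at h
  exact EV_congr (Submodule.quotEquivOfEqBot (⊥ : Ideal (Localization.AtPrime P)) rfl) h

theorem EVL_colon {i : ℕ} {J J' : Ideal A} {f : A} (hc : ∀ p, f * p ∈ J ↔ p ∈ J') (h1 : EVL P i J')
    (h2 : EVL P i (J ⊔ Ideal.span {f})) : EVL P i J := by
  refine EV_colon (loc_colon P hc) h1 ?_
  unfold EVL at h2
  rw [Ideal.map_sup, Ideal.map_span, Set.image_singleton] at h2
  exact h2

theorem EVL_reg [IsNoetherianRing A] {i : ℕ} {J : Ideal A} (hreg : IsRegularRing (A ⧸ J))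
    (hi : J ≤ P → (i : ℕ∞) < (P.map (Ideal.Quotient.mk J)).height) : EVL P i J := by
  unfold EVL
  by_cases hJP : J ≤ P
  swap
  · have := Ideal.Quotient.subsingleton_iff.2 (loc_top P hJP)
    exact EV_of_subsingleton
  have hpr : (P.map (Ideal.Quotient.mk J)).IsPrime := Ideal.isPrime_map_quotientMk_of_isPrime hJP
  have hloc := loc_quot P hJP hpr
  have e2 := (IsLocalization.algEquiv (P.map (Ideal.Quotient.mk J)).primeCompl
    (Localization.AtPrime (P.map (Ideal.Quotient.mk J)))
    (Localization.AtPrime P ⧸ J.map (algebraMap _ (Localization.AtPrime P)))).toRingEquiv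
  have hrl : IsRegularLocalRing (Localization.AtPrime (P.map (Ideal.Quotient.mk J))) :=
    IsRegularRing.isRegularLocalRing_localization _
  have hrl' : IsRegularLocalRing (Localization.AtPrime P ⧸ J.map (algebraMap _ (Localization.AtPrime P))) :=
    IsRegularLocalRing.of_ringEquiv e2
  have hN : IsNoetherianRing (Localization.AtPrime P) := IsLocalization.isNoetherianRing P.primeCompl _ ‹_›
  obtain ⟨h, hh, H⟩ := RGI.of_reg (J := J.map (algebraMap _ (Localization.AtPrime P)))
  refine H.EV ?_
  have h1 := IsLocalization.AtPrime.ringKrullDim_eq_height (P.map (Ideal.Quotient.mk J))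
    (Localization.AtPrime P ⧸ J.map (algebraMap _ (Localization.AtPrime P)))
  rw [hh] at h1
  have h1' : (P.map (Ideal.Quotient.mk J)).height = h := by exact_mod_cast h1.symm
  have := hi hJP
  rw [h1'] at this
  exact_mod_cast this

theorem CM_crit (h : ∀ (P : Ideal A) [P.IsPrime] (i : ℕ), (i : ℕ∞) < P.height → EVL P i ⊥) :
    IsCohenMacaulayRing A := by
  intro P hP
  change IsCohenMacaulayLocalRing (Localization.AtPrime P)
  intro i hi
  rw [IsLocalization.AtPrime.ringKrullDim_eq_height P] at hi
  exact EVL_bot P (h P i (by exact_mod_cast hi))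
end gen
variable {K : Type} [Field K] {n : ℕ}

theorem comap_map_quot {S : Type} [CommRing S] {I J : Ideal S} (h : I ≤ J) (P : Ideal (S ⧸ I))
    (hJP : J.map (Ideal.Quotient.mk I) ≤ P) :
    ((P.map (Ideal.Quotient.mk (J.map (Ideal.Quotient.mk I)))).comap
      (DoubleQuot.quotQuotEquivQuotOfLE h).symm) =
      (P.comap (Ideal.Quotient.mk I)).map (Ideal.Quotient.mk J) := by
  ext y
  obtain ⟨z, rfl⟩ := Ideal.Quotient.mk_surjective y
  have h1 : (Ideal.Quotient.mk (J.map (Ideal.Quotient.mk I)) (Ideal.Quotient.mk I z) ∈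
    P.map (Ideal.Quotient.mk (J.map (Ideal.Quotient.mk I)))) ↔ Ideal.Quotient.mk I z ∈ P :=
    Ideal.mem_quotient_iff_mem hJP
  have h2 : Ideal.Quotient.mk J z ∈ (P.comap (Ideal.Quotient.mk I)).map (Ideal.Quotient.mk J) ↔
    z ∈ P.comap (Ideal.Quotient.mk I) := Ideal.mem_quotient_iff_mem (Ideal.map_le_iff_le_comap.1 hJP)
  rw [h2]
  exact h1

theorem EV_facet {Δ : SimComplex n} {d : ℕ}
    (hfac : ∀ F, Δ.IsFacet F ↔ F ∈ Δ.faces ∧ F.card = d) (m : ℕ)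
    (P : Ideal (MvPolynomial (Fin n) K ⧸ SRSymbPow K Δ m)) [hP : P.IsPrime] {i : ℕ}
    (hi : (i : ℕ∞) < P.height) {F : Finset (Fin n)} (hF : Δ.IsFacet F)
    (hle : SRSymbPow K Δ m ≤ PF K Fᶜ) :
    EVL P i ((PF K Fᶜ).map (Ideal.Quotient.mk (SRSymbPow K Δ m))) := by
  have hreg : IsRegularRing ((MvPolynomial (Fin n) K ⧸ SRSymbPow K Δ m) ⧸
      (PF K Fᶜ).map (Ideal.Quotient.mk (SRSymbPow K Δ m))) :=
    IsRegularRing.of_ringEquiv ((DoubleQuot.quotQuotEquivQuotOfLE hle).trans (quotEquiv K F)).symm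
  refine EVL_reg P hreg fun hJP => hi.trans_le ?_
  let I := SRSymbPow K Δ m
  have h2 : (P.map (Ideal.Quotient.mk ((PF K Fᶜ).map (Ideal.Quotient.mk I)))).height =
     ((P.comap (Ideal.Quotient.mk I)).map (Ideal.Quotient.mk (PF K Fᶜ))).height := by
    rw [← comap_map_quot hle P hJP]
    exact (RingEquiv.height_comap _ _).symm
  rw [h2]
  have hPc : (P.comap (Ideal.Quotient.mk I)).IsPrime := Ideal.comap_isPrime _ _
  have h3 := Ideal.height_le_height_add_spanFinrank_of_le (Ideal.map_le_iff_le_comap.1 hJP)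
  have h4 := height_bound hfac m P
  have h5 := spanFinrank_PF (K := K) Fᶜ
  rw [Finset.card_compl, Fintype.card_fin, ((hfac F).1 hF).2] at h5
  have h6 := h4.trans (h3.trans (add_le_add_right (Nat.cast_le.2 h5) _))
  exact (ENat.add_le_add_iff_right (ENat.coe_ne_top _)).1 h6

theorem mat_CM {Δ : SimComplex n} (hM : Δ.IsMatroid) {d : ℕ}
    (hfac : ∀ F, Δ.IsFacet F ↔ F ∈ Δ.faces ∧ F.card = d) (hmax : ∀ Y ∈ Δ.faces, Y.card ≤ d)
    (hne : ∃ F ∈ Δ.faces, F.card = d) (m : ℕ) : IsCohenMacaulayIdeal (SRSymbPow K Δ m) := by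
  refine CM_crit fun P _ i hi => ?_
  have key := filt (K := K) hM hfac hmax hne m (fun J => SRSymbPow K Δ m ≤ J →
    EVL P i (J.map (Ideal.Quotient.mk (SRSymbPow K Δ m)))) ?_ ?_ le_rfl
  · rw [Ideal.map_quotient_self] at key
    exact key
  · intro _
    rw [Ideal.map_top]
    exact EVL_top P i
  · intro J f F hF hc hQ hIJ
    have hIF : SRSymbPow K Δ m ≤ PF K Fᶜ := fun x hx => (hc x).1 (J.mul_mem_left _ (hIJ hx))
    refine EVL_colon P (quot_colon hIJ hc) (EV_facet hfac m P hi hF hIF) ?_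
    have := hQ (hIJ.trans le_sup_left)
    rw [Ideal.map_sup, Ideal.map_span, Set.image_singleton] at this
    exact this
end
end EX

namespace EX
noncomputable section
variable {n : ℕ}

/-- augmentation among faces sharing a vertex -/
def LM (Δ : SimComplex n) : Prop := ∀ v, ∀ F ∈ Δ.faces, ∀ G ∈ Δ.faces, v ∈ F → v ∈ G →
  G.card < F.card → ∃ i ∈ F, i ∉ G ∧ insert i G ∈ Δ.faces

theorem LM.aug {Δ : SimComplex n} (h : LM Δ) {v : Fin n} {F G : Finset (Fin n)} (hF : F ∈ Δ.faces)
    (hG : G ∈ Δ.faces) (hvF : v ∈ F) (hvG : v ∈ G) (hc : G.card ≤ F.card) :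
    ∃ F' ∈ Δ.faces, G ⊆ F' ∧ F' ⊆ G ∪ F ∧ F'.card = F.card := by
  obtain ⟨k, hk⟩ := Nat.exists_eq_add_of_le hc
  induction k generalizing G with
  | zero => exact ⟨G, hG, subset_rfl, Finset.subset_union_left, by omega⟩
  | succ k ih =>
    obtain ⟨i, hiF, hiG, hi⟩ := h v F hF G hG hvF hvG (by omega)
    have hcard := Finset.card_insert_of_notMem hiG
    obtain ⟨F', h1, h2, h3, h4⟩ := ih hi (Finset.mem_insert_of_mem hvG) (by omega) (by omega)
    refine ⟨F', h1, (Finset.subset_insert _ _).trans h2, h3.trans ?_, h4⟩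
    intro x
    simp only [Finset.mem_union, Finset.mem_insert]
    rintro ((rfl | h) | h) <;> tauto

theorem LM.three {Δ : SimComplex n} (h : LM Δ) {a b x y : Fin n} (hab : a ≠ b)
    (hf : ({a, b} : Finset (Fin n)) ∈ Δ.faces) (hf' : ({b, x, y} : Finset (Fin n)) ∈ Δ.faces)
    (h1 : b ≠ x) (h2 : b ≠ y) (h3 : x ≠ y) :
    (x ≠ a ∧ ({x, a, b} : Finset (Fin n)) ∈ Δ.faces) ∨
    (y ≠ a ∧ ({y, a, b} : Finset (Fin n)) ∈ Δ.faces) := by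
  obtain ⟨i, hi, hi', hi''⟩ := h b _ hf' _ hf (by simp) (by simp) (by
    rw [Finset.card_pair hab, Finset.card_eq_three.2 ⟨b, x, y, h1, h2, h3, rfl⟩]; omega)
  simp only [Finset.mem_insert, Finset.mem_singleton] at hi hi'
  push Not at hi'
  rcases hi with rfl | rfl | rfl
  · exact absurd rfl hi'.2
  · exact Or.inl ⟨hi'.1, hi''⟩
  · exact Or.inr ⟨hi'.1, hi''⟩

theorem sub_face {Δ : SimComplex n} {x a b : Fin n} (h : ({x, a, b} : Finset (Fin n)) ∈ Δ.faces) :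
    ({x, a} : Finset (Fin n)) ∈ Δ.faces ∧ ({x, b} : Finset (Fin n)) ∈ Δ.faces ∧
    ({a, b} : Finset (Fin n)) ∈ Δ.faces := by
  refine ⟨Δ.down_closed h ?_, Δ.down_closed h ?_, Δ.down_closed h ?_⟩ <;>
  · intro y; simp only [Finset.mem_insert, Finset.mem_singleton]; tauto

def E3 (Δ : SimComplex n) : Prop := ∀ p q, p ≠ q → ({p, q} : Finset (Fin n)) ∈ Δ.faces →
  ∃ z, z ≠ p ∧ z ≠ q ∧ ({p, q, z} : Finset (Fin n)) ∈ Δ.faces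

theorem perm3 {Δ : SimComplex n} {x a b : Fin n} (h : ({x, a, b} : Finset (Fin n)) ∈ Δ.faces) :
    ({a, x, b} : Finset (Fin n)) ∈ Δ.faces ∧ ({b, x, a} : Finset (Fin n)) ∈ Δ.faces ∧
    ({a, b, x} : Finset (Fin n)) ∈ Δ.faces ∧ ({b, a, x} : Finset (Fin n)) ∈ Δ.faces := by
  refine ⟨Δ.down_closed h ?_, Δ.down_closed h ?_, Δ.down_closed h ?_, Δ.down_closed h ?_⟩ <;>
  · intro y; simp only [Finset.mem_insert, Finset.mem_singleton]; tauto

theorem comm2 {Δ : SimComplex n} {x a : Fin n} (h : ({x, a} : Finset (Fin n)) ∈ Δ.faces) :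
    ({a, x} : Finset (Fin n)) ∈ Δ.faces := by rwa [Finset.pair_comm]

theorem dist_two {Δ : SimComplex n} (hL : LM Δ) (h3 : E3 Δ) {u p q w : Fin n}
    (hup : u ≠ p) (hpq : p ≠ q) (hqw : q ≠ w) (h1 : ({u, p} : Finset (Fin n)) ∈ Δ.faces)
    (h2 : ({p, q} : Finset (Fin n)) ∈ Δ.faces) (h4 : ({q, w} : Finset (Fin n)) ∈ Δ.faces)
    (huq : u ≠ q) (hpw : p ≠ w) :
    ∃ z, z ≠ u ∧ z ≠ w ∧ ({u, z} : Finset (Fin n)) ∈ Δ.faces ∧ ({z, w} : Finset (Fin n)) ∈ Δ.faces := by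
  obtain ⟨z, hzp, hzq, hz⟩ := h3 p q hpq h2
  rcases hL.three hup h1 hz hpq hzp.symm hzq.symm with ⟨h5, h6⟩ | ⟨h5, h6⟩
  · exact ⟨q, h5, hqw, comm2 (sub_face h6).1, h4⟩
  · rcases hL.three hqw.symm (comm2 h4) (perm3 hz).1 hpq.symm hzq.symm hzp.symm with ⟨h7, h8⟩ | ⟨h7, h8⟩
    · exact ⟨p, hup.symm, h7, h1, (sub_face h8).1⟩
    · exact ⟨z, h5, h7, comm2 (sub_face h6).1, (sub_face h8).1⟩

theorem vertex_edge {Δ : SimComplex n} (hL : LM Δ) (h3 : E3 Δ) {g p h1 h2 : Fin n}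
    (hgp : g ≠ p) (hp1 : p ≠ h1) (h12 : h1 ≠ h2)
    (f1 : ({g, p} : Finset (Fin n)) ∈ Δ.faces) (f2 : ({p, h1} : Finset (Fin n)) ∈ Δ.faces)
    (f3 : ({h1, h2} : Finset (Fin n)) ∈ Δ.faces) :
    ({g, h1} : Finset (Fin n)) ∈ Δ.faces ∨ ({g, h2} : Finset (Fin n)) ∈ Δ.faces := by
  have ca : ∀ p, g ≠ p → p ≠ h1 → p ≠ h2 → ({g, p} : Finset (Fin n)) ∈ Δ.faces →
      ({p, h1, h2} : Finset (Fin n)) ∈ Δ.faces →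
      ({g, h1} : Finset (Fin n)) ∈ Δ.faces ∨ ({g, h2} : Finset (Fin n)) ∈ Δ.faces := by
    intro p hgp hp1 hp2 f1 f
    rcases hL.three hgp f1 f hp1 hp2 h12 with ⟨_, h⟩ | ⟨_, h⟩
    · exact Or.inl (comm2 (sub_face h).1)
    · exact Or.inr (comm2 (sub_face h).1)
  by_cases hp2 : p = h2
  · subst hp2; exact Or.inr f1
  obtain ⟨z, hz1, hz2, hz⟩ := h3 h1 h2 h12 f3
  rcases hL.three hp1 f2 hz h12 hz1.symm hz2.symm with ⟨_, h⟩ | ⟨h5, h⟩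
  · exact ca p hgp hp1 hp2 f1 (perm3 h).2.2.1
  · rcases hL.three hgp f1 (perm3 h).2.2.1 hp1 h5.symm hz1.symm with ⟨_, h6⟩ | ⟨h7, h6⟩
    · exact Or.inl (comm2 (sub_face h6).1)
    · exact ca z h7.symm hz1 hz2 (comm2 (sub_face h6).1) (perm3 hz).2.1

def H1 (Δ : SimComplex n) (d : ℕ) : Prop := ∀ G ∈ Δ.faces, G.card + 2 ≤ d → ∀ A : Set (Fin n),
  ∀ v ∈ A, ∀ v' ∉ A, v ∉ G → v' ∉ G → insert v G ∈ Δ.faces → insert v' G ∈ Δ.faces →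
  ∃ p ∈ A, ∃ q ∉ A, p ∉ G ∧ q ∉ G ∧ insert p (insert q G) ∈ Δ.faces

def H2 (Δ : SimComplex n) (d : ℕ) : Prop := ∀ G ∈ Δ.faces, G.card + 2 = d → ∀ u v w,
  u ≠ v → v ≠ w → u ≠ w → u ∉ G → v ∉ G → w ∉ G → insert u (insert w G) ∈ Δ.faces → insert v G ∈ Δ.faces →
  insert u (insert v G) ∈ Δ.faces ∨ insert w (insert v G) ∈ Δ.faces

theorem mat_of_LM {Δ : SimComplex n} (hL : LM Δ) (h3 : E3 Δ) {d : ℕ} (hd : 3 ≤ d) (h1 : H1 Δ d) : Δ.IsMatroid := by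
  intro F G hF hG hc
  rcases Finset.eq_empty_or_nonempty G with rfl | ⟨g, hg⟩
  · obtain ⟨i, hi⟩ := Finset.card_pos.1 (by simpa using hc)
    exact ⟨i, hi, by simp, Δ.down_closed hF (by simpa using hi)⟩
  by_cases hgF : g ∈ F
  · exact hL g F hF G hG hgF hg hc
  have hGc := Finset.card_pos.2 ⟨g, hg⟩
  obtain ⟨k1, k2, hk1, hk2, hk⟩ := Finset.one_lt_card_iff.1 (by omega : 1 < F.card)
  have hne : (∅ : Finset (Fin n)) ∈ Δ.faces := Δ.down_closed hF (by simp)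
  have hgs : insert g (∅ : Finset (Fin n)) ∈ Δ.faces := Δ.down_closed hG (by simpa using hg)
  have hk1s : insert k1 (∅ : Finset (Fin n)) ∈ Δ.faces := Δ.down_closed hF (by simpa using hk1)
  have f3 : ({k1, k2} : Finset (Fin n)) ∈ Δ.faces := Δ.down_closed hF (by
    intro x; simp only [Finset.mem_insert, Finset.mem_singleton]; rintro (rfl | rfl) <;> assumption)
  have hD : ({g, k1} : Finset (Fin n)) ∈ Δ.faces ∨
      ∃ z, z ≠ g ∧ z ≠ k1 ∧ ({g, z} : Finset (Fin n)) ∈ Δ.faces ∧ ({z, k1} : Finset (Fin n)) ∈ Δ.faces := by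
    by_contra hcon
    obtain ⟨p, hp, q, hq, -, -, hpq⟩ := h1 ∅ hne (by simpa using by omega) {x | x = g ∨ (({g, x} : Finset (Fin n)) ∈ Δ.faces ∨
      ∃ z, z ≠ g ∧ z ≠ x ∧ ({g, z} : Finset (Fin n)) ∈ Δ.faces ∧ ({z, x} : Finset (Fin n)) ∈ Δ.faces)}
      g (Or.inl rfl) k1 (by
        rintro (rfl | h)
        · exact hgF hk1
        · exact hcon h) (by simp) (by simp) hgs hk1s
    have hpq' : ({p, q} : Finset (Fin n)) ∈ Δ.faces := hpq
    have hpneq : p ≠ q := by rintro rfl; exact hq hp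
    apply hq
    by_cases hgq : g = q
    · exact Or.inl hgq.symm
    right
    rcases hp with rfl | h | ⟨z, hz1, hz2, h5, h6⟩
    · exact Or.inl hpq'
    · by_cases hpg : p = g
      · subst hpg; exact Or.inl hpq'
      · exact Or.inr ⟨p, hpg, hpneq, h, hpq'⟩
    · by_cases hgp : g = p
      · subst hgp; exact Or.inl hpq'
      by_cases hzq : z = q
      · subst hzq; exact Or.inl h5
      exact Or.inr (dist_two hL h3 hz1.symm hz2 hpneq h5 h6 hpq' hgp hzq)
  have hC : ∃ h ∈ F, ({g, h} : Finset (Fin n)) ∈ Δ.faces := by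
    rcases hD with h | ⟨z, hz1, hz2, h5, h6⟩
    · exact ⟨k1, hk1, h⟩
    · rcases vertex_edge hL h3 hz1.symm hz2 hk h5 h6 f3 with h | h
      · exact ⟨k1, hk1, h⟩
      · exact ⟨k2, hk2, h⟩
  obtain ⟨h, hhF, hh⟩ := hC
  have hgh : g ≠ h := by rintro rfl; exact hgF hhF
  obtain ⟨F', e1, e2, e3, e4⟩ := hL.aug hF hh hhF (by simp) (by rw [Finset.card_pair hgh]; omega)
  obtain ⟨i, hi, hi', hi''⟩ := hL g F' e1 G hG (e2 (by simp)) hg (by omega)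
  refine ⟨i, ?_, hi', hi''⟩
  have := e3 hi
  simp only [Finset.mem_union, Finset.mem_insert, Finset.mem_singleton] at this
  rcases this with (rfl | rfl) | h
  · exact absurd hg hi'
  · exact hhF
  · exact h

theorem mat_of_H (d : ℕ) : ∀ Δ : SimComplex n, (∀ F ∈ Δ.faces, ∃ F' ∈ Δ.faces, F ⊆ F' ∧ F'.card = d) →
    (∀ F ∈ Δ.faces, F.card ≤ d) → H1 Δ d → H2 Δ d → Δ.IsMatroid := by
  induction d with
  | zero =>
    intro Δ _ hmax _ _ F G hF _ hc
    have := hmax F hF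
    omega
  | succ d ih =>
    intro Δ hext hmax h1 h2
    have hsmall : ∀ F ∈ Δ.faces, F.card > 0 → ∃ i ∈ F, i ∉ (∅ : Finset (Fin n)) ∧ insert i ∅ ∈ Δ.faces := by
      intro F hF hc
      obtain ⟨i, hi⟩ := Finset.card_pos.1 hc
      exact ⟨i, hi, by simp, Δ.down_closed hF (by simpa using hi)⟩
    rcases (by omega : d = 0 ∨ d = 1 ∨ 2 ≤ d) with rfl | rfl | hd
    · intro F G hF hG hc
      have := hmax F hF
      have : G = ∅ := Finset.card_eq_zero.1 (by omega)
      subst this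
      exact hsmall F hF (by omega)
    · intro F G hF hG hc
      have hF2 := hmax F hF
      by_cases hG0 : G = ∅
      · subst hG0
        exact hsmall F hF (by simpa using hc)
      have := Finset.card_pos.2 (Finset.nonempty_iff_ne_empty.2 hG0)
      obtain ⟨v, rfl⟩ := Finset.card_eq_one.1 (by omega : G.card = 1)
      obtain ⟨u, w, huw, rfl⟩ := Finset.card_eq_two.1 (by omega : F.card = 2)
      by_cases hvu : v = u
      · subst hvu
        exact ⟨w, by simp, by simpa using huw.symm, by rw [Finset.pair_comm]; exact hF⟩
      by_cases hvw : v = w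
      · subst hvw
        exact ⟨u, by simp, by simpa using huw, hF⟩
      have := h2 ∅ (Δ.down_closed hF (by simp)) (by simp) u v w (Ne.symm hvu) hvw huw (by simp) (by simp)
        (by simp) hF hG
      rcases this with h | h
      · exact ⟨u, by simp, by simpa using Ne.symm hvu, h⟩
      · exact ⟨w, by simp, by simpa using Ne.symm hvw, h⟩
    · have hL : LM Δ := by
        intro v F hF G hG hvF hvG hc
        have hlk : ∀ X, X ∈ (Δ.link {v}).faces ↔ v ∉ X ∧ insert v X ∈ Δ.faces := by
          intro X
          change (Disjoint X {v} ∧ X ∪ {v} ∈ Δ.faces) ↔ _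
          rw [Finset.disjoint_singleton_right, Finset.union_comm, Finset.insert_eq]
        have key := ih (Δ.link {v}) ?_ ?_ ?_ ?_ (F.erase v) (G.erase v)
          ((hlk _).2 ⟨by simp, by rwa [Finset.insert_erase hvF]⟩)
          ((hlk _).2 ⟨by simp, by rwa [Finset.insert_erase hvG]⟩) (by
            rw [Finset.card_erase_of_mem hvF, Finset.card_erase_of_mem hvG]
            have := Finset.card_pos.2 ⟨v, hvG⟩
            omega)
        · obtain ⟨i, hi1, hi2, hi3⟩ := key
          have hiv := Finset.ne_of_mem_erase hi1
          refine ⟨i, Finset.mem_of_mem_erase hi1, fun h => hi2 (Finset.mem_erase.2 ⟨hiv, h⟩), ?_⟩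
          have := ((hlk _).1 hi3).2
          rwa [Finset.insert_comm, Finset.insert_erase hvG] at this
        · intro X hX
          obtain ⟨hvX, hX'⟩ := (hlk X).1 hX
          obtain ⟨Y, hY, hXY, hYc⟩ := hext _ hX'
          have hvY : v ∈ Y := hXY (Finset.mem_insert_self _ _)
          refine ⟨Y.erase v, (hlk _).2 ⟨by simp, by rwa [Finset.insert_erase hvY]⟩, ?_, ?_⟩
          · intro x hx
            exact Finset.mem_erase.2 ⟨fun h => hvX (h ▸ hx), hXY (Finset.mem_insert_of_mem hx)⟩
          · rw [Finset.card_erase_of_mem hvY]; omega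
        · intro X hX
          obtain ⟨hvX, hX'⟩ := (hlk X).1 hX
          have := hmax _ hX'
          rw [Finset.card_insert_of_notMem hvX] at this
          omega
        · intro X hX hXc A a ha b hb haX hbX hXa hXb
          obtain ⟨hvX, hX'⟩ := (hlk X).1 hX
          obtain ⟨hva, hXa'⟩ := (hlk _).1 hXa
          obtain ⟨hvb, hXb'⟩ := (hlk _).1 hXb
          rw [Finset.insert_comm] at hXa' hXb'
          simp only [Finset.mem_insert, not_or] at hva hvb
          obtain ⟨p, hp, q, hq, hpX, hqX, h⟩ := h1 (insert v X) hX' (by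
            rw [Finset.card_insert_of_notMem hvX]; omega) A a ha b hb
            (by simp only [Finset.mem_insert, not_or]; exact ⟨Ne.symm hva.1, haX⟩)
            (by simp only [Finset.mem_insert, not_or]; exact ⟨Ne.symm hvb.1, hbX⟩) hXa' hXb'
          simp only [Finset.mem_insert, not_or] at hpX hqX
          refine ⟨p, hp, q, hq, hpX.2, hqX.2, (hlk _).2 ⟨?_, ?_⟩⟩
          · simp only [Finset.mem_insert, not_or]; exact ⟨Ne.symm hpX.1, Ne.symm hqX.1, hvX⟩
          · rwa [Finset.insert_comm v, Finset.insert_comm v]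
        · intro X hX hXc a b c hab hbc hac ha hb hc hXac hXb
          obtain ⟨hvX, hX'⟩ := (hlk X).1 hX
          obtain ⟨hvac, hXac'⟩ := (hlk _).1 hXac
          obtain ⟨hvb, hXb'⟩ := (hlk _).1 hXb
          rw [Finset.insert_comm] at hXac' hXb'
          rw [Finset.insert_comm v c] at hXac'
          simp only [Finset.mem_insert, not_or] at hvac hvb
          have := h2 (insert v X) hX' (by
            rw [Finset.card_insert_of_notMem hvX]; omega) a b c hab hbc hac
            (by simp only [Finset.mem_insert, not_or]; exact ⟨Ne.symm hvac.1, ha⟩)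
            (by simp only [Finset.mem_insert, not_or]; exact ⟨Ne.symm hvb.1, hb⟩)
            (by simp only [Finset.mem_insert, not_or]; exact ⟨Ne.symm hvac.2.1, hc⟩) hXac' hXb'
          refine this.imp (fun h => (hlk _).2 ⟨?_, ?_⟩) (fun h => (hlk _).2 ⟨?_, ?_⟩)
          · simp only [Finset.mem_insert, not_or]; exact ⟨hvac.1, hvb⟩
          · rwa [Finset.insert_comm v, Finset.insert_comm v]
          · simp only [Finset.mem_insert, not_or]; exact ⟨hvac.2.1, hvb⟩
          · rwa [Finset.insert_comm v, Finset.insert_comm v]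
      refine mat_of_LM hL ?_ (by omega : 3 ≤ d + 1) h1
      intro p q hpq hf
      obtain ⟨Y, hY, hsub, hYc⟩ := hext _ hf
      obtain ⟨z, hzY, hz⟩ := Finset.exists_mem_notMem_of_card_lt_card
        (by rw [Finset.card_pair hpq]; omega : ({p, q} : Finset (Fin n)).card < Y.card)
      simp only [Finset.mem_insert, Finset.mem_singleton, not_or] at hz
      refine ⟨z, hz.1, hz.2, Δ.down_closed hY ?_⟩
      intro x hx
      simp only [Finset.mem_insert, Finset.mem_singleton] at hx
      rcases hx with rfl | rfl | rfl
      · exact hsub (by simp)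
      · exact hsub (by simp)
      · exact hzY
end
end EX

namespace EX
noncomputable section
variable {n : ℕ}

structure SD (Δ : SimComplex n) (m : ℕ) where
  G : Finset (Fin n)
  a : Fin n →₀ ℕ
  A : Set (Fin n)
  j : Fin n
  aG : ∀ i ∈ G, a i = 0
  v : Fin n
  hvA : v ∈ A
  hvG : v ∉ G
  F : Finset (Fin n)
  hF : Δ.IsFacet F
  hvF : insert v G ⊆ F
  hFa : wt Fᶜ (Finsupp.single j 1 + a) < m
  v' : Fin n
  hvA' : v' ∉ A
  hvG' : v' ∉ G
  F' : Finset (Fin n)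
  hF' : Δ.IsFacet F'
  hvF' : insert v' G ⊆ F'
  hFa' : wt F'ᶜ (Finsupp.single j 1 + a) < m
  hA : ∀ p ∈ A, ∀ q ∉ A, p ∉ G → q ∉ G → ∀ F, Δ.IsFacet F → insert p (insert q G) ⊆ F → m ≤ wt Fᶜ a

theorem wt_single_add_lt {Δ : SimComplex n} {G F : Finset (Fin n)} {j : Fin n} {a : Fin n →₀ ℕ} {m : ℕ}
    (hj : j ∈ G) (hG : G ⊆ F) (h : wt Fᶜ a < m) : wt Fᶜ (Finsupp.single j 1 + a) < m := by
  rw [wt_add, wt_single, if_neg (by simpa using hG hj)]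
  omega

theorem exists_SD {Δ : SimComplex n} {d : ℕ} (hd : 3 ≤ d)
    (hfac : ∀ F, Δ.IsFacet F ↔ F ∈ Δ.faces ∧ F.card = d) (hmax : ∀ Y ∈ Δ.faces, Y.card ≤ d)
    (hext : ∀ F ∈ Δ.faces, ∃ F' ∈ Δ.faces, F ⊆ F' ∧ F'.card = d) (hnot : ¬ Δ.IsMatroid) {m : ℕ} (hm : 3 ≤ m) :
    ∃ s : SD Δ m, s.G.card + 2 ≤ d := by
  classical
  have h12 : ¬ (H1 Δ d ∧ H2 Δ d) := fun h => hnot (mat_of_H d Δ hext hmax h.1 h.2)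
  have hext' : ∀ F ∈ Δ.faces, ∃ F', Δ.IsFacet F' ∧ F ⊆ F' := fun F hF => by
    obtain ⟨F', h1, h2, h3⟩ := hext F hF
    exact ⟨F', (hfac F').2 ⟨h1, h3⟩, h2⟩
  rw [not_and_or] at h12
  rcases h12 with h | h
  · unfold H1 at h
    push Not at h
    obtain ⟨G, hG, hGd, A, v, hv, v', hv', hvG, hvG', f, f', hno⟩ := h
    obtain ⟨F, hF, hFv⟩ := hext' _ f
    obtain ⟨F', hF', hFv'⟩ := hext' _ f'
    have hw : ∀ X : Finset (Fin n), wt Xᶜ (Finsupp.single v 1 + 0) < m := by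
      intro X
      rw [add_zero, wt_single]
      split_ifs <;> omega
    exact ⟨⟨G, 0, A, v, by simp, v, hv, hvG, F, hF, hFv, hw _, v', hv', hvG', F', hF', hFv', hw _,
      fun p hp q hq hpG hqG X hX hs => absurd (Δ.down_closed hX.1 hs) (hno p hp q hq hpG hqG)⟩, hGd⟩
  · unfold H2 at h
    push Not at h
    obtain ⟨G, hG, hGd, u, v, w, huv, hvw, huw, hu, hv, hw, f1, f2, no1, no2⟩ := h
    obtain ⟨j, hj⟩ := Finset.card_pos.1 (by omega : 0 < G.card)
    obtain ⟨F', hF', hFv'⟩ := hext' _ f2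
    have hc1 : (insert u (insert w G)).card = d := by
      rw [Finset.card_insert_of_notMem, Finset.card_insert_of_notMem hw]
      · omega
      · simp only [Finset.mem_insert, not_or]; exact ⟨huw, hu⟩
    have hFu : Δ.IsFacet (insert u (insert w G)) := (hfac _).2 ⟨f1, hc1⟩
    have hvF' : v ∈ F' := hFv' (by simp)
    have huF' : u ∉ F' := fun h => no1 (Δ.down_closed hF'.1 (Finset.insert_subset h hFv'))
    have hwF' : w ∉ F' := fun h => no2 (Δ.down_closed hF'.1 (Finset.insert_subset h hFv'))
    have hwt : ∀ X : Finset (Fin n), wt X (Finsupp.single u 1 + Finsupp.single w 1 + Finsupp.single v (m-1)) =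
      (if u ∈ X then 1 else 0) + (if w ∈ X then 1 else 0) + (if v ∈ X then m - 1 else 0) := by
      intro X
      rw [wt_add, wt_add, wt_single, wt_single, wt_single]
    have hcard : ∀ p q, p ≠ q → p ∉ G → q ∉ G → ∀ X, Δ.IsFacet X → insert p (insert q G) ⊆ X →
        X = insert p (insert q G) := by
      intro p q hpq hp hq X hX hs
      refine (Finset.eq_of_subset_of_card_le hs ?_).symm
      rw [((hfac X).1 hX).2, Finset.card_insert_of_notMem, Finset.card_insert_of_notMem hq]
      · omega
      · simp only [Finset.mem_insert, not_or]; exact ⟨hpq, hp⟩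
    refine ⟨⟨G, Finsupp.single u 1 + Finsupp.single w 1 + Finsupp.single v (m-1), {u, w}, j, ?_,
      u, by simp, hu, insert u (insert w G), hFu, ?_, ?_,
      v, by simp [huv.symm, hvw], hv, F', hF', hFv', ?_, ?_⟩, hGd.le⟩
    · intro i hi
      have h1 : u ≠ i := fun h => hu (h ▸ hi)
      have h2 : w ≠ i := fun h => hw (h ▸ hi)
      have h3 : v ≠ i := fun h => hv (h ▸ hi)
      simp [Finsupp.single_apply, h1, h2, h3]
    · exact Finset.insert_subset_insert _ (Finset.subset_insert _ _)
    · refine wt_single_add_lt (Δ := Δ) hj ((Finset.subset_insert _ _).trans (Finset.subset_insert _ _)) ?_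
      rw [hwt, if_neg (by simp), if_neg (by simp)]
      split_ifs <;> omega
    · refine wt_single_add_lt (Δ := Δ) hj ((Finset.subset_insert _ _).trans hFv') ?_
      rw [hwt, if_pos (by simpa using huF'), if_pos (by simpa using hwF'), if_neg (by simpa using hvF')]
      omega
    · intro p hp q hq hpG hqG X hX hs
      have hqu : q ≠ u := fun h => hq (by simp [h])
      have hqw : q ≠ w := fun h => hq (by simp [h])
      have hpq : p ≠ q := fun h => hq (h ▸ hp)
      have hXe := hcard p q hpq hpG hqG X hX hs
      rcases hp with rfl | rfl
      · have hvX : v ∉ X := fun h => no1 (Δ.down_closed hX.1 (Finset.insert_subset (hs (by simp))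
          (Finset.insert_subset h (((Finset.subset_insert _ _).trans (Finset.subset_insert _ _)).trans hs))))
        have hwX : w ∉ X := by
          rw [hXe]; simp only [Finset.mem_insert, not_or]; exact ⟨huw.symm, hqw.symm, hw⟩
        rw [hwt, if_pos (by simpa using hwX : w ∈ Xᶜ), if_pos (by simpa using hvX : v ∈ Xᶜ)]
        omega
      · have hvX : v ∉ X := fun h => no2 (Δ.down_closed hX.1 (Finset.insert_subset (hs (by simp))
          (Finset.insert_subset h (((Finset.subset_insert _ _).trans (Finset.subset_insert _ _)).trans hs))))
        have huX : u ∉ X := by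
          rw [hXe]; simp only [Finset.mem_insert, not_or]; exact ⟨huw, hqu.symm, hu⟩
        rw [hwt, if_pos (by simpa using huX : u ∈ Xᶜ), if_pos (by simpa using hvX : v ∈ Xᶜ)]
        omega
end
end EX

namespace EX
noncomputable section
open IsLocalRing
section gen
theorem hom_zero {A : Type} [CommRing A] {L M : Type} [AddCommGroup L] [Module A L] [AddCommGroup M]
    [Module A M] (h : EV A 0 L M) (φ : L →ₗ[A] M) : φ = 0 := by
  rw [EV_iff] at h
  set P := projectiveResolution (ModuleCat.of A L)
  obtain ⟨π, hπ⟩ : ∃ π : P.complex.X 0 ⟶ ModuleCat.of A L, π = P.π.f 0 := ⟨_, rfl⟩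
  have hepi : Epi π := by rw [hπ]; exact inferInstanceAs (Epi (P.π.f 0))
  have h0 : P.complex.d 1 0 ≫ π = 0 := by rw [hπ]; exact P.complex_d_comp_π_f_zero
  obtain ⟨g, hg⟩ := h (π ≫ ModuleCat.ofHom φ) (by
    rw [← Category.assoc]
    refine Eq.trans (congrArg (· ≫ ModuleCat.ofHom φ) h0) Limits.zero_comp)
  have h1 : π ≫ ModuleCat.ofHom φ = 0 := by
    rw [hg, P.complex.shape _ _ (by simp), Limits.zero_comp]
  have h2 : ModuleCat.ofHom φ = 0 := by
    rw [← cancel_epi π, h1, Limits.comp_zero]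
  exact congrArg ModuleCat.Hom.hom h2

variable {B : Type} [CommRing B] [IsLocalRing B] {M : Type} [AddCommGroup M] [Module B M]

theorem soc_zero (h : EV B 0 (B ⧸ maximalIdeal B) M) (z : M) (hz : ∀ y ∈ maximalIdeal B, y • z = 0) : z = 0 := by
  let φ : (B ⧸ maximalIdeal B) →ₗ[B] M := Submodule.liftQ (maximalIdeal B) (LinearMap.toSpanSingleton B M z) (by
    intro y hy
    exact hz y hy)
  have h1 := hom_zero h φ
  have : φ (Submodule.Quotient.mk 1) = z := by
    exact (Submodule.liftQ_apply _ _ _).trans (one_smul B z)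
  rw [← this, h1]; rfl

theorem soc_zero' (h : EV B 0 (B ⧸ maximalIdeal B) M) (N : ℕ) (z : M)
    (hz : ∀ y ∈ maximalIdeal B ^ N, y • z = 0) : z = 0 := by
  induction N with
  | zero => simpa using hz 1 (by simp)
  | succ N ih =>
    refine ih fun y hy => soc_zero h _ fun u hu => ?_
    rw [smul_smul]
    exact hz _ (by rw [pow_succ']; exact Ideal.mul_mem_mul hu hy)

theorem exists_reg [IsNoetherianRing B] (h : EV B 0 (B ⧸ maximalIdeal B) B) :
    ∃ x ∈ maximalIdeal B, ∀ z : B, x * z = 0 → z = 0 := by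
  have hsub : Subsingleton ((B ⧸ maximalIdeal B) →ₗ[B] B) :=
    ⟨fun f g => (hom_zero h f).trans (hom_zero h g).symm⟩
  obtain ⟨x, hx, hr⟩ := IsSMulRegular.subsingleton_linearMap_iff.1 hsub
  rw [Ideal.annihilator_quotient] at hx
  refine ⟨x, hx, fun z hz => hr ?_⟩
  simpa using hz

theorem extend [IsNoetherianRing B] (h0 : EV B 0 (B ⧸ maximalIdeal B) B)
    (h1 : EV B 1 (B ⧸ maximalIdeal B) B) {ι : Type} [Fintype ι] (y c : ι → B) (N : ℕ)
    (hN : maximalIdeal B ^ N ≤ Ideal.span (Set.range y)) (hc : ∀ v w, c v * y w = c w * y v) :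
    ∃ τ, ∀ w, y w * τ = c w := by
  obtain ⟨x, hx, hreg⟩ := exists_reg h0
  have hreg' : ∀ z : B, x ^ N * z = 0 → z = 0 := by
    clear hN
    induction N with
    | zero => simp
    | succ N ih =>
      intro z hz
      exact ih z (hreg _ (by rw [← hz]; ring))
  have hx' := hN (Ideal.pow_mem_pow hx N)
  rw [Ideal.mem_span_range_iff_exists_fun] at hx'
  obtain ⟨k, hk⟩ := hx'
  have hβ : ∀ w, y w * ∑ v, k v * c v = x ^ N * c w := by
    intro w
    rw [← hk, Finset.mul_sum, Finset.sum_mul]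
    refine Finset.sum_congr rfl fun v _ => ?_
    linear_combination k v * hc v w
  have hV : EV B 0 (B ⧸ maximalIdeal B) (B ⧸ Ideal.span {x ^ N}) := by
    refine V3 (LinearMap.mulLeft B (x ^ N)) (Submodule.mkQ (Ideal.span {x ^ N})) ?_ ?_
      (Submodule.mkQ_surjective _) h1 h0
    · rw [← LinearMap.ker_eq_bot, LinearMap.ker_eq_bot']
      exact hreg'
    · intro m
      rw [Submodule.mkQ_apply, Submodule.Quotient.mk_eq_zero]
      rw [Ideal.mem_span_singleton']
      constructor
      · rintro ⟨b, hb⟩; exact ⟨b, by rw [← hb, mul_comm]; rfl⟩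
      · rintro ⟨b, hb⟩; exact ⟨b, by rw [← hb, mul_comm]; rfl⟩
  have hz := soc_zero' hV N (Submodule.Quotient.mk (∑ v, k v * c v)) (by
    intro u hu
    rw [← Submodule.Quotient.mk_smul, Submodule.Quotient.mk_eq_zero]
    have hu' := hN hu
    rw [Ideal.mem_span_range_iff_exists_fun] at hu'
    obtain ⟨l, hl⟩ := hu'
    rw [smul_eq_mul, ← hl, Finset.sum_mul]
    refine Ideal.sum_mem _ fun w _ => ?_
    rw [mul_assoc, hβ w]
    exact Ideal.mul_mem_left _ _ (Ideal.mul_mem_right _ _ (Ideal.mem_span_singleton_self _)))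
  rw [Submodule.Quotient.mk_eq_zero, Ideal.mem_span_singleton'] at hz
  obtain ⟨τ, hτ⟩ := hz
  refine ⟨τ, fun w => ?_⟩
  have := hreg' (y w * τ - c w) (by
    have := hβ w
    rw [← hτ] at this
    linear_combination this)
  exact sub_eq_zero.1 this
end gen

theorem extend_A {A : Type} [CommRing A] [IsNoetherianRing A] (hCM : IsCohenMacaulayRing A) (P : Ideal A)
    [hP : P.IsPrime] (hdim : 2 ≤ P.height) {ι : Type} [Fintype ι] (y c : ι → A)
    (hN : ∀ x ∈ P, x ∈ (Ideal.span (Set.range y)).radical)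
    (hc : ∀ v w, ∃ s, s ∉ P ∧ s * (c v * y w - c w * y v) = 0) :
    ∃ t u, u ∉ P ∧ ∀ w, u * c w = y w * t := by
  have hloc : ∀ i : ℕ, i < 2 → EV (Localization.AtPrime P) i
      (Localization.AtPrime P ⧸ maximalIdeal (Localization.AtPrime P)) (Localization.AtPrime P) := by
    intro i hi
    refine hCM P hP i ?_
    rw [IsLocalization.AtPrime.ringKrullDim_eq_height P]
    have : (i : ℕ∞) < P.height := lt_of_lt_of_le (by exact_mod_cast hi) hdim
    exact_mod_cast this
  obtain ⟨N, hN'⟩ := Ideal.exists_radical_pow_le_of_fg (Ideal.span (Set.range y)) (IsNoetherian.noetherian _)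
  have hNB : IsNoetherianRing (Localization.AtPrime P) := IsLocalization.isNoetherianRing P.primeCompl _ ‹_›
  obtain ⟨τ, hτ⟩ := extend (hloc 0 (by omega)) (hloc 1 (by omega))
    (fun v => algebraMap A (Localization.AtPrime P) (y v)) (fun v => algebraMap A (Localization.AtPrime P) (c v))
    N (by
      rw [← Localization.AtPrime.map_eq_maximalIdeal, ← Ideal.map_pow]
      have := Ideal.map_mono (f := algebraMap A (Localization.AtPrime P)) ((Ideal.pow_right_mono hN N).trans hN')
      refine this.trans ?_
      rw [Ideal.map_span, ← Set.range_comp]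
      exact le_rfl) (by
      intro v w
      obtain ⟨s, hs, h⟩ := hc v w
      have h1 : IsUnit (algebraMap A (Localization.AtPrime P) s) :=
        IsLocalization.map_units (Localization.AtPrime P) (⟨s, hs⟩ : P.primeCompl)
      have h2 := congrArg (algebraMap A (Localization.AtPrime P)) h
      rw [map_mul, map_zero, h1.mul_right_eq_zero, map_sub, map_mul, map_mul] at h2
      exact sub_eq_zero.1 h2)
  obtain ⟨t, u, rfl⟩ := IsLocalization.exists_mk'_eq P.primeCompl τ
  have h3 : ∀ w, ∃ s : P.primeCompl, (s : A) * (y w * t) = s * (u * c w) := by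
    intro w
    have := hτ w
    rw [← IsLocalization.mk'_one (M := P.primeCompl) (Localization.AtPrime P) (y w), ← IsLocalization.mk'_mul,
      one_mul, IsLocalization.mk'_eq_iff_eq_mul, ← map_mul, IsLocalization.eq_iff_exists P.primeCompl] at this
    obtain ⟨s, hs⟩ := this
    exact ⟨s, by rw [hs, mul_comm (c w)]⟩
  choose s hs using h3
  have hall : ∀ w, ∃ r, (∏ v, (s v : A)) = r * s w := fun w => by
    obtain ⟨r, hr⟩ := Finset.dvd_prod_of_mem (fun v => (s v : A)) (Finset.mem_univ w)
    exact ⟨r, by rw [hr, mul_comm]⟩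
  refine ⟨(∏ v, (s v : A)) * t, (∏ v, (s v : A)) * u, ?_, fun w => ?_⟩
  · have : (∏ v, (s v : A)) * u ∈ P.primeCompl :=
      mul_mem (prod_mem fun v _ => (s v).2) u.2
    exact this
  · obtain ⟨r, hr⟩ := hall w
    rw [hr]
    linear_combination -r * hs w
end
end EX

namespace EX
noncomputable section
open MvPolynomial
variable {K : Type} [Field K] {n : ℕ}

theorem coeff_SR {Δ : SimComplex n} {m : ℕ} {p : MvPolynomial (Fin n) K} (hp : p ∈ SRSymbPow K Δ m)
    {F : Finset (Fin n)} (hF : Δ.IsFacet F) {e : Fin n →₀ ℕ} (he : wt Fᶜ e < m) : coeff e p = 0 := by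
  by_contra h
  rw [SRSymbPow_eq, mem_MI] at hp
  have := (mem_US.1 (hp e h)) F hF
  omega

theorem mono_SR {Δ : SimComplex n} {m : ℕ} {e : Fin n →₀ ℕ}
    (he : ∀ F, Δ.IsFacet F → m ≤ wt Fᶜ e) (c : K) : monomial e c ∈ SRSymbPow K Δ m := by
  rw [SRSymbPow_eq, mem_MI]
  intro b hb
  rw [coeff_monomial] at hb
  split_ifs at hb with h
  · rw [← h]; exact mem_US.2 he
  · exact absurd rfl hb

theorem le_wt {F : Finset (Fin n)} {e : Fin n →₀ ℕ} {i : Fin n} (hi : i ∉ F) : e i ≤ wt Fᶜ e :=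
  Finset.single_le_sum (f := fun i => e i) (fun _ _ => Nat.zero_le _) (by simpa using hi)

theorem SR_le_PF {Δ : SimComplex n} {m : ℕ} (hm : 1 ≤ m) {F G : Finset (Fin n)} (hF : Δ.IsFacet F)
    (hG : G ⊆ F) : SRSymbPow K Δ m ≤ PF K Gᶜ := by
  refine le_trans ?_ (PF_mono (Finset.compl_subset_compl.2 hG))
  refine (iInf₂_le F hF).trans (Ideal.pow_le_self (by omega))

theorem qlt {S : Type} [CommRing S] {I P Q : Ideal S} (hI : I ≤ P) (h : P < Q) :
    P.map (Ideal.Quotient.mk I) < Q.map (Ideal.Quotient.mk I) := by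
  refine lt_of_le_of_ne (Ideal.map_mono h.le) fun he => h.not_ge ?_
  intro x hx
  have h1 := Ideal.mem_map_of_mem (Ideal.Quotient.mk I) hx
  rw [← he] at h1
  exact (Ideal.mem_quotient_iff_mem hI).1 h1

theorem height_two {I : Ideal (MvPolynomial (Fin n) K)} {F G : Finset (Fin n)} (hI : I ≤ PF K Fᶜ)
    (hG : G ⊆ F) (hc : G.card + 2 ≤ F.card) : 2 ≤ ((PF K Gᶜ).map (Ideal.Quotient.mk I)).height := by
  classical
  have hc' : 1 < (F \ G).card := by rw [Finset.card_sdiff_of_subset hG]; omega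
  obtain ⟨f1, f2, h1, h2, h12⟩ := Finset.one_lt_card_iff.1 hc'
  simp only [Finset.mem_sdiff] at h1 h2
  have l1 : PF K Fᶜ < PF K (insert f1 Fᶜ) := PF_lt (by simpa using h1.1)
  have l2 : PF K (insert f1 Fᶜ) < PF K (insert f2 (insert f1 Fᶜ)) := PF_lt (by
    simp only [Finset.mem_insert, Finset.mem_compl, not_or, not_not]; exact ⟨h12.symm, h2.1⟩)
  have l3 : PF K (insert f2 (insert f1 Fᶜ)) ≤ PF K Gᶜ := PF_mono (by
    intro x
    simp only [Finset.mem_insert, Finset.mem_compl]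
    rintro (rfl | rfl | h)
    · exact h2.2
    · exact h1.2
    · exact fun hx => h (hG hx))
  have hpr : ∀ X : Finset (Fin n), I ≤ PF K X → ((PF K X).map (Ideal.Quotient.mk I)).IsPrime := by
    intro X hX
    have := PF_prime (K := K) X
    exact Ideal.isPrime_map_quotientMk_of_isPrime hX
  have p1 := hpr _ hI
  have p2 := hpr _ (hI.trans l1.le)
  have p3 := hpr _ (hI.trans (l1.le.trans l2.le))
  have e1 := Ideal.height_add_one_le_of_lt_of_isPrime (qlt hI l1)
  have e2 := Ideal.height_add_one_le_of_lt_of_isPrime (qlt (hI.trans l1.le) l2)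
  refine le_trans ?_ (Ideal.height_mono (Ideal.map_mono l3))
  refine le_trans ?_ e2
  refine le_trans ?_ (add_le_add_left e1 1)
  rw [add_assoc]
  exact le_trans (by norm_num) le_add_self

theorem CM_contra {Δ : SimComplex n} {m d : ℕ} (hm : 3 ≤ m) (s : SD Δ m) (hs : s.G.card + 2 ≤ d)
    (hfac : ∀ F, Δ.IsFacet F ↔ F ∈ Δ.faces ∧ F.card = d) (h : IsCohenMacaulayIdeal (SRSymbPow K Δ m)) : False := by
  classical
  obtain ⟨G, a, A, j, aG, v, hvA, hvG, F, hF, hvF, hFa, v', hvA', hvG', F', hF', hvF', hFa', hA⟩ := s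
  simp only at hs
  have hGF : G ⊆ F := (Finset.subset_insert _ _).trans hvF
  have hGF' : G ⊆ F' := (Finset.subset_insert _ _).trans hvF'
  have hIG : SRSymbPow K Δ m ≤ PF K Gᶜ := SR_le_PF (by omega) hF hGF
  have hprG := PF_prime (K := K) Gᶜ
  have hpr : ((PF K Gᶜ).map (Ideal.Quotient.mk (SRSymbPow K Δ m))).IsPrime :=
    Ideal.isPrime_map_quotientMk_of_isPrime hIG
  have hmem : ∀ x, Ideal.Quotient.mk (SRSymbPow K Δ m) x ∈ (PF K Gᶜ).map (Ideal.Quotient.mk (SRSymbPow K Δ m)) ↔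
    x ∈ PF K Gᶜ := fun x => Ideal.mem_quotient_iff_mem hIG
  let y : {w // w ∉ G} → MvPolynomial (Fin n) K := fun w => X w.1 ^ m
  let c : {w // w ∉ G} → MvPolynomial (Fin n) K := fun w => if w.1 ∈ A then monomial a 1 * X w.1 ^ m else 0
  obtain ⟨t, u, hu, htu⟩ := extend_A h ((PF K Gᶜ).map (Ideal.Quotient.mk (SRSymbPow K Δ m)))
    (height_two (SR_le_PF (by omega) hF subset_rfl) hGF (by rw [((hfac F).1 hF).2]; exact hs))
    (fun w => Ideal.Quotient.mk (SRSymbPow K Δ m) (y w)) (fun w => Ideal.Quotient.mk (SRSymbPow K Δ m) (c w))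
    (by
      change (PF K Gᶜ).map (Ideal.Quotient.mk (SRSymbPow K Δ m)) ≤ _
      rw [Ideal.map_le_iff_le_comap]
      refine Ideal.span_le.2 ?_
      rintro _ ⟨w, hw, rfl⟩
      have hw' : w ∉ G := by simpa using hw
      refine ⟨m, ?_⟩
      rw [← map_pow]
      exact Ideal.subset_span ⟨⟨w, hw'⟩, rfl⟩)
    (by
      have key : ∀ p q : {w // w ∉ G}, p.1 ∈ A → q.1 ∉ A →
          monomial (∑ i ∈ G, Finsupp.single i m) (1 : K) * (monomial a 1 * X p.1 ^ m * X q.1 ^ m) ∈ SRSymbPow K Δ m := by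
        intro p q hp hq
        rw [X_pow_eq_monomial, X_pow_eq_monomial, monomial_mul, monomial_mul, monomial_mul]
        refine mono_SR (fun X hX => ?_) _
        by_cases hXs : insert p.1 (insert q.1 G) ⊆ X
        · refine (hA p.1 hp q.1 hq p.2 q.2 X hX hXs).trans (wt_mono _ ?_)
          intro i
          simp only [Finsupp.add_apply]
          omega
        · obtain ⟨i, hi, hiX⟩ := Finset.not_subset.1 hXs
          refine le_trans ?_ (le_wt hiX)
          simp only [Finset.mem_insert] at hi
          simp only [Finsupp.add_apply]
          rcases hi with rfl | rfl | hi
          · rw [Finsupp.single_eq_same]; omega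
          · rw [Finsupp.single_eq_same]; omega
          · have : m ≤ (∑ i ∈ G, Finsupp.single i m) i := by
              rw [Finsupp.finsetSum_apply]
              refine le_trans ?_ (Finset.single_le_sum (f := fun k => (Finsupp.single k m) i)
                (fun _ _ => Nat.zero_le _) hi)
              simp
            omega
      have hsP : monomial (∑ i ∈ G, Finsupp.single i m) (1 : K) ∉ PF K Gᶜ := by
        rw [mem_PF]
        push Not
        refine ⟨∑ i ∈ G, Finsupp.single i m, by simp, fun i hi => ?_⟩
        rw [Finsupp.finsetSum_apply]
        refine Finset.sum_eq_zero fun k hk => ?_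
        rw [Finsupp.single_eq_of_ne]
        rintro rfl
        exact (Finset.mem_compl.1 hi) hk
      intro p q
      by_cases hp : p.1 ∈ A
      · by_cases hq : q.1 ∈ A
        · refine ⟨1, fun h1 => hpr.ne_top ((Ideal.eq_top_iff_one _).2 h1), ?_⟩
          rw [one_mul, ← map_mul, ← map_mul, ← map_sub]
          simp only [c, y, if_pos hp, if_pos hq]
          rw [← map_zero (Ideal.Quotient.mk (SRSymbPow K Δ m))]
          congr 1
          ring
        · refine ⟨_, fun h1 => hsP ((hmem _).1 h1), ?_⟩
          rw [← map_mul, ← map_mul, ← map_sub, ← map_mul, Ideal.Quotient.eq_zero_iff_mem]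
          simp only [c, y, if_pos hp, if_neg hq, zero_mul, sub_zero]
          exact key p q hp hq
      · by_cases hq : q.1 ∈ A
        · refine ⟨_, fun h1 => hsP ((hmem _).1 h1), ?_⟩
          rw [← map_mul, ← map_mul, ← map_sub, ← map_mul, Ideal.Quotient.eq_zero_iff_mem]
          simp only [c, y, if_pos hq, if_neg hp, zero_mul, zero_sub, mul_neg]
          exact (SRSymbPow K Δ m).neg_mem (key q p hq hp)
        · refine ⟨1, fun h1 => hpr.ne_top ((Ideal.eq_top_iff_one _).2 h1), ?_⟩
          rw [one_mul, ← map_mul, ← map_mul, ← map_sub]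
          simp only [c, y, if_neg hp, if_neg hq, zero_mul, sub_zero, map_zero])
  obtain ⟨t, rfl⟩ := Ideal.Quotient.mk_surjective t
  obtain ⟨u, rfl⟩ := Ideal.Quotient.mk_surjective u
  rw [hmem, mem_PF] at hu
  push Not at hu
  obtain ⟨γ, hγ, hγG⟩ := hu
  have htu' : ∀ w, u * c w - y w * t ∈ SRSymbPow K Δ m := by
    intro w
    have := htu w
    rwa [← map_mul, ← map_mul, Ideal.Quotient.eq] at this
  have hγw : ∀ X : Finset (Fin n), G ⊆ X → wt Xᶜ γ = 0 := fun X hX =>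
    Finset.sum_eq_zero fun i hi => hγG i (Finset.compl_subset_compl.2 hX hi)
  have hlt : ∀ (X : Finset (Fin n)) w, insert w G ⊆ X → wt Xᶜ (Finsupp.single j 1 + a) < m →
      wt Xᶜ (Finsupp.single w m + (a + γ)) < m := by
    intro X w hX hw
    rw [wt_add] at hw
    rw [wt_add, wt_add, hγw X ((Finset.subset_insert _ _).trans hX), wt_single, if_neg (by
      simpa using hX (Finset.mem_insert_self _ _))]
    omega
  have e1 := coeff_SR (htu' ⟨v, hvG⟩) hF (hlt F v hvF hFa)
  have e2 := coeff_SR (htu' ⟨v', hvG'⟩) hF' (hlt F' v' hvF' hFa')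
  simp only [c, y, if_pos hvA, if_neg hvA', mul_zero, zero_sub, coeff_neg, coeff_sub, X_pow_eq_monomial,
    coeff_monomial_mul, one_mul, neg_eq_zero] at e1 e2
  have e3 : u * (monomial a 1 * monomial (Finsupp.single v m) 1) =
    monomial (Finsupp.single v m) 1 * (monomial a 1 * u) := by ring
  rw [e3, coeff_monomial_mul, coeff_monomial_mul, one_mul, one_mul, e2, sub_zero] at e1
  exact hγ e1
end
end EX

namespace EX
noncomputable section
open MvPolynomial
variable {K : Type} [Field K] {n : ℕ}

/-- Koszul sign -/
def sg (K : Type) [Field K] {n : ℕ} (w : Fin n) (U : Finset (Fin n)) : K := (-1) ^ (U.filter (· < w)).card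

theorem sg_insert_lt {v w : Fin n} {U : Finset (Fin n)} (hv : v ∉ U) (h : v < w) :
    sg K w (insert v U) = - sg K w U := by
  rw [sg, sg, Finset.filter_insert, if_pos h, Finset.card_insert_of_notMem, pow_succ, mul_neg_one]
  simp [hv]

theorem sg_insert_gt {v w : Fin n} {U : Finset (Fin n)} (h : w < v) :
    sg K w (insert v U) = sg K w U := by
  rw [sg, sg, Finset.filter_insert, if_neg (not_lt.2 h.le)]

theorem sg_anti {v w : Fin n} {U : Finset (Fin n)} (hv : v ∉ U) (hw : w ∉ U) (h : v ≠ w) :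
    sg K w U * sg K v (insert w U) = - (sg K v U * sg K w (insert v U)) := by
  rcases lt_or_gt_of_ne h with h | h
  · rw [sg_insert_gt h, sg_insert_lt hv h]; ring
  · rw [sg_insert_gt h, sg_insert_lt hw h]; ring

theorem sg_sq (w : Fin n) (U : Finset (Fin n)) : sg K w U * sg K w U = 1 := by
  rw [sg, ← pow_add, ← two_mul, pow_mul]; simp

theorem sg_ne (w : Fin n) (U : Finset (Fin n)) : sg K w U ≠ 0 := by
  intro h; have := sg_sq (K := K) w U; simp [h] at this

/-- total Koszul differential -/
def KD (K : Type) [Field K] {n : ℕ} (t : ℕ) : (Finset (Fin n) → MvPolynomial (Fin n) K) →ₗ[MvPolynomial (Fin n) K]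
    (Finset (Fin n) → MvPolynomial (Fin n) K) where
  toFun f U := ∑ w ∈ Uᶜ, monomial (Finsupp.single w t) (sg K w U) * f (insert w U)
  map_add' f g := by
    ext1 U
    simp [mul_add, Finset.sum_add_distrib]
  map_smul' c f := by
    ext1 U
    simp only [Pi.smul_apply, smul_eq_mul, RingHom.id_apply, Finset.mul_sum]
    exact Finset.sum_congr rfl fun w _ => by ring

theorem KD_apply (t : ℕ) (f : Finset (Fin n) → MvPolynomial (Fin n) K) (U : Finset (Fin n)) :
    KD K t f U = ∑ w ∈ Uᶜ, monomial (Finsupp.single w t) (sg K w U) * f (insert w U) := rfl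

theorem KD_KD (t : ℕ) (f : Finset (Fin n) → MvPolynomial (Fin n) K) : KD K t (KD K t f) = 0 := by
  ext1 U
  rw [KD_apply]
  simp only [KD_apply, Finset.mul_sum, Pi.zero_apply]
  rw [Finset.sum_sigma']
  refine Finset.sum_involution (fun p _ => ⟨p.2, p.1⟩) ?_ ?_ ?_ ?_
  · rintro ⟨w, v⟩ h
    simp only [Finset.mem_sigma, Finset.mem_compl, Finset.mem_insert, not_or] at h
    obtain ⟨hw, hvw, hv⟩ := h
    dsimp only
    rw [← mul_assoc, ← mul_assoc, monomial_mul, monomial_mul, Finset.insert_comm w v,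
      add_comm (Finsupp.single w t), sg_anti hv hw hvw, ← add_mul, ← map_add]
    simp
  · rintro ⟨w, v⟩ h _ he
    simp only [Finset.mem_sigma, Finset.mem_compl, Finset.mem_insert, not_or] at h
    simp only [Sigma.mk.injEq, heq_eq_eq] at he
    exact h.2.1 he.1
  · rintro ⟨w, v⟩ h
    simp only [Finset.mem_sigma, Finset.mem_compl, Finset.mem_insert, not_or] at h ⊢
    exact ⟨h.2.2, Ne.symm h.2.1, h.1⟩
  · rintro ⟨w, v⟩ h; rfl

theorem coeff_KD (t : ℕ) (f : Finset (Fin n) → MvPolynomial (Fin n) K) (U : Finset (Fin n)) (β : Fin n →₀ ℕ) :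
    coeff β (KD K t f U) = ∑ w ∈ Uᶜ, if t ≤ β w then
      sg K w U * coeff (β - Finsupp.single w t) (f (insert w U)) else 0 := by
  rw [KD_apply, coeff_sum]
  refine Finset.sum_congr rfl fun w _ => ?_
  rw [coeff_monomial_mul']
  simp only [Finsupp.single_le_iff]

/-- contracting homotopy -/
def KH (t : ℕ) (f : Finset (Fin n) → MvPolynomial (Fin n) K) (W : Finset (Fin n)) : MvPolynomial (Fin n) K :=
  if h : W.Nonempty then
    ∑ α ∈ ((f (W.erase (W.min' h))).divMonomial (Finsupp.single (W.min' h) t)).support,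
      monomial α (open Classical in if ∀ u < W.min' h, α u < t then
        coeff (Finsupp.single (W.min' h) t + α) (f (W.erase (W.min' h))) else 0)
  else 0

open Classical in
theorem coeff_KH (t : ℕ) (f : Finset (Fin n) → MvPolynomial (Fin n) K) (W : Finset (Fin n)) (v : Fin n)
    (hv : v ∈ W) (hm : ∀ u ∈ W, v ≤ u) (α : Fin n →₀ ℕ) :
    coeff α (KH t f W) = if ∀ u < v, α u < t then
      coeff (Finsupp.single v t + α) (f (W.erase v)) else 0 := by
  have h : W.Nonempty := ⟨v, hv⟩
  have e : W.min' h = v := le_antisymm (Finset.min'_le _ _ hv) (hm _ (Finset.min'_mem _ _))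
  rw [KH, dif_pos h, e, coeff_sum]
  simp only [coeff_monomial, Finset.sum_ite_eq']
  split_ifs with h1 h2 h2
  · rfl
  · rfl
  · rw [notMem_support_iff, coeff_divMonomial] at h1
    exact h1.symm
  · rfl

theorem KD_KH (t : ℕ) (f : Finset (Fin n) → MvPolynomial (Fin n) K) (hf : KD K t f = 0)
    (h0 : ∀ β : Fin n →₀ ℕ, (∀ u, β u < t) → coeff β (f ∅) = 0) : KD K t (KH t f) = f := by
  classical
  ext U β
  rw [coeff_KD]
  set Z : Finset (Fin n) := Finset.univ.filter (fun u => u ∈ U ∨ t ≤ β u) with hZ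
  have mZ : ∀ u, u ∈ Z ↔ u ∈ U ∨ t ≤ β u := by intro u; simp [hZ]
  rcases Z.eq_empty_or_nonempty with he | hne
  · have h1 : ∀ u, u ∉ U ∧ β u < t := by
      intro u
      have := mZ u
      rw [he] at this
      simp only [Finset.notMem_empty, false_iff, not_or, not_le] at this
      exact this
    have hU : U = ∅ := Finset.eq_empty_of_forall_notMem fun u => (h1 u).1
    rw [hU, h0 β fun u => (h1 u).2]
    exact Finset.sum_eq_zero fun w _ => if_neg (not_le.2 (h1 w).2)
  · obtain ⟨v, hvZ, hvm⟩ : ∃ v ∈ Z, ∀ u ∈ Z, v ≤ u :=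
      ⟨Z.min' hne, Finset.min'_mem _ _, fun u hu => Finset.min'_le _ _ hu⟩
    have hlt : ∀ u < v, u ∉ U ∧ β u < t := by
      intro u hu
      have h := mt (hvm u) (not_le.2 hu)
      rw [mZ, not_or, not_le] at h
      exact h
    have hUv : ∀ u ∈ U, v ≤ u := fun u hu => hvm u ((mZ u).2 (Or.inl hu))
    have hs : ∀ X : Finset (Fin n), (∀ u ∈ X, v ≤ u) → sg K v X = 1 := by
      intro X hX
      rw [sg, Finset.filter_false_of_mem fun u hu => not_lt.2 (hX u hu)]
      simp
    by_cases hvU : v ∈ U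
    · have hD := congrArg (coeff (Finsupp.single v t + β)) (congrFun hf (U.erase v))
      rw [coeff_KD, Pi.zero_apply, coeff_zero, Finset.compl_erase,
        Finset.sum_insert (by simpa using hvU)] at hD
      rw [if_pos (by simp), hs _ fun u hu => hUv u (Finset.mem_of_mem_erase hu), one_mul,
        Finset.insert_erase hvU, add_tsub_cancel_left] at hD
      rw [eq_neg_of_add_eq_zero_left hD, ← Finset.sum_neg_distrib]
      refine Finset.sum_congr rfl fun w hw => ?_
      rw [Finset.mem_compl] at hw
      have hwv : v ≠ w := fun h => hw (h ▸ hvU)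
      have e1 : (Finsupp.single v t + β) w = β w := by simp [hwv]
      rw [e1]
      by_cases hw' : t ≤ β w
      · have hvw : v < w := lt_of_le_of_ne (hvm w ((mZ w).2 (Or.inr hw'))) hwv
        rw [if_pos hw', if_pos hw', coeff_KH t f _ v (by simp [hvU])
          (by
            intro u hu
            rcases Finset.mem_insert.1 hu with rfl | hu
            · exact hvw.le
            · exact hUv u hu),
          if_pos (by
            intro u hu
            simp only [Finsupp.coe_tsub, Pi.sub_apply]
            exact lt_of_le_of_lt (Nat.sub_le _ _) (hlt u hu).2)]
        have e2 : sg K w U = - sg K w (U.erase v) := by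
          conv_lhs => rw [← Finset.insert_erase hvU]
          exact sg_insert_lt (by simp) hvw
        rw [e2, neg_mul, Finset.erase_insert_of_ne hwv.symm, add_tsub_assoc_of_le (by simpa using hw')]
      · rw [if_neg hw', if_neg hw', neg_zero]
    · have hvb : t ≤ β v := ((mZ v).1 hvZ).resolve_left hvU
      rw [Finset.sum_eq_single v]
      · rw [if_pos hvb, hs U hUv, one_mul, coeff_KH t f _ v (by simp) (by
            intro u hu
            rcases Finset.mem_insert.1 hu with rfl | hu
            · exact le_rfl
            · exact hUv u hu), if_pos (by
            intro u hu
            simp only [Finsupp.coe_tsub, Pi.sub_apply]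
            exact lt_of_le_of_lt (Nat.sub_le _ _) (hlt u hu).2), Finset.erase_insert hvU,
            add_tsub_cancel_of_le (by simpa using hvb)]
      · intro w hw hwv
        rw [Finset.mem_compl] at hw
        split_ifs with hw'
        · have hvw : v < w := lt_of_le_of_ne (hvm w ((mZ w).2 (Or.inr hw'))) hwv.symm
          have hn : (insert w U).Nonempty := by simp
          have hmin := Finset.min'_mem _ hn
          have hlt' : v < (insert w U).min' hn := by
            rcases Finset.mem_insert.1 hmin with h | h
            · rw [h]; exact hvw
            · exact lt_of_le_of_ne (hUv _ h) fun h' => hvU (h' ▸ h)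
          rw [coeff_KH t f _ _ hmin fun u hu => Finset.min'_le _ _ hu, if_neg, mul_zero]
          intro h
          have := h v hlt'
          simp only [Finsupp.coe_tsub, Pi.sub_apply, Finsupp.single_apply, if_neg hwv] at this
          omega
        · rfl
      · intro h; exact absurd (Finset.mem_compl.2 hvU) h
end
end EX

namespace EX
noncomputable section
open MvPolynomial
variable {K : Type} [Field K] {n : ℕ}

/-- resolution from elementwise exactness -/
def mkRes {R : Type} [CommRing R] {Z : ModuleCat.{0} R} (C : ChainComplex (ModuleCat.{0} R) ℕ)
    (hP : ∀ i, Projective (C.X i)) (p : C.X 0 ⟶ Z) (w : C.d 1 0 ≫ p = 0) (hs : Function.Surjective p)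
    (h0 : ∀ f : C.X 0, p f = 0 → ∃ g, C.d 1 0 g = f)
    (h1 : ∀ i, ∀ f : C.X (i+1), C.d (i+1) i f = 0 → ∃ g, C.d (i+2) (i+1) g = f) : ProjectiveResolution Z where
  complex := C
  projective := hP
  π := (ChainComplex.toSingle₀Equiv _ _).symm ⟨p, w⟩
  quasiIso := ⟨fun i => by
    cases i with
    | zero =>
      rw [ChainComplex.quasiIsoAt₀_iff, ShortComplex.quasiIso_iff_of_zeros']
      · refine (ShortComplex.exact_and_epi_g_iff_of_iso (S₂ := ShortComplex.mk _ _ w) ?_).2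
          ⟨?_, ?_⟩
        · exact ShortComplex.isoMk (Iso.refl _) (Iso.refl _) (Iso.refl _)
            ((Category.id_comp _).trans (Category.comp_id _).symm)
            ((Category.id_comp _).trans (Eq.symm ((Category.comp_id _).trans
              (ChainComplex.toSingle₀Equiv_symm_apply_f_zero _ _))))
        · rw [ShortComplex.moduleCat_exact_iff]
          exact h0
        · exact (ModuleCat.epi_iff_surjective _).2 hs
      · exact C.shape _ _ (by simp)
      · rfl
      · rfl
    | succ i =>
      rw [quasiIsoAt_iff_exactAt']
      · rw [HomologicalComplex.exactAt_iff' _ (i+2) (i+1) i (by simp) (by simp), ShortComplex.moduleCat_exact_iff]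
        exact h1 i
      · apply ChainComplex.exactAt_succ_single_obj⟩

/-- Koszul module in degree `i` -/
def KM (K : Type) [Field K] (n i : ℕ) : Submodule (MvPolynomial (Fin n) K) (Finset (Fin n) → MvPolynomial (Fin n) K) where
  carrier := {f | ∀ W, W.card ≠ i → f W = 0}
  add_mem' := by intro f g hf hg W hW; simp [hf W hW, hg W hW]
  zero_mem' := by intro W _; rfl
  smul_mem' := by intro c f hf W hW; simp [hf W hW]

/-- truncation onto degree `i` -/
def KR (K : Type) [Field K] (n i : ℕ) : (Finset (Fin n) → MvPolynomial (Fin n) K) →ₗ[MvPolynomial (Fin n) K] KM K n i where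
  toFun f := ⟨fun W => if W.card = i then f W else 0, fun W hW => if_neg hW⟩
  map_add' f g := by ext1; ext1 W; by_cases h : W.card = i <;> simp [h]
  map_smul' c f := by ext1; ext1 W; by_cases h : W.card = i <;> simp [h]

theorem KR_of (i : ℕ) (f : KM K n i) : KR K n i f.1 = f := by
  ext1; ext1 W
  by_cases h : W.card = i
  · exact if_pos h
  · exact (if_neg h).trans (f.2 W h).symm

instance (i : ℕ) : Module.Projective (MvPolynomial (Fin n) K) (KM K n i) :=
  Module.Projective.of_split (KM K n i).subtype (KR K n i) (LinearMap.ext fun f => KR_of i f)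

theorem KD_mem (t i : ℕ) (f : Finset (Fin n) → MvPolynomial (Fin n) K) (hf : f ∈ KM K n (i+1)) :
    KD K t f ∈ KM K n i := by
  intro U hU
  rw [KD_apply]
  refine Finset.sum_eq_zero fun w hw => ?_
  rw [hf, mul_zero]
  rw [Finset.card_insert_of_notMem (Finset.mem_compl.1 hw)]
  omega

theorem KH_mem (t i : ℕ) (f : Finset (Fin n) → MvPolynomial (Fin n) K) (hf : f ∈ KM K n i) :
    KH t f ∈ KM K n (i+1) := by
  intro W hW
  rw [KH]
  split_ifs with h
  · have : f (W.erase (W.min' h)) = 0 := hf _ (by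
      rw [Finset.card_erase_of_mem (Finset.min'_mem _ _)]
      have := h.card_pos
      omega)
    rw [this]
    refine Finset.sum_eq_zero fun α _ => ?_
    simp
  · rfl

theorem KD_zero (t : ℕ) (f : Finset (Fin n) → MvPolynomial (Fin n) K) (hf : f ∈ KM K n 0) :
    KD K t f = 0 := by
  ext1 U
  rw [KD_apply]
  refine Finset.sum_eq_zero fun w hw => ?_
  rw [hf, mul_zero]
  rw [Finset.card_insert_of_notMem (Finset.mem_compl.1 hw)]
  omega

/-- differential -/
def Kd (K : Type) [Field K] (n t i : ℕ) : KM K n (i+1) →ₗ[MvPolynomial (Fin n) K] KM K n i :=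
  (KD K t).restrict (KD_mem t i)

/-- upper set -/
def UJ (n t : ℕ) : UpperSet (Fin n →₀ ℕ) :=
  ⟨{a | ∃ i, t ≤ a i}, fun _ _ h ⟨i, h'⟩ => ⟨i, le_trans h' (h i)⟩⟩

/-- the ideal of `t`-th powers of variables -/
def J (K : Type) [Field K] (n t : ℕ) : Ideal (MvPolynomial (Fin n) K) := MI K (UJ n t)

theorem J_mono {t T : ℕ} (h : t ≤ T) : J K n T ≤ J K n t := by
  intro p hp a ha
  obtain ⟨i, hi⟩ := hp a ha
  exact ⟨i, h.trans hi⟩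

theorem mono_mem_J (t : ℕ) (w : Fin n) (c : K) : monomial (Finsupp.single w t) c ∈ J K n t := by
  intro a ha
  rw [coeff_monomial] at ha
  split_ifs at ha with h
  · exact ⟨w, by simp [← h]⟩
  · exact absurd rfl ha

theorem pow_le_J (t : ℕ) : maxIdeal K n ^ (n * t + 1) ≤ J K n t := by
  rw [maxIdeal_eq, PF_pow]
  intro p hp a ha
  have h : n * t + 1 ≤ wt Finset.univ a := hp a ha
  by_contra hc
  have h1 : ∀ i, a i ≤ t := by
    intro i
    by_contra h2
    exact hc ⟨i, by omega⟩
  have : wt Finset.univ a ≤ n * t := by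
    refine (Finset.sum_le_sum fun i _ => h1 i).trans ?_
    simp
  omega

theorem J_le_pow (t : ℕ) : J K n t ≤ maxIdeal K n ^ t := by
  rw [maxIdeal_eq, PF_pow]
  intro p hp a ha
  obtain ⟨i, hi⟩ := hp a ha
  exact hi.trans (Finset.single_le_sum (f := fun i => a i) (fun _ _ => Nat.zero_le _) (Finset.mem_univ i))

/-- Koszul complex -/
def KC (K : Type) [Field K] (n t : ℕ) : ChainComplex (ModuleCat.{0} (MvPolynomial (Fin n) K)) ℕ :=
  ChainComplex.of (fun i => ModuleCat.of _ (KM K n i)) (fun i => ModuleCat.ofHom (Kd K n t i)) (by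
    intro i
    ext1
    exact LinearMap.ext fun f => Subtype.ext (KD_KD t f.1))

theorem KC_d (t i : ℕ) : (KC K n t).d (i+1) i = ModuleCat.ofHom (Kd K n t i) :=
  ChainComplex.of_d (fun i => ModuleCat.of _ (KM K n i)) (fun i => ModuleCat.ofHom (Kd K n t i)) i

/-- augmentation -/
def Kp (K : Type) [Field K] (n t : ℕ) : KM K n 0 →ₗ[MvPolynomial (Fin n) K] (MvPolynomial (Fin n) K ⧸ J K n t) :=
  (J K n t).mkQ.comp ((LinearMap.proj ∅).comp (KM K n 0).subtype)

theorem Kp_comp (t : ℕ) : (KC K n t).d 1 0 ≫ ModuleCat.ofHom (Kp K n t) = 0 := by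
  rw [KC_d]
  ext f
  change (J K n t).mkQ (KD K t f.1 ∅) = 0
  rw [Submodule.mkQ_apply, Submodule.Quotient.mk_eq_zero, KD_apply]
  exact Ideal.sum_mem _ fun w _ => Ideal.mul_mem_right _ _ (mono_mem_J t w _)

theorem Kexact0 (t : ℕ) (f : KM K n 0) (hf : Kp K n t f = 0) : ∃ g, Kd K n t 0 g = f := by
  have hf' : f.1 ∅ ∈ J K n t := (Submodule.Quotient.mk_eq_zero _).1 hf
  refine ⟨⟨KH t f.1, KH_mem t 0 f.1 f.2⟩, Subtype.ext (KD_KH t f.1 (KD_zero t f.1 f.2) ?_)⟩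
  intro β hβ
  by_contra h
  obtain ⟨i, hi⟩ := hf' β h
  exact absurd (hβ i) (not_lt.2 hi)

theorem Kexact (t i : ℕ) (f : KM K n (i+1)) (hf : Kd K n t i f = 0) : ∃ g, Kd K n t (i+1) g = f := by
  refine ⟨⟨KH t f.1, KH_mem t (i+1) f.1 f.2⟩, Subtype.ext (KD_KH t f.1 (congrArg Subtype.val hf) ?_)⟩
  intro β hβ
  rw [f.2 ∅ (by simp), coeff_zero]

theorem Kp_surj (t : ℕ) : Function.Surjective (Kp K n t) := by
  intro y
  obtain ⟨p, rfl⟩ := Submodule.Quotient.mk_surjective _ y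
  exact ⟨KR K n 0 (fun _ => p), congrArg (Submodule.Quotient.mk) (show (KR K n 0 (fun _ => p)).1 ∅ = p from if_pos (c := (∅ : Finset (Fin n)).card = 0) (e := 0) (by simp))⟩

/-- the Koszul resolution -/
def KP (K : Type) [Field K] (n t : ℕ) :
    ProjectiveResolution (ModuleCat.of (MvPolynomial (Fin n) K) (MvPolynomial (Fin n) K ⧸ J K n t)) :=
  mkRes (KC K n t) (fun i => (inferInstance : Projective (ModuleCat.of (MvPolynomial (Fin n) K) (KM K n i))))
    (ModuleCat.ofHom (Kp K n t)) (Kp_comp t) (Kp_surj t)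
    (fun f hf => (Kexact0 t f hf).imp fun g hg => (ConcreteCategory.congr_hom (KC_d t 0) g).trans hg)
    (fun i f hf => (Kexact t i f ((ConcreteCategory.congr_hom (KC_d t i) f).symm.trans hf)).imp
      fun g hg => (ConcreteCategory.congr_hom (KC_d t (i+1)) g).trans hg)

theorem KP_d (t i : ℕ) : (KP K n t).complex.d (i+1) i = ModuleCat.ofHom (Kd K n t i) := KC_d t i

theorem KP_π (t : ℕ) : (KP K n t).π.f 0 = ModuleCat.ofHom (Kp K n t) :=
  ChainComplex.toSingle₀Equiv_symm_apply_f_zero _ _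

/-- comparison map -/
def Kc (K : Type) [Field K] (n s i : ℕ) : KM K n i →ₗ[MvPolynomial (Fin n) K] KM K n i :=
  LinearMap.restrict (LinearMap.pi fun W => (monomial (∑ w ∈ W, Finsupp.single w s) (1:K)) • LinearMap.proj W)
    (fun f hf W hW => by simp [hf W hW])

theorem Kc_apply (s i : ℕ) (f : KM K n i) (W) : (Kc K n s i f).1 W = monomial (∑ w ∈ W, Finsupp.single w s) (1:K) * f.1 W := rfl

theorem Kc_comm (s t i : ℕ) (f : KM K n (i+1)) :
    Kd K n t i (Kc K n s (i+1) f) = Kc K n s i (Kd K n (t+s) i f) := by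
  ext1; ext1 U
  rw [Kc_apply]
  change KD K t (Kc K n s (i+1) f).1 U = _ * KD K (t+s) f.1 U
  rw [KD_apply, KD_apply, Finset.mul_sum]
  refine Finset.sum_congr rfl fun w hw => ?_
  rw [Kc_apply, Finset.sum_insert (Finset.mem_compl.1 hw), ← mul_assoc, ← mul_assoc, monomial_mul, monomial_mul,
    ← add_assoc, ← Finsupp.single_add, mul_one, one_mul, add_comm]

/-- comparison chain map -/
def Kφ (K : Type) [Field K] (n s t : ℕ) : (KP K n (t+s)).complex ⟶ (KP K n t).complex where
  f i := ModuleCat.ofHom (Kc K n s i)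
  comm' i j h := by
    obtain rfl : j + 1 = i := h
    rw [KP_d, KP_d]
    ext1
    exact LinearMap.ext fun f => Kc_comm s t j f

theorem Kφ_comm (s t : ℕ) (h : J K n (t+s) ≤ J K n t) :
    (Kφ K n s t).f 0 ≫ (KP K n t).π.f 0 = (KP K n (t+s)).π.f 0 ≫ qtr h := by
  rw [KP_π, KP_π]
  ext1
  refine LinearMap.ext fun f => ?_
  change (J K n t).mkQ ((Kc K n s 0 f).1 ∅) = (J K n t).mkQ (f.1 ∅)
  refine congrArg _ ((Kc_apply s 0 f ∅).trans ?_)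
  rw [Finset.sum_empty, monomial_zero', C_1, one_mul]
end
end EX

namespace EX
noncomputable section
open MvPolynomial
variable {K : Type} [Field K] {n : ℕ}

theorem Ext_comp {R : Type} [CommRing R] (i : ℕ) {X X' X'' M : ModuleCat.{0} R} (f : X ⟶ X') (g : X' ⟶ X'')
    (e : ((Ext R (ModuleCat.{0} R) i).obj (op X'')).obj M) :
    ((Ext R (ModuleCat.{0} R) i).map f.op).app M (((Ext R (ModuleCat.{0} R) i).map g.op).app M e) =
      ((Ext R (ModuleCat.{0} R) i).map (f ≫ g).op).app M e := by
  rw [op_comp, Functor.map_comp]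
  rfl

theorem qtr_comp {R : Type} [CommRing R] {I I' I'' : Ideal R} (h : I ≤ I') (h' : I' ≤ I'') :
    qtr h ≫ qtr h' = qtr (h.trans h') := by
  ext1
  refine LinearMap.ext fun x => ?_
  obtain ⟨x, rfl⟩ := Submodule.Quotient.mk_surjective _ x
  rfl

theorem transport (I : Ideal (MvPolynomial (Fin n) K)) (r : ℕ) (x : MvPolynomial (Fin n) K) (t : ℕ)
    (c : KM K n (r+1) →ₗ[MvPolynomial (Fin n) K] (MvPolynomial (Fin n) K ⧸ I))
    (hc : ∀ f, c (Kd K n t (r+1) f) = 0) (hq : ∀ y : locCoh K (r+1) I, x • y = 0) :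
    ∃ s, ∃ g : KM K n r →ₗ[MvPolynomial (Fin n) K] (MvPolynomial (Fin n) K ⧸ I),
      ∀ f, x • c (Kc K n s (r+1) f) = g (Kd K n (t+s) r f) := by
  let M : ModuleCat.{0} (MvPolynomial (Fin n) K) := ModuleCat.of _ (MvPolynomial (Fin n) K ⧸ I)
  let c' : (KP K n t).complex.X (r+1) ⟶ M := ModuleCat.ofHom c
  obtain ⟨e, he⟩ := exists_cls (KP K n t) c' (by
    rw [KP_d]
    ext1
    exact LinearMap.ext hc)
  have h1 := he.smul _ x
  let e1 := ((Ext (MvPolynomial (Fin n) K) (ModuleCat.{0} _) (r+1)).map (qtr (pow_le_J (K := K) (n := n) t)).op).app M (x • e)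
  have h2 : lcι (maxIdeal K n) (r+1) M _ e1 = 0 := by
    have e2 : e1 = x • ((Ext (MvPolynomial (Fin n) K) (ModuleCat.{0} _) (r+1)).map (qtr (pow_le_J (K := K) (n := n) t)).op).app M e :=
      map_smul _ _ _
    rw [e2]
    exact (map_smul (lcι (maxIdeal K n) (r+1) M _).hom x _).trans (hq _)
  obtain ⟨T, hT, h3⟩ := lc_zero _ _ _ _ _ h2
  have hJ : J K n (t+T) ≤ maxIdeal K n ^ T := (J_mono (by omega)).trans (J_le_pow T)
  have h4 := congrArg (((Ext (MvPolynomial (Fin n) K) (ModuleCat.{0} _) (r+1)).map (qtr hJ).op).app M) h3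
  rw [map_zero, Ext_comp, qtr_comp, Ext_comp, qtr_comp] at h4
  have h5 := (IsCls.map (KP K n (t+T)) (qtr _) (KP K n t) (Kφ K n T t) (Kφ_comm T t _) h1).eq_zero_iff.1 h4
  obtain ⟨g, hg⟩ := h5
  refine ⟨T, g.hom, fun f => ?_⟩
  have h6 := ConcreteCategory.congr_hom hg f
  refine Eq.trans ?_ (h6.trans ?_)
  · rfl
  · have := ConcreteCategory.congr_hom (KP_d (K := K) (n := n) (t+T) r) f
    exact congrArg g this

theorem dim_ge {Δ : SimComplex n} {m : ℕ} (hm : 1 ≤ m) {F : Finset (Fin n)} (hF : Δ.IsFacet F) :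
    (F.card : WithBot ℕ∞) ≤ ringKrullDim (MvPolynomial (Fin n) K ⧸ SRSymbPow K Δ m) := by
  rw [← dim_quot (K := K) F]
  exact ringKrullDim_le_of_surjective _ (Ideal.Quotient.factor_surjective (SR_le_PF hm hF subset_rfl))

open Classical in
theorem KD_single (t : ℕ) (W : Finset (Fin n)) : KD K t (Pi.single W 1) =
    ∑ w ∈ W, monomial (Finsupp.single w t) (sg K w (W.erase w)) • (Pi.single (W.erase w) 1 : Finset (Fin n) → MvPolynomial (Fin n) K) := by
  ext1 U
  rw [KD_apply, Finset.sum_apply]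
  simp only [Pi.smul_apply, Pi.single_apply, smul_eq_mul, mul_ite, mul_one, mul_zero]
  rw [← Finset.sum_filter, ← Finset.sum_filter]
  have : Uᶜ.filter (fun w => insert w U = W) = W.filter (fun w => U = W.erase w) := by
    ext w
    simp only [Finset.mem_filter, Finset.mem_compl]
    constructor
    · rintro ⟨h1, rfl⟩; simp [h1]
    · rintro ⟨h1, rfl⟩; simp [h1]
  rw [this]
  refine Finset.sum_congr rfl fun w hw => ?_
  rw [← (Finset.mem_filter.1 hw).2]

/-- exponent -/
def exq (G : Finset (Fin n)) (a : Fin n →₀ ℕ) (T : ℕ) : Fin n →₀ ℕ := a + ∑ w ∈ G, Finsupp.single w (T-2)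

theorem exq_mem (G : Finset (Fin n)) (a : Fin n →₀ ℕ) (T : ℕ) {i : Fin n} (hi : i ∈ G) : exq G a T i = a i + (T - 2) := by
  classical
  rw [exq, Finsupp.add_apply, Finsupp.finsetSum_apply]
  simp only [Finsupp.single_apply, Finset.sum_ite_eq', if_pos hi]

theorem exq_wt (G F : Finset (Fin n)) (a : Fin n →₀ ℕ) (T : ℕ) (h : G ⊆ F) : wt Fᶜ (exq G a T) = wt Fᶜ a := by
  classical
  refine Finset.sum_congr rfl fun i hi => ?_
  have hi' : i ∉ G := fun h' => (Finset.mem_compl.1 hi) (h h')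
  rw [exq, Finsupp.add_apply, Finsupp.finsetSum_apply]
  simp only [Finsupp.single_apply, Finset.sum_ite_eq', if_neg hi', add_zero]

open Classical in
/-- Koszul cocycle -/
def cc (K : Type) [Field K] (G : Finset (Fin n)) (a : Fin n →₀ ℕ) (A : Set (Fin n)) (T : ℕ) (W : Finset (Fin n)) : MvPolynomial (Fin n) K :=
  ∑ v ∈ Gᶜ, if W = insert v G ∧ v ∈ A then monomial (exq G a T + Finsupp.single v T) (sg K v G) else 0

open Classical in
theorem cc_insert {G : Finset (Fin n)} (a : Fin n →₀ ℕ) (A : Set (Fin n)) (T : ℕ) {v : Fin n} (hv : v ∉ G) :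
    cc K G a A T (insert v G) = if v ∈ A then monomial (exq G a T + Finsupp.single v T) (sg K v G) else 0 := by
  rw [cc, Finset.sum_eq_single v]
  · simp
  · intro w hw hwv
    rw [if_neg]
    rintro ⟨h, -⟩
    exact hwv ((Finset.insert_inj hv).1 h).symm
  · intro h; exact absurd (Finset.mem_compl.2 hv) h

theorem cc_ne {G : Finset (Fin n)} {a : Fin n →₀ ℕ} {A : Set (Fin n)} {T : ℕ} {W : Finset (Fin n)}
    (h : cc K G a A T W ≠ 0) : ∃ v, v ∉ G ∧ v ∈ A ∧ W = insert v G := by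
  obtain ⟨v, hv, h⟩ := Finset.exists_ne_zero_of_sum_ne_zero h
  by_cases h' : W = insert v G ∧ v ∈ A
  · exact ⟨v, Finset.mem_compl.1 hv, h'.2, h'.1⟩
  · rw [if_neg h'] at h; exact absurd rfl h

theorem cc_shift {G : Finset (Fin n)} (a : Fin n →₀ ℕ) (A : Set (Fin n)) (t s : ℕ) (ht : 2 ≤ t) (W : Finset (Fin n)) :
    cc K G a A t W * monomial (∑ w ∈ W, Finsupp.single w s) (1:K) = cc K G a A (t+s) W := by
  classical
  rw [cc, cc, Finset.sum_mul]
  refine Finset.sum_congr rfl fun v hv => ?_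
  split_ifs with h
  · rw [h.1, Finset.sum_insert (Finset.mem_compl.1 hv), monomial_mul, mul_one]
    congr 1
    rw [exq, exq, show t + s - 2 = (t - 2) + s by omega]
    simp only [Finsupp.single_add, Finset.sum_add_distrib]
    abel_nf
  · rw [zero_mul]

theorem cc_cocycle {Δ : SimComplex n} {m : ℕ} {G : Finset (Fin n)} {a : Fin n →₀ ℕ} {A : Set (Fin n)}
    (hA : ∀ p ∈ A, ∀ q ∉ A, p ∉ G → q ∉ G → ∀ F, Δ.IsFacet F → insert p (insert q G) ⊆ F → m ≤ wt Fᶜ a)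
    {t : ℕ} (ht : m + 2 ≤ t) (Y : Finset (Fin n)) :
    ∑ w ∈ Y, monomial (Finsupp.single w t) (sg K w (Y.erase w)) * cc K G a A t (Y.erase w) ∈ SRSymbPow K Δ m := by
  classical
  by_cases h : ∃ w ∈ Y, cc K G a A t (Y.erase w) ≠ 0
  · obtain ⟨w, hw, h⟩ := h
    obtain ⟨v, hvG, hvA, hY⟩ := cc_ne h
    have hwv : w ∉ insert v G := by rw [← hY]; simp
    have hY' : Y = insert w (insert v G) := by rw [← hY, Finset.insert_erase hw]
    rw [Finset.mem_insert, not_or] at hwv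
    have e1 : Y.erase v = insert w G := by
      rw [hY', Finset.insert_comm, Finset.erase_insert (by simp [Ne.symm hwv.1, hvG])]
    have h0 : ∑ u ∈ G, monomial (Finsupp.single u t) (sg K u (Y.erase u)) * cc K G a A t (Y.erase u) = 0 := by
      refine Finset.sum_eq_zero fun u hu => ?_
      by_contra hne
      obtain ⟨v', -, -, h'⟩ := cc_ne (right_ne_zero_of_mul hne)
      have : u ∈ Y.erase u := by rw [h']; exact Finset.mem_insert_of_mem hu
      simp at this
    have e2 : ∀ f : Fin n → MvPolynomial (Fin n) K, ∑ u ∈ Y, f u = f w + (f v + ∑ u ∈ G, f u) := by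
      intro f
      rw [hY', Finset.sum_insert (by simpa using hwv), Finset.sum_insert hvG]
    rw [e2, h0, hY, e1, cc_insert a A t hvG, cc_insert a A t hwv.2, if_pos hvA, add_zero, monomial_mul]
    by_cases hwA : w ∈ A
    · rw [if_pos hwA, monomial_mul]
      have : Finsupp.single v t + (exq G a t + Finsupp.single w t) = Finsupp.single w t + (exq G a t + Finsupp.single v t) := by
        abel
      rw [this, ← map_add, mul_comm, sg_anti hwv.2 hvG hwv.1, mul_comm (sg K w G), neg_add_cancel, map_zero]
      exact zero_mem _
    · rw [if_neg hwA, mul_zero, add_zero]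
      refine mono_SR (fun F hF => ?_) _
      by_cases hs : insert v (insert w G) ⊆ F
      · refine (hA v hvA w hwA hvG hwv.2 F hF hs).trans (wt_mono _ ?_)
        intro i
        simp only [exq, Finsupp.add_apply]
        omega
      · rw [Finset.not_subset] at hs
        obtain ⟨i, hi, hiF⟩ := hs
        refine le_trans ?_ (le_wt hiF)
        simp only [Finsupp.add_apply]
        rcases Finset.mem_insert.1 hi with rfl | hi
        · simp only [Finsupp.single_eq_same]; omega
        rcases Finset.mem_insert.1 hi with rfl | hi
        · simp only [Finsupp.single_eq_same]; omega
        · rw [exq_mem G a t hi]; omega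
  · push Not at h
    rw [Finset.sum_eq_zero fun w hw => by rw [h w hw, mul_zero]]
    exact zero_mem _
end
end EX

namespace EX
noncomputable section
open MvPolynomial
variable {K : Type} [Field K] {n : ℕ}

/-- evaluation of a cochain -/
def ev (c : Finset (Fin n) → MvPolynomial (Fin n) K) :
    (Finset (Fin n) → MvPolynomial (Fin n) K) →ₗ[MvPolynomial (Fin n) K] MvPolynomial (Fin n) K :=
  ∑ W, c W • LinearMap.proj W

theorem ev_apply (c f : Finset (Fin n) → MvPolynomial (Fin n) K) : ev c f = ∑ W, c W * f W := by
  simp [ev]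

open Classical in
theorem ev_single (c : Finset (Fin n) → MvPolynomial (Fin n) K) (W : Finset (Fin n)) : ev c (Pi.single W 1) = c W := by
  rw [ev_apply]
  simp [Pi.single_apply]

theorem coeff_key {Δ : SimComplex n} {m : ℕ} {G : Finset (Fin n)} {a : Fin n →₀ ℕ} {A : Set (Fin n)} {j : Fin n}
    (aG : ∀ i ∈ G, a i = 0) {T : ℕ} (hT : 2 ≤ T) (γ : Finset (Fin n) → MvPolynomial (Fin n) K)
    {v : Fin n} (hvG : v ∉ G) {F : Finset (Fin n)} (hF : Δ.IsFacet F) (hvF : insert v G ⊆ F)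
    (hFa : wt Fᶜ (Finsupp.single j 1 + a) < m)
    (h : X j * cc K G a A T (insert v G) - ∑ w ∈ insert v G, monomial (Finsupp.single w T)
      (sg K w ((insert v G).erase w)) * γ ((insert v G).erase w) ∈ SRSymbPow K Δ m) :
    (open Classical in if v ∈ A then (1:K) else 0) = coeff (Finsupp.single j 1 + exq G a T) (γ G) := by
  classical
  have hGF : G ⊆ F := (Finset.subset_insert _ _).trans hvF
  have hvF' : v ∈ F := hvF (Finset.mem_insert_self _ _)
  have h1 := coeff_SR h hF (e := Finsupp.single j 1 + exq G a T + Finsupp.single v T) (by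
    rw [wt_add, wt_add, exq_wt G F a T hGF, wt_single Fᶜ v, if_neg (by simpa using hvF'), ← wt_add]
    exact hFa)
  rw [coeff_sub, Finset.sum_insert hvG, Finset.erase_insert hvG, coeff_add, coeff_sum,
    Finset.sum_eq_zero, add_zero, cc_insert a A T hvG, coeff_monomial_mul',
      if_pos (c := Finsupp.single v T ≤ Finsupp.single j 1 + exq G a T + Finsupp.single v T) le_add_self, add_tsub_cancel_right] at h1
  · have h2 : coeff (Finsupp.single j 1 + exq G a T + Finsupp.single v T)
        (X j * if v ∈ A then monomial (exq G a T + Finsupp.single v T) (sg K v G) else 0) =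
        sg K v G * if v ∈ A then (1:K) else 0 := by
      rw [add_assoc, coeff_X_mul]
      split_ifs <;> simp
    rw [h2, ← mul_sub] at h1
    exact sub_eq_zero.1 ((mul_eq_zero.1 h1).resolve_left (sg_ne v G))
  · intro w hw
    rw [coeff_monomial_mul', if_neg]
    rw [Finsupp.single_le_iff, Finsupp.add_apply, Finsupp.add_apply, exq_mem G a T hw, aG w hw]
    have hwv : v ≠ w := fun h => hvG (h ▸ hw)
    rw [Finsupp.single_apply, Finsupp.single_apply, if_neg hwv]
    split_ifs <;> omega

theorem qB_contra {Δ : SimComplex n} {m d : ℕ} (hm : 3 ≤ m) (s : SD Δ m) (hs : s.G.card + 2 ≤ d)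
    (hfac : ∀ F, Δ.IsFacet F ↔ F ∈ Δ.faces ∧ F.card = d) (h : IsQuasiBuchsbaum K (SRSymbPow K Δ m)) : False := by
  classical
  obtain ⟨G, a, A, j, aG, v, hvA, hvG, F, hF, hvF, hFa, v', hvA', hvG', F', hF', hvF', hFa', hA⟩ := s
  simp only at hs
  set I := SRSymbPow K Δ m with hI
  have hdim : ((G.card + 1 : ℕ) : WithBot ℕ∞) < ringKrullDim (MvPolynomial (Fin n) K ⧸ I) := by
    refine lt_of_lt_of_le ?_ (dim_ge (by omega) hF)
    rw [((hfac F).1 hF).2]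
    exact_mod_cast (by omega : G.card + 1 < d)
  have hx : (X j : MvPolynomial (Fin n) K) ∈ maxIdeal K n := Ideal.subset_span ⟨j, rfl⟩
  let c : (Finset (Fin n) → MvPolynomial (Fin n) K) →ₗ[MvPolynomial (Fin n) K] (MvPolynomial (Fin n) K ⧸ I) :=
    I.mkQ.comp (ev (cc K G a A (m+2)))
  have hc : c.comp (KD K (m+2)) = 0 := by
    refine LinearMap.pi_ext' fun Y => LinearMap.ext_ring ?_
    change I.mkQ (ev (cc K G a A (m+2)) (KD K (m+2) (Pi.single Y 1))) = 0
    rw [KD_single, map_sum, Submodule.mkQ_apply, Submodule.Quotient.mk_eq_zero]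
    simp only [map_smul, ev_single, smul_eq_mul]
    exact cc_cocycle hA le_rfl Y
  obtain ⟨s, g, hg⟩ := transport I G.card (X j) (m+2) (c.comp (KM K n (G.card+1)).subtype)
    (fun f => LinearMap.congr_fun hc f.1) (h _ hdim _ hx)
  have hγ : ∀ U : Finset (Fin n), ∃ p : MvPolynomial (Fin n) K, I.mkQ p = g (KR K n G.card (Pi.single U 1)) :=
    fun U => Submodule.mkQ_surjective _ _
  choose γ hγ using hγ
  have key : ∀ v, v ∉ G → X j * cc K G a A (m+2+s) (insert v G) - ∑ w ∈ insert v G, monomial (Finsupp.single w (m+2+s))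
      (sg K w ((insert v G).erase w)) * γ ((insert v G).erase w) ∈ I := by
    intro v hv
    have hmem : (Pi.single (insert v G) 1 : Finset (Fin n) → MvPolynomial (Fin n) K) ∈ KM K n (G.card+1) := by
      intro W hW
      rw [Pi.single_apply, if_neg]
      rintro rfl
      exact hW (Finset.card_insert_of_notMem hv)
    have h1 := hg ⟨_, hmem⟩
    have h2 : (c.comp (KM K n (G.card+1)).subtype) (Kc K n s (G.card+1) ⟨_, hmem⟩) =
        I.mkQ (cc K G a A (m+2+s) (insert v G)) := by
      refine congrArg I.mkQ ?_
      rw [← cc_shift a A (m+2) s (by omega), ev_apply]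
      refine (Finset.sum_eq_single (insert v G) ?_ ?_).trans ?_
      · intro W _ hW
        refine (congrArg _ (Kc_apply s _ _ W)).trans ?_
        simp [hW]
      · intro h; exact absurd (Finset.mem_univ _) h
      · refine (congrArg _ (Kc_apply s _ _ _)).trans ?_
        simp
    have h3 : g (Kd K n (m+2+s) G.card ⟨_, hmem⟩) = I.mkQ (∑ w ∈ insert v G, monomial (Finsupp.single w (m+2+s))
      (sg K w ((insert v G).erase w)) * γ ((insert v G).erase w)) := by
      rw [← KR_of G.card (Kd K n (m+2+s) G.card ⟨_, hmem⟩)]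
      change g (KR K n G.card (KD K (m+2+s) (Pi.single (insert v G) 1))) = _
      rw [KD_single, map_sum, map_sum, map_sum]
      refine Finset.sum_congr rfl fun w _ => ?_
      rw [map_smul, map_smul, ← hγ, ← smul_eq_mul, map_smul]
    rw [h2, h3, ← map_smul, ← sub_eq_zero, ← map_sub, Submodule.mkQ_apply, Submodule.Quotient.mk_eq_zero, smul_eq_mul] at h1
    exact h1
  have k1 := coeff_key aG (by omega) γ hvG hF hvF hFa (key v hvG)
  have k2 := coeff_key aG (by omega) γ hvG' hF' hvF' hFa' (key v' hvG')
  rw [if_pos hvA] at k1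
  rw [if_neg hvA', ← k1] at k2
  exact zero_ne_one k2

theorem pure_data {Δ : SimComplex n} (hV : ∀ i, {i} ∈ Δ.faces) (hpure : Δ.Pure) (hdim : 2 ≤ Δ.dim) :
    ∃ d, 3 ≤ d ∧ (∀ F, Δ.IsFacet F ↔ F ∈ Δ.faces ∧ F.card = d) ∧ (∀ Y ∈ Δ.faces, Y.card ≤ d) ∧
      (∃ F ∈ Δ.faces, F.card = d) ∧ (∀ F ∈ Δ.faces, ∃ F' ∈ Δ.faces, F ⊆ F' ∧ F'.card = d) := by
  classical
  have hbdd : BddAbove (Finset.card '' Δ.faces) := ⟨n, by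
    rintro _ ⟨F, -, rfl⟩
    simpa using Finset.card_le_univ F⟩
  have hd : 3 ≤ sSup (Finset.card '' Δ.faces) := by
    rw [SimComplex.dim] at hdim
    have : (2:ℤ) ≤ (sSup (Finset.card '' Δ.faces) : ℕ) - 1 := hdim
    omega
  have hne : (Finset.card '' Δ.faces).Nonempty := by
    rw [Set.nonempty_iff_ne_empty]
    intro h
    rw [h] at hd
    simp at hd
  obtain ⟨F0, hF0, hF0c⟩ := Nat.sSup_mem hne hbdd
  have hmax : ∀ Y ∈ Δ.faces, Y.card ≤ sSup (Finset.card '' Δ.faces) := fun Y hY => le_csSup hbdd ⟨Y, hY, rfl⟩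
  have hfm : ∀ F ∈ Δ.faces, F.card = sSup (Finset.card '' Δ.faces) → Δ.IsFacet F := by
    intro F hF hc
    exact ⟨hF, fun G hG hFG => Finset.eq_of_subset_of_card_le hFG (by rw [hc]; exact hmax G hG)⟩
  have hfac : ∀ F, Δ.IsFacet F ↔ F ∈ Δ.faces ∧ F.card = sSup (Finset.card '' Δ.faces) := by
    intro F
    refine ⟨fun h => ⟨h.1, ?_⟩, fun h => hfm F h.1 h.2⟩
    rw [hpure F F0 h (hfm F0 hF0 hF0c), hF0c]
  refine ⟨_, hd, hfac, hmax, ⟨F0, hF0, hF0c⟩, ?_⟩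
  intro F hF
  obtain ⟨F', hF', hm⟩ := Set.Finite.exists_le_maximal (Set.toFinite Δ.faces) hF
  have : Δ.IsFacet F' := ⟨hm.1, fun G hG h => le_antisymm h (hm.2 hG h)⟩
  exact ⟨F', hm.1, hF', ((hfac F').1 this).2⟩

theorem main_tfae (K : Type) [Field K] {n : ℕ} (Δ : SimComplex n) (hV : ∀ i, {i} ∈ Δ.faces) (hpure : Δ.Pure) (hdim : 2 ≤ Δ.dim) :
    List.TFAE [∀ m, 1 ≤ m → IsCohenMacaulayIdeal (SRSymbPow K Δ m), ∃ m, 3 ≤ m ∧ IsBuchsbaum K (SRSymbPow K Δ m),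
      ∃ m, 3 ≤ m ∧ IsQuasiBuchsbaum K (SRSymbPow K Δ m), Δ.IsMatroid] := by
  obtain ⟨d, hd, hfac, hmax, hne, hext⟩ := pure_data hV hpure hdim
  tfae_have 4 → 1 := fun hM m _ => mat_CM hM hfac hmax hne m
  tfae_have 4 → 2 := fun hM => ⟨3, le_rfl, mat_buch hM hfac hmax hne 3⟩
  tfae_have 2 → 3 := fun ⟨m, hm, h⟩ => ⟨m, hm, buch_quasi h⟩
  tfae_have 3 → 4 := by
    rintro ⟨m, hm, h⟩
    by_contra hnot
    obtain ⟨s, hs⟩ := exists_SD hd hfac hmax hext hnot hm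
    exact qB_contra hm s hs hfac h
  tfae_have 1 → 4 := by
    intro h
    by_contra hnot
    obtain ⟨s, hs⟩ := exists_SD hd hfac hmax hext hnot (le_refl 3)
    exact CM_contra le_rfl s hs hfac (h 3 (by omega))
  tfae_finish
end
end EX



/-- **Theorem.** For a pure complex `Δ` on `[n]` with `dim Δ ≥ 2`: all symbolic powers
of `I_Δ` are Cohen–Macaulay iff some `I_Δ^{(m)}`, `m ≥ 3`, is Buchsbaum iff some
`I_Δ^{(m)}`, `m ≥ 3`, is quasi-Buchsbaum iff `Δ` is a matroid. -/
theorem symbolic_powers_Buchsbaum_iff_matroid (K : Type) [Field K] {n : ℕ}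
    (Δ : SimComplex n)
    (hV : ∀ i : Fin n, ({i} : Finset (Fin n)) ∈ Δ.faces)
    (hpure : Δ.Pure) (hdim : 2 ≤ Δ.dim) :
    List.TFAE
      [∀ m : ℕ, 1 ≤ m → IsCohenMacaulayIdeal (SRSymbPow K Δ m),
       ∃ m : ℕ, 3 ≤ m ∧ IsBuchsbaum K (SRSymbPow K Δ m),
       ∃ m : ℕ, 3 ≤ m ∧ IsQuasiBuchsbaum K (SRSymbPow K Δ m),
       Δ.IsMatroid] := by
  exact EX.main_tfae K Δ hV hpure hdim
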